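/- Let 𝓛 be the rectangular lattice with basic half-periods ω₁ ∈ (0,∞) and ω₃ ∈ i(0,∞), and let ω = ω₂ = ω₁ + ω₃. Then all closed spectral gaps of the complex Lamé operator L = −d²/dx² + 2ω²℘(ωx+z₀) are located on the spectral arc extending to infinity. -/

import Mathlib

open Complex Set Filter

noncomputable section

/-- The period lattice with half-periods `w1`, `w3`, i.e. the set of all
`2 m w1 + 2 n w3` with `m n : ℤ`. -/
def latticeSet (w1 w3 : ℂ) : Set ℂ := {z | ∃ m n : ℤ, z = 2 * m * w1 + 2 * n * w3}

/-- Weierstrass data for a lattice `𝓛` with basic half-periods `w1`, `w3`: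
the functions `℘` (denoted `P`), `ζ` (denoted `Z`) and `σ` (denoted `S`),
characterized up to uniqueness by their standard analytic properties:
`℘` is `𝓛`-periodic, holomorphic off `𝓛`, with `℘(z) - 1/z² → 0` as `z → 0`;
`ζ` is odd with `ζ' = -℘`; `σ` is entire, non-vanishing off `𝓛`, with
`σ'/σ = ζ` and `σ(z)/z → 1` as `z → 0`. -/
structure WeierstrassData where
  w1 : ℂ
  w3 : ℂ
  P : ℂ → ℂ
  Z : ℂ → ℂ
  S : ℂ → ℂ
  w1_ne : w1 ≠ 0
  indep : ∀ r : ℝ, w3 ≠ (r : ℂ) * w1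
  P_diff : ∀ z ∉ latticeSet w1 w3, DifferentiableAt ℂ P z
  P_periodic : ∀ w ∈ latticeSet w1 w3, ∀ z, P (z + w) = P z
  P_pole : Tendsto (fun z => P z - 1 / z ^ 2) (nhdsWithin 0 {(0 : ℂ)}ᶜ) (nhds 0)
  Z_diff : ∀ z ∉ latticeSet w1 w3, DifferentiableAt ℂ Z z
  Z_deriv : ∀ z ∉ latticeSet w1 w3, deriv Z z = -P z
  Z_odd : ∀ z, Z (-z) = -Z z
  S_diff : Differentiable ℂ S
  S_ne : ∀ z ∉ latticeSet w1 w3, S z ≠ 0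
  S_deriv : ∀ z ∉ latticeSet w1 w3, deriv S z = Z z * S z
  S_norm : Tendsto (fun z => S z / z) (nhdsWithin 0 {(0 : ℂ)}ᶜ) (nhds 1)

namespace WeierstrassData

variable (W : WeierstrassData)

/-- The period lattice of `W`. -/
def lattice : Set ℂ := latticeSet W.w1 W.w3

/-- The third basic half-period `ω₂ = ω₁ + ω₃`. -/
def w2 : ℂ := W.w1 + W.w3

/-- `e₁ = ℘(ω₁)`. -/
def e1 : ℂ := W.P W.w1
/-- `e₂ = ℘(ω₂)`. -/
def e2 : ℂ := W.P W.w2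
/-- `e₃ = ℘(ω₃)`. -/
def e3 : ℂ := W.P W.w3

/-- The Rofe-Beketov spectrum of the complex Lamé operator
`L = -d²/dx² + m(m+1) ω² ℘(ωx + z₀)` in `L²(ℝ)`: the set of `λ ∈ ℂ` for which
the equation `Lψ = λψ` has a nonzero bounded solution on the whole real line. -/
def lameSpectrum (m : ℕ) (ω z0 : ℂ) : Set ℂ :=
  {lam | ∃ φ : ℝ → ℂ, φ ≠ 0 ∧ ContDiff ℝ 2 φ ∧
    (∀ x : ℝ, -deriv (deriv φ) x + (m * (m + 1) : ℂ) * ω ^ 2 * W.P (ω * x + z0) * φ x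
      = lam * φ x) ∧ ∃ C : ℝ, ∀ x : ℝ, ‖φ x‖ ≤ C}

/-- The function `u(k) = Re[η k - ω ζ(k)]`, where `η = ζ(ω)`. -/
def uFun (ω : ℂ) : ℂ → ℝ := fun k => (W.Z ω * k - ω * W.Z k).re

/-- The function `v(k) = Im[η k - ω ζ(k)]`, where `η = ζ(ω)`. -/
def vFun (ω : ℂ) : ℂ → ℝ := fun k => (W.Z ω * k - ω * W.Z k).im

end WeierstrassData




/-- A *closed spectral gap* of the complex Lamé operator (with `m = 1` and
half-period `ω`): a point `λ = -ω²℘(k)` of the spectrum (`u(k) = 0`) at which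
two linearly independent periodic or antiperiodic Floquet solutions coexist
(`v(k) = pπ/2` for some integer `p`), other than the endpoints
`-ω²e₁, -ω²e₂, -ω²e₃` of the spectral arcs. -/
def WeierstrassData.IsClosedGap (W : WeierstrassData) (ω lam : ℂ) : Prop :=
  (∃ k : ℂ, k ∉ W.lattice ∧ W.uFun ω k = 0 ∧
    (∃ p : ℤ, W.vFun ω k = p * Real.pi / 2) ∧ lam = -ω ^ 2 * W.P k) ∧
  lam ∉ ({-ω ^ 2 * W.e1, -ω ^ 2 * W.e2, -ω ^ 2 * W.e3} : Set ℂ)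

section part1
open scoped Topology
namespace WeierstrassData

/-- The Mathlib period pair of the lattice. -/
def per (W : WeierstrassData) : PeriodPair where
  ω₁ := 2 * W.w1
  ω₂ := 2 * W.w3
  indep := by
    rw [LinearIndependent.pair_iff]
    intro s t h
    simp only [Complex.real_smul] at h
    have ht : t = 0 := by
      by_contra ht
      apply W.indep (-s / t)
      have : (t : ℂ) ≠ 0 := by exact_mod_cast ht
      push_cast
      field_simp
      linear_combination h / 2
    subst ht
    have : (s : ℂ) * (2 * W.w1) = 0 := by simpa using h
    rcases mul_eq_zero.1 this with h | h
    · exact ⟨by exact_mod_cast h, rfl⟩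
    · exact absurd h (by simp [W.w1_ne])

variable (W : WeierstrassData)

theorem mem_per {z : ℂ} : z ∈ W.per.lattice ↔ z ∈ W.lattice := by
  rw [PeriodPair.mem_lattice]
  constructor
  · rintro ⟨m, n, h⟩
    exact ⟨m, n, by rw [← h]; simp only [per]; ring⟩
  · rintro ⟨m, n, h⟩
    exact ⟨m, n, by rw [h]; simp only [per]; ring⟩

theorem lattice_eq : W.lattice = (W.per.lattice : Set ℂ) := by
  ext z; exact W.mem_per.symm

theorem zero_mem : (0 : ℂ) ∈ W.lattice := W.mem_per.1 (Submodule.zero_mem _)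
theorem add_mem {x y : ℂ} (hx : x ∈ W.lattice) (hy : y ∈ W.lattice) : x + y ∈ W.lattice :=
  W.mem_per.1 (Submodule.add_mem _ (W.mem_per.2 hx) (W.mem_per.2 hy))
theorem sub_mem {x y : ℂ} (hx : x ∈ W.lattice) (hy : y ∈ W.lattice) : x - y ∈ W.lattice :=
  W.mem_per.1 (Submodule.sub_mem _ (W.mem_per.2 hx) (W.mem_per.2 hy))
theorem neg_mem {x : ℂ} (hx : x ∈ W.lattice) : -x ∈ W.lattice :=
  W.mem_per.1 (Submodule.neg_mem _ (W.mem_per.2 hx))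
theorem neg_mem_iff {x : ℂ} : -x ∈ W.lattice ↔ x ∈ W.lattice :=
  ⟨fun h => by simpa using W.neg_mem h, W.neg_mem⟩
theorem add_mem_iff {x l : ℂ} (hl : l ∈ W.lattice) : x + l ∈ W.lattice ↔ x ∈ W.lattice :=
  ⟨fun h => by simpa using W.sub_mem h hl, fun h => W.add_mem h hl⟩

theorem isClosed_lattice : IsClosed W.lattice := by
  rw [lattice_eq]; exact W.per.isClosed_lattice
theorem isOpen_compl : IsOpen W.latticeᶜ := W.isClosed_lattice.isOpen_compl
theorem countable_lattice : W.lattice.Countable := by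
  have : W.lattice = Set.range (fun p : ℤ × ℤ => (2 * p.1 * W.w1 + 2 * p.2 * W.w3 : ℂ)) := by
    ext z; constructor
    · rintro ⟨m, n, h⟩; exact ⟨(m, n), h.symm⟩
    · rintro ⟨⟨m, n⟩, h⟩; exact ⟨m, n, h.symm⟩
  rw [this]; exact Set.countable_range _
theorem isPreconnected_compl : IsPreconnected W.latticeᶜ :=
  (W.countable_lattice.isConnected_compl_of_one_lt_rank (by simp)).isPreconnected

theorem eventually_notMem (z0 : ℂ) : ∀ᶠ z in 𝓝[≠] z0, z ∉ W.lattice := by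
  have h := W.per.compl_lattice_sdiff_singleton_mem_nhds z0
  rw [eventually_nhdsWithin_iff]
  filter_upwards [h] with z hz hne hmem
  exact hz ⟨W.mem_per.2 hmem, hne⟩

theorem half1_notMem : W.w1 ∉ W.lattice := fun h => by
  have := W.per.ω₁_div_two_notMem_lattice
  apply this; rw [mem_per]; simpa [per] using h
theorem half3_notMem : W.w3 ∉ W.lattice := fun h => by
  have := W.per.ω₂_div_two_notMem_lattice
  apply this; rw [mem_per]; simpa [per] using h
theorem half2_notMem : W.w2 ∉ W.lattice := fun h => by
  have := (W.per.mul_ω₁_add_mul_ω₂_mem_lattice (α := 1 / 2) (β := 1/2)).not.mpr (by norm_num)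
  apply this; rw [mem_per]; convert h using 1; simp [per, w2]
theorem two_w1_mem : 2 * W.w1 ∈ W.lattice := ⟨1, 0, by simp⟩
theorem two_w3_mem : 2 * W.w3 ∈ W.lattice := ⟨0, 1, by simp⟩
theorem two_w2_mem : 2 * W.w2 ∈ W.lattice := ⟨1, 1, by simp [w2]; ring⟩

/-- Liouville for elliptic functions. -/
theorem liouville (G : ℂ → ℂ) (hper : ∀ l ∈ W.lattice, ∀ z, G (z + l) = G z)
    (hloc : ∀ z0, (∀ᶠ z in 𝓝[≠] z0, DifferentiableAt ℂ G z) ∧ ∃ c, Tendsto G (𝓝[≠] z0) (𝓝 c)) :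
    ∃ c, (∀ z, ContinuousAt G z → G z = c) ∧
      (∀ z0 c', Tendsto G (𝓝[≠] z0) (𝓝 c') → c' = c) := by
  choose c hc using fun z0 => (hloc z0).2
  have hcu : ∀ z0 c', Tendsto G (𝓝[≠] z0) (𝓝 c') → c' = c z0 := fun z0 c' h =>
    tendsto_nhds_unique h (hc z0)
  have hcont : ∀ z, ContinuousAt G z → G z = c z := fun z hz =>
    hcu z _ (hz.tendsto.mono_left nhdsWithin_le_nhds)
  have han : ∀ z0, AnalyticAt ℂ c z0 := by
    intro z0
    have h1 : AnalyticAt ℂ (Function.update G z0 (c z0)) z0 := by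
      apply Complex.analyticAt_of_differentiable_on_punctured_nhds_of_continuousAt
      · have := (hloc z0).1
        filter_upwards [this, self_mem_nhdsWithin] with z hz hne
        apply hz.congr_of_eventuallyEq
        filter_upwards [isOpen_ne.mem_nhds hne] with w hw
        rw [Function.update_of_ne hw]
      · rw [continuousAt_update_same]; exact hc z0
    apply h1.congr
    have := (hloc z0).1
    rw [eventually_nhdsWithin_iff] at this
    filter_upwards [this] with z hz
    by_cases h : z = z0
    · subst h; simp
    · rw [Function.update_of_ne h]; exact hcont z (hz h).continuousAt
  have hd : Differentiable ℂ c := fun z => (han z).differentiableAt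
  have hp : ∀ z w, w ∈ W.per.lattice → c (z + w) = c z := by
    intro z l hl
    symm
    apply hcu
    have h1 : Tendsto (fun x => x - l) (𝓝[≠] (z + l)) (𝓝[≠] z) := by
      apply tendsto_nhdsWithin_of_tendsto_nhds_of_eventually_within
      · have : Tendsto (fun x => x - l) (𝓝 (z + l)) (𝓝 (z + l - l)) := by
          apply Continuous.tendsto; fun_prop
        rw [add_sub_cancel_right] at this
        exact this.mono_left nhdsWithin_le_nhds
      · filter_upwards [self_mem_nhdsWithin] with x hx h
        apply hx; simp only [mem_singleton_iff] at h ⊢; rw [← h]; ring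
    refine ((hc z).comp h1).congr ?_
    intro x
    simp only [Function.comp]
    rw [← hper l (W.mem_per.1 hl)]; ring_nf
  have hb := (IsZLattice.isCompact_range_of_periodic W.per.lattice c hd.continuous hp).isBounded
  have hconst := fun z => hd.apply_eq_apply_of_bounded hb z 0
  refine ⟨c 0, fun z hz => (hcont z hz).trans (hconst z), fun z0 c' h => (hcu z0 c' h).trans (hconst z0)⟩

/-- transport of local conditions along periods -/
theorem loc_transport (G : ℂ → ℂ) (hper : ∀ l ∈ W.lattice, ∀ z, G (z + l) = G z) (p l : ℂ)
    (hl : l ∈ W.lattice) (c : ℂ) (h : Tendsto G (𝓝[≠] p) (𝓝 c)) :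
    Tendsto G (𝓝[≠] (p + l)) (𝓝 c) := by
  have h1 : Tendsto (fun x => x - l) (𝓝[≠] (p + l)) (𝓝[≠] p) := by
    apply tendsto_nhdsWithin_of_tendsto_nhds_of_eventually_within
    · have : Tendsto (fun x => x - l) (𝓝 (p + l)) (𝓝 (p + l - l)) := by
        apply Continuous.tendsto; fun_prop
      rw [add_sub_cancel_right] at this
      exact this.mono_left nhdsWithin_le_nhds
    · filter_upwards [self_mem_nhdsWithin] with x hx h
      apply hx; simp only [mem_singleton_iff] at h ⊢; rw [← h]; ring
  refine (h.comp h1).congr ?_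
  intro x
  simp only [Function.comp]
  rw [← hper l hl]; ring_nf

/-- Liouville with only lattice singularities. -/
theorem liouville_zero (G : ℂ → ℂ) (hper : ∀ l ∈ W.lattice, ∀ z, G (z + l) = G z)
    (hd : ∀ z ∉ W.lattice, DifferentiableAt ℂ G z) (c : ℂ) (h0 : Tendsto G (𝓝[≠] 0) (𝓝 c)) :
    ∀ z ∉ W.lattice, G z = c := by
  obtain ⟨c', h1, h2⟩ := W.liouville G hper (by
    intro z0
    constructor
    · filter_upwards [W.eventually_notMem z0] with z hz using hd z hz
    · by_cases h : z0 ∈ W.lattice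
      · exact ⟨c, by simpa using W.loc_transport G hper 0 z0 h c h0⟩
      · exact ⟨G z0, (hd z0 h).continuousAt.tendsto.mono_left nhdsWithin_le_nhds⟩)
  intro z hz
  rw [h1 z (hd z hz).continuousAt, h2 0 c h0]

/-! ### identification with the Weierstrass function of Mathlib -/

theorem wp_pole : Tendsto (fun z => W.per.weierstrassP z - 1 / z ^ 2) (𝓝[≠] 0) (𝓝 0) := by
  have h := (W.per.analyticAt_weierstrassPExcept 0).continuousAt.tendsto
  have h0 : W.per.weierstrassPExcept 0 0 = 0 := by
    simp [PeriodPair.weierstrassPExcept]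
  rw [h0] at h
  refine (h.mono_left nhdsWithin_le_nhds).congr ?_
  intro z
  have := W.per.weierstrassPExcept_add (0 : W.per.lattice) z
  simp at this
  rw [← this]; simp

theorem P_eq {z : ℂ} (hz : z ∉ W.lattice) : W.P z = W.per.weierstrassP z := by
  have := W.liouville_zero (fun z => W.P z - W.per.weierstrassP z) ?_ ?_ 0 ?_ z hz
  · exact sub_eq_zero.1 this
  · intro l hl z
    have := W.per.weierstrassP_add_coe z ⟨l, W.mem_per.2 hl⟩
    simp only [] at this
    simp only [this, W.P_periodic l hl z]
  · intro z hz
    refine (W.P_diff z hz).sub ?_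
    exact (W.per.analyticOnNhd_weierstrassP z (by rwa [← lattice_eq])).differentiableAt
  · have := W.P_pole.sub W.wp_pole
    simpa using this

theorem P_analyticAt {z : ℂ} (hz : z ∉ W.lattice) : AnalyticAt ℂ W.P z := by
  have : DifferentiableOn ℂ W.P W.latticeᶜ := fun x hx => (W.P_diff x hx).differentiableWithinAt
  exact this.analyticAt (W.isOpen_compl.mem_nhds hz)
theorem Z_analyticAt {z : ℂ} (hz : z ∉ W.lattice) : AnalyticAt ℂ W.Z z := by
  have : DifferentiableOn ℂ W.Z W.latticeᶜ := fun x hx => (W.Z_diff x hx).differentiableWithinAt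
  exact this.analyticAt (W.isOpen_compl.mem_nhds hz)
theorem Z_hasDerivAt {z : ℂ} (hz : z ∉ W.lattice) : HasDerivAt W.Z (-W.P z) z := by
  rw [← W.Z_deriv z hz]; exact (W.Z_diff z hz).hasDerivAt
theorem S_hasDerivAt {z : ℂ} (hz : z ∉ W.lattice) : HasDerivAt W.S (W.Z z * W.S z) z := by
  rw [← W.S_deriv z hz]; exact (W.S_diff z).hasDerivAt

theorem P_even {z : ℂ} (hz : z ∉ W.lattice) : W.P (-z) = W.P z := by
  rw [W.P_eq hz, W.P_eq (by rwa [neg_mem_iff]), PeriodPair.weierstrassP_neg]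

/-- derivative of `℘` -/
def dP (z : ℂ) : ℂ := deriv W.P z

theorem P_hasDerivAt {z : ℂ} (hz : z ∉ W.lattice) : HasDerivAt W.P (W.dP z) z :=
  (W.P_diff z hz).hasDerivAt

theorem dP_eq {z : ℂ} (hz : z ∉ W.lattice) : W.dP z = W.per.derivWeierstrassP z := by
  unfold dP
  rw [← W.per.deriv_weierstrassP]
  apply EventuallyEq.deriv_eq
  filter_upwards [W.isOpen_compl.mem_nhds hz] with w hw using W.P_eq hw

theorem dP_sq_aux {z : ℂ} (hz : z ∉ W.lattice) :
    W.dP z ^ 2 = 4 * W.P z ^ 3 - W.per.g₂ * W.P z - W.per.g₃ := by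
  rw [W.dP_eq hz, W.P_eq hz]
  exact W.per.derivWeierstrassP_sq z (by rwa [mem_per])

theorem dP_odd {z : ℂ} (hz : z ∉ W.lattice) : W.dP (-z) = -W.dP z := by
  rw [W.dP_eq hz, W.dP_eq (by rwa [neg_mem_iff]), PeriodPair.derivWeierstrassP_neg]

theorem dP_periodic {z l : ℂ} (hz : z ∉ W.lattice) (hl : l ∈ W.lattice) :
    W.dP (z + l) = W.dP z := by
  rw [W.dP_eq hz, W.dP_eq (by rwa [W.add_mem_iff hl])]
  exact W.per.derivWeierstrassP_add_coe z ⟨l, W.mem_per.2 hl⟩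

theorem dP_half {w : ℂ} (hw : w ∉ W.lattice) (h2 : 2 * w ∈ W.lattice) : W.dP w = 0 := by
  have h1 := W.dP_periodic (z := -w) (l := 2 * w) (by rwa [neg_mem_iff]) h2
  rw [W.dP_odd hw] at h1
  have : -w + 2 * w = w := by ring
  rw [this] at h1
  linear_combination h1 / 2

theorem dP_analyticAt {z : ℂ} (hz : z ∉ W.lattice) : AnalyticAt ℂ W.dP z :=
  (W.P_analyticAt hz).deriv

/-! ### quasi-periodicity -/

theorem Z_quasi {l : ℂ} (hl : l ∈ W.lattice) : ∃ C, ∀ z ∉ W.lattice, W.Z (z + l) = W.Z z + C := by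
  have key : ∀ z ∈ W.latticeᶜ, HasDerivAt (fun z => W.Z (z + l) - W.Z z) 0 z := by
    intro z hz
    have h1 := (W.Z_hasDerivAt (z := z + l) (by rwa [W.add_mem_iff hl])).comp_add_const z l
    have := h1.sub (W.Z_hasDerivAt hz)
    rw [W.P_periodic l hl z, sub_self] at this
    exact this
  obtain ⟨a, ha⟩ := W.isOpen_compl.exists_is_const_of_deriv_eq_zero W.isPreconnected_compl
    (fun z hz => (key z hz).differentiableAt.differentiableWithinAt)
    (fun z hz => (key z hz).deriv)
  exact ⟨a, fun z hz => by rw [← ha z hz]; ring⟩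

theorem Z_half {w : ℂ} (hw : w ∉ W.lattice) (h2 : 2 * w ∈ W.lattice) {z : ℂ} (hz : z ∉ W.lattice) :
    W.Z (z + 2 * w) = W.Z z + 2 * W.Z w := by
  obtain ⟨C, hC⟩ := W.Z_quasi h2
  have h := hC (-w) (by rwa [neg_mem_iff])
  have e : -w + 2 * w = w := by ring
  rw [e, W.Z_odd] at h
  rw [hC z hz]; linear_combination -h

theorem Z_w2 : W.Z W.w2 = W.Z W.w1 + W.Z W.w3 := by
  have hd : W.w3 - W.w1 ∉ W.lattice := by
    rw [← W.add_mem_iff W.two_w1_mem]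
    convert W.half2_notMem using 2; simp [w2]; ring
  have h1 := W.Z_half W.half1_notMem W.two_w1_mem hd
  have h3 := W.Z_half W.half3_notMem W.two_w3_mem (z := -(W.w3 - W.w1)) (by rwa [neg_mem_iff])
  rw [W.Z_odd] at h3
  have e1 : W.w3 - W.w1 + 2 * W.w1 = W.w2 := by simp [w2]; ring
  have e3 : -(W.w3 - W.w1) + 2 * W.w3 = W.w2 := by simp [w2]; ring
  rw [e1] at h1; rw [e3] at h3
  linear_combination h1 / 2 + h3 / 2

theorem S_quasi {l : ℂ} (hl : l ∈ W.lattice) : ∃ C η : ℂ, C ≠ 0 ∧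
    ∀ z, W.S (z + l) = C * exp (η * z) * W.S z := by
  obtain ⟨η, hη⟩ := W.Z_quasi hl
  have key : ∀ z ∈ W.latticeᶜ, HasDerivAt (fun z => W.S (z + l) * exp (-η * z) / W.S z) 0 z := by
    intro z hz
    have hl' : z + l ∉ W.lattice := by rwa [W.add_mem_iff hl]
    have h1 := (W.S_hasDerivAt hl').comp_add_const z l
    have h2 : HasDerivAt (fun z => exp (-η * z)) (exp (-η * z) * (-η * 1)) z :=
      ((hasDerivAt_id z).const_mul (-η)).cexp
    have := (h1.mul h2).div (W.S_hasDerivAt hz) (W.S_ne z hz)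
    refine this.congr_deriv ?_
    rw [hη z hz]
    simp only [Pi.mul_apply]
    rw [div_eq_zero_iff]; left; ring
  obtain ⟨a, ha⟩ := W.isOpen_compl.exists_is_const_of_deriv_eq_zero W.isPreconnected_compl
    (fun z hz => (key z hz).differentiableAt.differentiableWithinAt)
    (fun z hz => (key z hz).deriv)
  have main : ∀ z ∈ W.latticeᶜ, W.S (z + l) = a * exp (η * z) * W.S z := by
    intro z hz
    have h := ha z hz
    have hS := W.S_ne z hz
    rw [div_eq_iff hS, neg_mul] at h
    calc W.S (z + l) = (W.S (z + l) * exp (-(η * z))) * exp (η * z) := by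
          rw [mul_assoc, ← exp_add]; simp
      _ = _ := by rw [h]; ring
  refine ⟨a, η, ?_, ?_⟩
  · intro h0
    have := main W.w1 W.half1_notMem
    rw [h0] at this
    simp only [zero_mul] at this
    exact W.S_ne _ (fun hm => W.half1_notMem ((W.add_mem_iff hl).1 hm)) this
  · have hcl : Dense (W.latticeᶜ) := by
      exact W.countable_lattice.dense_compl ℝ
    have hS := W.S_diff.continuous
    have := Continuous.ext_on hcl (f := fun z => W.S (z + l)) (g := fun z => a * exp (η * z) * W.S z)
      (by fun_prop) (by fun_prop) main
    exact fun z => congrFun this z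

theorem S_zero : W.S 0 = 0 := by
  have h1 : Tendsto (fun z => W.S z / z * z) (𝓝[≠] 0) (𝓝 (1 * 0)) :=
    W.S_norm.mul (tendsto_id.mono_left nhdsWithin_le_nhds)
  have h2 : Tendsto W.S (𝓝[≠] 0) (𝓝 (W.S 0)) :=
    (W.S_diff 0).continuousAt.tendsto.mono_left nhdsWithin_le_nhds
  have h3 : Tendsto W.S (𝓝[≠] 0) (𝓝 (1 * 0)) := by
    refine h1.congr' ?_
    filter_upwards [self_mem_nhdsWithin] with z hz
    field_simp [show z ≠ 0 from hz]
  simpa using tendsto_nhds_unique h2 h3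

theorem S_lattice {l : ℂ} (hl : l ∈ W.lattice) : W.S l = 0 := by
  obtain ⟨C, η, _, h⟩ := W.S_quasi hl
  have := h 0
  simpa [W.S_zero] using this

theorem S_eq_zero_iff {z : ℂ} : W.S z = 0 ↔ z ∈ W.lattice :=
  ⟨fun h => by_contra fun hz => W.S_ne z hz h, W.S_lattice⟩

theorem S_odd (z : ℂ) : W.S (-z) = -W.S z := by
  have key : ∀ z ∈ W.latticeᶜ, HasDerivAt (fun z => W.S (-z) / W.S z) 0 z := by
    intro z hz
    have hl' : -z ∉ W.lattice := by rwa [neg_mem_iff]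
    have h1 : HasDerivAt (fun z => W.S (-z)) (W.Z (-z) * W.S (-z) * (-1)) z := by
      have h0 : HasDerivAt (fun z : ℂ => -z) (-1) z := (hasDerivAt_id z).neg
      exact (W.S_hasDerivAt hl').comp z h0
    have := h1.div (W.S_hasDerivAt hz) (W.S_ne z hz)
    refine this.congr_deriv ?_
    rw [W.Z_odd, div_eq_zero_iff]; left; ring
  obtain ⟨a, ha⟩ := W.isOpen_compl.exists_is_const_of_deriv_eq_zero W.isPreconnected_compl
    (fun z hz => (key z hz).differentiableAt.differentiableWithinAt)
    (fun z hz => (key z hz).deriv)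
  have ha1 : a = -1 := by
    have hneg : Tendsto (fun z : ℂ => -z) (𝓝[≠] 0) (𝓝[≠] 0) := by
      apply tendsto_nhdsWithin_of_tendsto_nhds_of_eventually_within
      · have : Tendsto (fun z : ℂ => -z) (𝓝 0) (𝓝 (-0)) := continuous_neg.tendsto 0
        rw [neg_zero] at this
        exact this.mono_left nhdsWithin_le_nhds
      · filter_upwards [self_mem_nhdsWithin] with x hx
        simpa using hx
    have h1 := ((W.S_norm.comp hneg).div W.S_norm one_ne_zero).neg
    have h2 : Tendsto (fun _ : ℂ => a) (𝓝[≠] (0:ℂ)) (𝓝 (-(1/1))) := by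
      refine h1.congr' ?_
      filter_upwards [self_mem_nhdsWithin, W.eventually_notMem 0] with z hz hl
      rw [← ha z hl]
      have : z ≠ 0 := hz
      have := W.S_ne z hl
      simp only [Function.comp_apply, Pi.div_apply, Pi.neg_apply]
      field_simp
    have := tendsto_nhds_unique h2 tendsto_const_nhds
    rw [← this]; norm_num
  by_cases hz : z ∈ W.lattice
  · rw [W.S_lattice hz, W.S_lattice (W.neg_mem hz)]; simp
  · have := ha z hz
    rw [ha1, div_eq_iff (W.S_ne z hz)] at this
    rw [this]; ring

end WeierstrassData

end part1

section part2
open scoped Topology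
namespace WeierstrassData
variable (W : WeierstrassData)

theorem even_limit {N : ℂ → ℂ} (hN : AnalyticAt ℂ N 0) (hd : deriv N 0 = 0) :
    ∃ c, Tendsto (fun z => (N z - N 0) / z ^ 2) (𝓝[≠] 0) (𝓝 c) := by
  obtain ⟨p, hp⟩ := hN
  have h1 := hp.has_fpower_series_dslope_fslope
  have h2 := h1.has_fpower_series_dslope_fslope
  have hc := h2.continuousAt.tendsto.mono_left (nhdsWithin_le_nhds (s := {(0:ℂ)}ᶜ))
  refine ⟨_, hc.congr' ?_⟩
  filter_upwards [self_mem_nhdsWithin] with z hz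
  have hz' : z ≠ 0 := hz
  rw [dslope_of_ne _ hz', slope_def_field, dslope_same, dslope_of_ne _ hz', slope_def_field, hd]
  field_simp
  simp
  ring

theorem deriv_even {N : ℂ → ℂ} (h : ∀ᶠ z in 𝓝 0, N (-z) = N z) : deriv N 0 = 0 := by
  have h1 : deriv (fun z => N (-z)) 0 = deriv N 0 := EventuallyEq.deriv_eq h
  rw [deriv_comp_neg, neg_zero] at h1
  linear_combination -h1 / 2

/-- the function `σ(z)/z` -/
def sg (z : ℂ) : ℂ := dslope W.S 0 z

theorem sg_analyticAt : AnalyticAt ℂ W.sg 0 := by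
  obtain ⟨p, hp⟩ := W.S_diff.analyticAt 0
  exact ⟨_, hp.has_fpower_series_dslope_fslope⟩

theorem S_eq_sg (z : ℂ) : W.S z = z * W.sg z := by
  by_cases hz : z = 0
  · simp [hz, W.S_zero]
  · rw [sg, dslope_of_ne _ hz, slope_def_field, W.S_zero]; field_simp; simp; ring

theorem sg_ne {z : ℂ} (hz : z ≠ 0) : W.sg z = W.S z / z := by
  rw [W.S_eq_sg z]; field_simp

theorem sg_zero : W.sg 0 = 1 := by
  have h1 := W.sg_analyticAt.continuousAt.tendsto.mono_left (nhdsWithin_le_nhds (s := {(0:ℂ)}ᶜ))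
  refine tendsto_nhds_unique h1 (W.S_norm.congr' ?_)
  filter_upwards [self_mem_nhdsWithin] with z hz
  rw [W.sg_ne hz]

theorem sg_even (z : ℂ) : W.sg (-z) = W.sg z := by
  by_cases hz : z = 0
  · simp [hz]
  · rw [W.sg_ne hz, W.sg_ne (by simpa using hz), W.S_odd]; field_simp

theorem Z_expand : ∃ ρ : ℂ → ℂ, AnalyticAt ℂ ρ 0 ∧ ρ 0 = 0 ∧ deriv ρ 0 = 0 ∧
    ∀ᶠ z in 𝓝[≠] 0, W.Z z = 1 / z + ρ z := by
  have hs := W.sg_analyticAt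
  have hρ : AnalyticAt ℂ (fun z => deriv W.sg z / W.sg z) 0 :=
    hs.deriv.div hs (by rw [W.sg_zero]; exact one_ne_zero)
  have hZ : ∀ᶠ z in 𝓝[≠] 0, W.Z z = 1 / z + deriv W.sg z / W.sg z := by
    have h1 := hs.eventually_analyticAt
    filter_upwards [h1.filter_mono nhdsWithin_le_nhds, W.eventually_notMem 0, self_mem_nhdsWithin]
      with z hz hl hz0
    have hz0 : z ≠ 0 := hz0
    have hS : HasDerivAt W.S (1 * W.sg z + z * deriv W.sg z) z := by
      have := (hasDerivAt_id z).mul hz.differentiableAt.hasDerivAt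
      refine this.congr_of_eventuallyEq ?_
      filter_upwards with w using W.S_eq_sg w
    have h2 := hS.unique (W.S_hasDerivAt hl)
    have h3 := W.S_ne z hl
    rw [W.S_eq_sg z] at h3 h2
    have h4 : W.sg z ≠ 0 := right_ne_zero_of_mul h3
    field_simp
    linear_combination -h2
  refine ⟨_, hρ, ?_, ?_, hZ⟩
  · show deriv W.sg 0 / W.sg 0 = 0
    rw [deriv_even (Eventually.of_forall W.sg_even)]; simp
  · -- derivative is the limit of `1/z² - P`
    have hc := hρ.deriv.continuousAt.tendsto.mono_left (nhdsWithin_le_nhds (s := {(0:ℂ)}ᶜ))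
    refine tendsto_nhds_unique hc ?_
    have := W.P_pole.neg
    rw [neg_zero] at this
    refine this.congr' ?_
    rw [eventually_nhdsWithin_iff] at hZ
    have hZ' := hZ.eventually_nhds
    filter_upwards [hZ'.filter_mono nhdsWithin_le_nhds, W.eventually_notMem 0, self_mem_nhdsWithin]
      with z hz hl hz0
    have hz0 : z ≠ 0 := hz0
    symm
    have e : (fun z => deriv W.sg z / W.sg z) =ᶠ[𝓝 z] fun z => W.Z z - z⁻¹ := by
      filter_upwards [hz, isOpen_ne.mem_nhds hz0] with w hw hw0
      rw [hw hw0]; ring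
    rw [e.deriv_eq]
    have h := (W.Z_hasDerivAt hl).sub (hasDerivAt_inv hz0)
    rw [show (fun z => W.Z z - z⁻¹) = W.Z - (fun z => z⁻¹) from rfl, h.deriv]
    ring

theorem tendsto_neg_punct : Tendsto (fun z : ℂ => -z) (𝓝[≠] 0) (𝓝[≠] 0) := by
  apply tendsto_nhdsWithin_of_tendsto_nhds_of_eventually_within
  · have : Tendsto (fun z : ℂ => -z) (𝓝 0) (𝓝 (-0)) := continuous_neg.tendsto 0
    rw [neg_zero] at this
    exact this.mono_left nhdsWithin_le_nhds
  · filter_upwards [self_mem_nhdsWithin] with x hx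
    simpa using hx

/-- the sigma formula -/
theorem P_sub_P {z k : ℂ} (hz : z ∉ W.lattice) (hk : k ∉ W.lattice) :
    W.P z - W.P k = - (W.S (z + k) * W.S (z - k)) / (W.S z ^ 2 * W.S k ^ 2) := by
  have hSk := W.S_ne k hk
  set G : ℂ → ℂ := fun z => W.P z + W.S (z + k) * W.S (z - k) / (W.S z ^ 2 * W.S k ^ 2) with hG
  have hSd := W.S_diff
  have hs := W.sg_analyticAt
  obtain ⟨c, hc⟩ : ∃ c, Tendsto G (𝓝[≠] 0) (𝓝 c) := by
    set N : ℂ → ℂ := fun z => W.S (z + k) * W.S (z - k) / (W.sg z ^ 2 * W.S k ^ 2) with hN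
    have hSa : ∀ z, AnalyticAt ℂ W.S z := fun z => hSd.analyticAt z
    have hNa : AnalyticAt ℂ N 0 := by
      apply AnalyticAt.div
      · apply AnalyticAt.mul
        · exact (hSa _).comp (f := fun z => z + k) (by fun_prop)
        · exact (hSa _).comp (f := fun z => z - k) (by fun_prop)
      · exact (hs.pow 2).mul analyticAt_const
      · simp [W.sg_zero, hSk]
    have hN0 : N 0 = -1 := by
      simp only [hN, W.sg_zero, zero_add, zero_sub, W.S_odd]
      field_simp
    have hNe : ∀ z, N (-z) = N z := by
      intro z
      simp only [hN, W.sg_even]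
      rw [show -z + k = -(z - k) by ring, show -z - k = -(z + k) by ring, W.S_odd, W.S_odd]
      ring
    obtain ⟨c, hc⟩ := even_limit hNa (deriv_even (Eventually.of_forall hNe))
    refine ⟨0 + c, (W.P_pole.add hc).congr' ?_⟩
    filter_upwards [self_mem_nhdsWithin] with z hz
    have hz : z ≠ 0 := hz
    rw [hN0]
    simp only [hN, hG, W.sg_ne hz]
    by_cases hS : W.S z = 0
    · simp only [hS]; simp
    field_simp
    ring
  have h := W.liouville_zero G ?_ ?_ c hc
  · have h1 := h z hz
    have h2 := h k hk
    simp only [hG, sub_self, W.S_zero] at h1 h2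
    rw [← h1] at h2
    linear_combination -h2
  · intro l hl z
    obtain ⟨C, η, hC, h⟩ := W.S_quasi hl
    simp only [hG, W.P_periodic l hl]
    rw [show z + l + k = (z + k) + l by ring, show z + l - k = (z - k) + l by ring, h, h, h]
    congr 1
    have e1 : exp (η * (z + k)) * exp (η * (z - k)) = exp (η * z) ^ 2 := by
      rw [← exp_add, ← exp_nat_mul]; congr 1; push_cast; ring
    rw [show C * exp (η * (z + k)) * W.S (z + k) * (C * exp (η * (z - k)) * W.S (z - k))
      = (C ^ 2 * exp (η * z) ^ 2) * (W.S (z + k) * W.S (z - k)) by rw [← e1]; ring,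
      show (C * exp (η * z) * W.S z) ^ 2 * W.S k ^ 2
      = (C ^ 2 * exp (η * z) ^ 2) * (W.S z ^ 2 * W.S k ^ 2) by ring]
    rw [mul_div_mul_left]
    simp [hC, exp_ne_zero]
  · intro z hz
    have := W.P_diff z hz
    have hSz := W.S_ne z hz
    simp only [hG]
    have : W.S z ^ 2 * W.S k ^ 2 ≠ 0 := by simp [hSz, hSk]
    fun_prop (disch := assumption)

theorem P_inj {z k : ℂ} (hz : z ∉ W.lattice) (hk : k ∉ W.lattice) (h : W.P z = W.P k) :
    z + k ∈ W.lattice ∨ z - k ∈ W.lattice := by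
  have h1 := W.P_sub_P hz hk
  rw [h, sub_self, eq_comm, div_eq_zero_iff, neg_eq_zero, mul_eq_zero] at h1
  rcases h1 with (h1 | h1) | h1
  · exact Or.inl (W.S_eq_zero_iff.1 h1)
  · exact Or.inr (W.S_eq_zero_iff.1 h1)
  · simp [W.S_ne z hz, W.S_ne k hk] at h1

theorem P_surj (w : ℂ) : ∃ z ∉ W.lattice, W.P z = w := by
  by_contra! hcon
  have h0 : Tendsto (fun z => (W.P z - w)⁻¹) (𝓝[≠] 0) (𝓝 0) := by
    have h1 : Tendsto (fun z : ℂ => z ^ 2 / (z ^ 2 * (W.P z - 1 / z ^ 2) + 1 - w * z ^ 2)) (𝓝[≠] 0)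
        (𝓝 (0 ^ 2 / (0 ^ 2 * 0 + 1 - w * 0 ^ 2))) := by
      have hz : Tendsto (fun z : ℂ => z ^ 2) (𝓝[≠] 0) (𝓝 (0 ^ 2)) :=
        ((continuous_pow 2).tendsto 0).mono_left nhdsWithin_le_nhds
      refine hz.div (((hz.mul W.P_pole).add_const 1).sub (hz.const_mul w)) (by simp)
    have e : ((0:ℂ) ^ 2 / (0 ^ 2 * 0 + 1 - w * 0 ^ 2)) = 0 := by simp
    rw [e] at h1
    refine h1.congr' ?_
    filter_upwards [self_mem_nhdsWithin] with z hz
    have hz : z ≠ 0 := hz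
    rw [show z ^ 2 * (W.P z - 1 / z ^ 2) + 1 - w * z ^ 2 = z ^ 2 * (W.P z - w) by field_simp; ring]
    rw [div_mul_eq_div_div, div_self (pow_ne_zero 2 hz), one_div]
  have := W.liouville_zero (fun z => (W.P z - w)⁻¹) (fun l hl z => by simp only [W.P_periodic l hl])
    (fun z hz => ((W.P_diff z hz).sub_const w).inv (sub_ne_zero.2 (hcon z hz))) 0 h0
    W.w1 W.half1_notMem
  rw [inv_eq_zero, sub_eq_zero] at this
  exact hcon _ W.half1_notMem this

theorem half_aux {m n : ℤ} (h : (m:ℂ) * W.w1 + n * W.w3 ∈ W.lattice) : Even m ∧ Even n := by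
  have h' := (W.per.mul_ω₁_add_mul_ω₂_mem_lattice (α := m / 2) (β := n / 2)).1 (by
    rw [mem_per]; convert h using 1; simp [per]; ring)
  obtain ⟨h1, h2⟩ := h'
  constructor
  · have : ((m / 2 : ℚ).num : ℚ) = m / 2 := by exact (Rat.den_eq_one_iff _).1 h1
    refine ⟨(m / 2 : ℚ).num, ?_⟩
    have : (m:ℚ) = (m / 2 : ℚ).num + (m / 2 : ℚ).num := by rw [this]; ring
    exact_mod_cast this
  · have : ((n / 2 : ℚ).num : ℚ) = n / 2 := by exact (Rat.den_eq_one_iff _).1 h2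
    refine ⟨(n / 2 : ℚ).num, ?_⟩
    have : (n:ℚ) = (n / 2 : ℚ).num + (n / 2 : ℚ).num := by rw [this]; ring
    exact_mod_cast this

theorem e1_ne_e2 : W.e1 ≠ W.e2 := fun h => by
  rcases W.P_inj W.half1_notMem W.half2_notMem h with h | h
  · have := W.half_aux (m := 2) (n := 1) (by convert h using 1; simp [w2]; ring)
    exact absurd this.2 (by decide)
  · have := W.half_aux (m := 0) (n := -1) (by convert h using 1; simp [w2])
    exact absurd this.2 (by decide)
theorem e1_ne_e3 : W.e1 ≠ W.e3 := fun h => by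
  rcases W.P_inj W.half1_notMem W.half3_notMem h with h | h
  · exact W.half2_notMem h
  · have := W.half_aux (m := 1) (n := -1) (by convert h using 1; simp; ring)
    exact absurd this.2 (by decide)
theorem e2_ne_e3 : W.e2 ≠ W.e3 := fun h => by
  rcases W.P_inj W.half2_notMem W.half3_notMem h with h | h
  · have := W.half_aux (m := 1) (n := 2) (by convert h using 1; simp [w2]; ring)
    exact absurd this.1 (by decide)
  · have := W.half_aux (m := 1) (n := 0) (by convert h using 1; simp [w2])
    exact absurd this.1 (by decide)

theorem dP_sq {z : ℂ} (hz : z ∉ W.lattice) :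
    W.dP z ^ 2 = 4 * (W.P z - W.e1) * (W.P z - W.e2) * (W.P z - W.e3) := by
  have key : ∀ w, w ∉ W.lattice → 2 * w ∈ W.lattice →
      0 = 4 * W.P w ^ 3 - W.per.g₂ * W.P w - W.per.g₃ := by
    intro w h1 h2
    rw [← W.dP_sq_aux h1, W.dP_half h1 h2]; simp
  have h1 := key _ W.half1_notMem W.two_w1_mem
  have h2 := key _ W.half2_notMem W.two_w2_mem
  have h3 := key _ W.half3_notMem W.two_w3_mem
  rw [W.dP_sq_aux hz]
  change 0 = 4 * W.e1 ^ 3 - W.per.g₂ * W.e1 - W.per.g₃ at h1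
  change 0 = 4 * W.e2 ^ 3 - W.per.g₂ * W.e2 - W.per.g₃ at h2
  change 0 = 4 * W.e3 ^ 3 - W.per.g₂ * W.e3 - W.per.g₃ at h3
  have n12 := sub_ne_zero.2 W.e1_ne_e2
  have n13 := sub_ne_zero.2 W.e1_ne_e3
  have n23 := sub_ne_zero.2 W.e2_ne_e3
  generalize W.e1 = a at *
  generalize W.e2 = b at *
  generalize W.e3 = c at *
  have q1 : 4 * (a ^ 2 + a * b + b ^ 2) = W.per.g₂ := by
    apply mul_left_cancel₀ n12; linear_combination h2 - h1
  have q2 : 4 * (a ^ 2 + a * c + c ^ 2) = W.per.g₂ := by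
    apply mul_left_cancel₀ n13; linear_combination h3 - h1
  have q3 : a + b + c = 0 := by
    apply mul_left_cancel₀ n23; linear_combination (q1 - q2) / 4
  have hc : c = - a - b := by linear_combination q3
  have hg3 : W.per.g₃ = 4 * a ^ 3 - W.per.g₂ * a := by linear_combination h1
  rw [hg3, ← q1, hc]; ring

open Classical in
/-- zeta addition identity -/
theorem zeta_add {z k : ℂ} (hz : z ∉ W.lattice) (hk : k ∉ W.lattice) (hzk : z + k ∉ W.lattice) :
    (W.Z (z + k) - W.Z z - W.Z k) ^ 2 = W.P (z + k) + W.P z + W.P k := by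
  set G : ℂ → ℂ := fun z => if z ∈ W.lattice ∨ z + k ∈ W.lattice then 0 else
    (W.Z (z + k) - W.Z z - W.Z k) ^ 2 - W.P (z + k) - W.P z with hG
  have hGv : ∀ z, z ∉ W.lattice → z + k ∉ W.lattice →
      G z = (W.Z (z + k) - W.Z z - W.Z k) ^ 2 - W.P (z + k) - W.P z := by
    intro z h1 h2; simp [hG, h1, h2]
  have ev : ∀ z0, ∀ᶠ z in 𝓝[≠] z0, z ∉ W.lattice ∧ z + k ∉ W.lattice := by
    intro z0
    refine (W.eventually_notMem z0).and ?_
    have h1 : Tendsto (fun x => x + k) (𝓝[≠] z0) (𝓝[≠] (z0 + k)) := by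
      apply tendsto_nhdsWithin_of_tendsto_nhds_of_eventually_within
      · exact (Continuous.tendsto (by fun_prop) z0).mono_left nhdsWithin_le_nhds
      · filter_upwards [self_mem_nhdsWithin] with x hx h
        apply hx; simpa using h
    exact h1.eventually (W.eventually_notMem (z0 + k))
  have hd : ∀ z, z ∉ W.lattice → z + k ∉ W.lattice → DifferentiableAt ℂ G z := by
    intro z h1 h2
    have e : G =ᶠ[𝓝 z] fun z => (W.Z (z + k) - W.Z z - W.Z k) ^ 2 - W.P (z + k) - W.P z := by
      have o2 : IsOpen {x | x + k ∉ W.lattice} :=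
        W.isOpen_compl.preimage (f := fun x => x + k) (by fun_prop)
      filter_upwards [W.isOpen_compl.mem_nhds h1, o2.mem_nhds h2] with x hx1 hx2
      exact hGv x hx1 hx2
    refine DifferentiableAt.congr_of_eventuallyEq ?_ e
    have a1 := W.Z_diff z h1
    have a2 : DifferentiableAt ℂ (fun z => W.Z (z + k)) z :=
      ((W.Z_hasDerivAt h2).comp_add_const z k).differentiableAt
    have a3 := W.P_diff z h1
    have a4 : DifferentiableAt ℂ (fun z => W.P (z + k)) z :=
      ((W.P_hasDerivAt h2).comp_add_const z k).differentiableAt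
    fun_prop
  have hper : ∀ l ∈ W.lattice, ∀ z, G (z + l) = G z := by
    intro l hl z
    simp only [hG]
    rw [show z + l + k = (z + k) + l by ring, W.add_mem_iff hl, W.add_mem_iff hl]
    split_ifs with h
    · rfl
    · push Not at h
      obtain ⟨C, hC⟩ := W.Z_quasi hl
      rw [hC z h.1, hC _ h.2, W.P_periodic l hl, W.P_periodic l hl]; ring
  have h0 : Tendsto G (𝓝[≠] 0) (𝓝 (W.P k)) := by
    obtain ⟨ρ, hρ, hρ0, hρd, hZ⟩ := W.Z_expand
    have t1 : Tendsto (fun z => (W.Z (z + k) - W.Z k) / z) (𝓝[≠] 0) (𝓝 (-W.P k)) := by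
      have h : HasDerivAt (fun z => W.Z (z + k)) (-W.P (0 + k)) 0 :=
        (W.Z_hasDerivAt (z := 0 + k) (by rwa [zero_add])).comp_add_const 0 k
      have := h.tendsto_slope
      rw [zero_add] at this
      refine this.congr' ?_
      filter_upwards with z
      rw [slope_def_field]; simp
    have t2 : Tendsto (fun z => ρ z / z) (𝓝[≠] 0) (𝓝 0) := by
      have h := hρ.differentiableAt.hasDerivAt.tendsto_slope
      rw [hρd] at h
      refine h.congr' ?_
      filter_upwards with z
      rw [slope_def_field, hρ0]; simp
    have t3 : Tendsto (fun z : ℂ => z) (𝓝[≠] 0) (𝓝 0) := tendsto_id.mono_left nhdsWithin_le_nhds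
    have t4 : Tendsto (fun z => W.P (z + k)) (𝓝[≠] 0) (𝓝 (W.P k)) := by
      have h : ContinuousAt (fun z => W.P (z + k)) 0 :=
        ((W.P_hasDerivAt (z := 0 + k) (by rwa [zero_add])).comp_add_const 0 k).continuousAt
      have := h.tendsto
      simp only [zero_add] at this
      exact this.mono_left nhdsWithin_le_nhds
    have t5 := t1.sub t2
    have t6 := ((W.P_pole.neg.sub (t5.const_mul 2)).add ((t5.mul t3).pow 2)).sub t4
    have e : (-0 - 2 * (-W.P k - 0) + ((-W.P k - 0) * 0) ^ 2 - W.P k) = W.P k := by ring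
    rw [e] at t6
    refine t6.congr' ?_
    filter_upwards [self_mem_nhdsWithin, ev 0, hZ] with z hz hl hZz
    have hz : z ≠ 0 := hz
    rw [hGv z hl.1 hl.2, hZz]
    field_simp
    ring
  have hsym : ∀ z, G (-k - z) = G z := by
    intro z
    simp only [hG]
    have i1 : -k - z ∈ W.lattice ↔ z + k ∈ W.lattice := by
      rw [← W.neg_mem_iff]; ring_nf
    have i2 : -k - z + k ∈ W.lattice ↔ z ∈ W.lattice := by
      rw [← W.neg_mem_iff]; ring_nf
    simp only [i1, i2]
    by_cases h : z ∈ W.lattice ∨ z + k ∈ W.lattice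
    · rw [if_pos h, if_pos h.symm]
    · rw [if_neg h, if_neg (fun h' => h h'.symm)]
      push Not at h
      rw [show -k - z + k = -z by ring, show -k - z = -(z + k) by ring, W.Z_odd, W.Z_odd,
        W.P_even h.1, W.P_even h.2]; ring
  have hk0 : Tendsto G (𝓝[≠] (-k)) (𝓝 (W.P k)) := by
    have h1 : Tendsto (fun x => -k - x) (𝓝[≠] (-k)) (𝓝[≠] 0) := by
      apply tendsto_nhdsWithin_of_tendsto_nhds_of_eventually_within
      · have : Tendsto (fun x => -k - x) (𝓝 (-k)) (𝓝 (-k - -k)) :=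
          Continuous.tendsto (by fun_prop) _
        rw [sub_self] at this
        exact this.mono_left nhdsWithin_le_nhds
      · filter_upwards [self_mem_nhdsWithin] with x hx h
        apply hx; simp only [mem_singleton_iff] at h ⊢; rw [sub_eq_zero] at h; exact h.symm
    exact (h0.comp h1).congr (fun x => hsym x)
  obtain ⟨c, h1, h2⟩ := W.liouville G hper (by
    intro z0
    constructor
    · filter_upwards [ev z0] with z hz using hd z hz.1 hz.2
    · by_cases h : z0 ∈ W.lattice
      · exact ⟨W.P k, by simpa using W.loc_transport G hper 0 z0 h _ h0⟩
      · by_cases h' : z0 + k ∈ W.lattice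
        · exact ⟨W.P k, by simpa using W.loc_transport G hper (-k) (z0 + k) h' _ hk0⟩
        · exact ⟨G z0, (hd z0 h h').continuousAt.tendsto.mono_left nhdsWithin_le_nhds⟩)
  have hf := h1 z (hd z hz hzk).continuousAt
  rw [← h2 0 _ h0, hGv z hz hzk] at hf
  linear_combination hf

end WeierstrassData

end part2

section part3
open scoped Topology
namespace WeierstrassData
variable (W : WeierstrassData)

/-- the Hermite–Halphen solution -/
def Psi (k z : ℂ) : ℂ := W.S (z + k) / W.S z * exp (-W.Z k * z)

theorem Psi_diff (k : ℂ) {z : ℂ} (hz : z ∉ W.lattice) : DifferentiableAt ℂ (W.Psi k) z := by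
  have h := W.S_diff
  have h1 : DifferentiableAt ℂ (fun z => W.S (z + k)) z := by fun_prop
  have h2 : DifferentiableAt ℂ (fun z => exp (-W.Z k * z)) z := by fun_prop
  exact (h1.div (h z) (W.S_ne z hz)).mul h2

theorem Psi_analyticAt (k : ℂ) {z : ℂ} (hz : z ∉ W.lattice) : AnalyticAt ℂ (W.Psi k) z :=
  DifferentiableOn.analyticAt (s := W.latticeᶜ)
    (fun x hx => (W.Psi_diff k hx).differentiableWithinAt) (W.isOpen_compl.mem_nhds hz)

theorem Psi_hasDerivAt {k z : ℂ} (hz : z ∉ W.lattice) (hzk : z + k ∉ W.lattice) :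
    HasDerivAt (W.Psi k) ((W.Z (z + k) - W.Z z - W.Z k) * W.Psi k z) z := by
  have h1 := (W.S_hasDerivAt hzk).comp_add_const z k
  have h2 := W.S_hasDerivAt hz
  have h3 : HasDerivAt (fun z => exp (-W.Z k * z)) (exp (-W.Z k * z) * (-W.Z k * 1)) z :=
    ((hasDerivAt_id z).const_mul (-W.Z k)).cexp
  refine ((h1.div h2 (W.S_ne z hz)).mul h3).congr_deriv ?_
  have := W.S_ne z hz
  simp only [Psi]
  simp only [Pi.div_apply]
  field_simp
  ring

theorem ev_add (z0 k : ℂ) : ∀ᶠ z in 𝓝[≠] z0, z + k ∉ W.lattice := by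
  have h1 : Tendsto (fun x => x + k) (𝓝[≠] z0) (𝓝[≠] (z0 + k)) := by
    apply tendsto_nhdsWithin_of_tendsto_nhds_of_eventually_within
    · exact (Continuous.tendsto (by fun_prop) z0).mono_left nhdsWithin_le_nhds
    · filter_upwards [self_mem_nhdsWithin] with x hx h
      apply hx; simpa using h
  exact h1.eventually (W.eventually_notMem (z0 + k))

theorem Psi_ode {k z : ℂ} (hk : k ∉ W.lattice) (hz : z ∉ W.lattice) :
    deriv (deriv (W.Psi k)) z = (2 * W.P z + W.P k) * W.Psi k z := by
  have key : ∀ z ∉ W.lattice, z + k ∉ W.lattice →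
      deriv (deriv (W.Psi k)) z = (2 * W.P z + W.P k) * W.Psi k z := by
    intro z hz hzk
    have o2 : IsOpen {x | x + k ∉ W.lattice} :=
      W.isOpen_compl.preimage (f := fun x => x + k) (by fun_prop)
    have e : deriv (W.Psi k) =ᶠ[𝓝 z] fun z => (W.Z (z + k) - W.Z z - W.Z k) * W.Psi k z := by
      filter_upwards [W.isOpen_compl.mem_nhds hz, o2.mem_nhds hzk] with x h1 h2
      exact (W.Psi_hasDerivAt h1 h2).deriv
    rw [e.deriv_eq]
    have h1 := (((W.Z_hasDerivAt hzk).comp_add_const z k).sub (W.Z_hasDerivAt hz)).sub_const (W.Z k)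
    have h2 := h1.mul (W.Psi_hasDerivAt hz hzk)
    have h3 : (fun z => (W.Z (z + k) - W.Z z - W.Z k) * W.Psi k z) =
      (fun x => ((fun x => W.Z (x + k)) - W.Z) x - W.Z k) * W.Psi k := rfl
    rw [h3, h2.deriv]
    have := W.zeta_add hz hk hzk
    simp only [Pi.sub_apply]
    linear_combination W.Psi k z * this
  have c1 : Tendsto (deriv (deriv (W.Psi k))) (𝓝[≠] z) (𝓝 (deriv (deriv (W.Psi k)) z)) :=
    (W.Psi_analyticAt k hz).deriv.deriv.continuousAt.tendsto.mono_left nhdsWithin_le_nhds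
  have c2 : Tendsto (fun z => (2 * W.P z + W.P k) * W.Psi k z) (𝓝[≠] z)
      (𝓝 ((2 * W.P z + W.P k) * W.Psi k z)) := by
    have h1 := (W.P_diff z hz).continuousAt
    have h2 := (W.Psi_diff k hz).continuousAt
    have : ContinuousAt (fun z => (2 * W.P z + W.P k) * W.Psi k z) z := by fun_prop
    exact this.tendsto.mono_left nhdsWithin_le_nhds
  refine tendsto_nhds_unique c1 (c2.congr' ?_)
  filter_upwards [W.eventually_notMem z, W.ev_add z k] with x h1 h2
  exact (key x h1 h2).symm

/-- the Floquet exponent -/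
def fF (k : ℂ) : ℂ := W.Z W.w2 * k - W.w2 * W.Z k

theorem Psi_quasi {k z : ℂ} (hz : z ∉ W.lattice) :
    W.Psi k (z + 2 * W.w2) = exp (2 * W.fF k) * W.Psi k z := by
  obtain ⟨C, η, hC, h⟩ := W.S_quasi W.two_w2_mem
  have hη : η = 2 * W.Z W.w2 := by
    have hz' : z + 2 * W.w2 ∉ W.lattice := by rwa [W.add_mem_iff W.two_w2_mem]
    have h1 := (W.S_hasDerivAt hz').comp_add_const z (2 * W.w2)
    have h2 : HasDerivAt (fun z => C * exp (η * z) * W.S z)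
        (C * (exp (η * z) * (η * 1)) * W.S z + C * exp (η * z) * (W.Z z * W.S z)) z :=
      (((hasDerivAt_id z).const_mul η).cexp.const_mul C).mul (W.S_hasDerivAt hz)
    have h3 : (fun x => W.S (x + 2 * W.w2)) = fun z => C * exp (η * z) * W.S z := funext h
    rw [h3] at h1
    have h4 := h1.unique h2
    rw [h, W.Z_half W.half2_notMem W.two_w2_mem hz] at h4
    have h5 := W.S_ne z hz
    have h6 := exp_ne_zero (η * z)
    have h7 : (C * exp (η * z) * W.S z) * (2 * W.Z W.w2) = (C * exp (η * z) * W.S z) * η := by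
      linear_combination h4
    exact (mul_left_cancel₀ (by positivity) h7).symm
  have e1 : exp (η * (z + k)) = exp (η * z) * exp (η * k) := by rw [← exp_add]; ring_nf
  have e2 : exp (-W.Z k * (z + 2 * W.w2)) = exp (-W.Z k * z) * exp (-2 * W.w2 * W.Z k) := by
    rw [← exp_add]; ring_nf
  have e3 : exp (2 * W.fF k) = exp (η * k) * exp (-2 * W.w2 * W.Z k) := by
    rw [← exp_add, fF, hη]; ring_nf
  have h5 := W.S_ne z hz
  have h6 := exp_ne_zero (η * z)
  rw [Psi, Psi, show z + 2 * W.w2 + k = (z + k) + 2 * W.w2 by ring, h, h, e1, e2, e3]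
  field_simp

theorem uFun_eq (k : ℂ) : W.uFun W.w2 k = (W.fF k).re := rfl
theorem vFun_eq (k : ℂ) : W.vFun W.w2 k = (W.fF k).im := rfl

section spectrum
variable {W} {z0 : ℂ} (hz0 : ∀ x : ℝ, W.w2 * x + z0 ∉ W.lattice)
include hz0

theorem line_hasDeriv (x : ℝ) : HasDerivAt (fun x : ℝ => W.w2 * (x:ℂ) + z0) W.w2 x := by
  have h : HasDerivAt (fun x : ℝ => (x:ℂ)) 1 x := (hasDerivAt_id (x:ℂ)).comp_ofReal
  simpa using (h.const_mul W.w2).add_const z0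

/-- restricted to the line -/
theorem psi_deriv (k : ℂ) (x : ℝ) : HasDerivAt (fun x : ℝ => W.Psi k (W.w2 * x + z0))
    (W.w2 * deriv (W.Psi k) (W.w2 * x + z0)) x := by
  have h := (W.Psi_diff k (hz0 x)).hasDerivAt
  have := h.comp_of_eq x (line_hasDeriv hz0 x) rfl
  exact this.congr_deriv (by ring)

theorem psi_deriv2 {k : ℂ} (hk : k ∉ W.lattice) (x : ℝ) :
    HasDerivAt (fun x : ℝ => W.w2 * deriv (W.Psi k) (W.w2 * x + z0))
    (W.w2 ^ 2 * (2 * W.P (W.w2 * x + z0) + W.P k) * W.Psi k (W.w2 * x + z0)) x := by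
  have h := (W.Psi_analyticAt k (hz0 x)).deriv.differentiableAt.hasDerivAt
  have := (h.comp_of_eq x (line_hasDeriv hz0 x) rfl).const_mul W.w2
  refine this.congr_deriv ?_
  rw [W.Psi_ode hk (hz0 x)]; ring

theorem psi_quasi (k : ℂ) (x : ℝ) : W.Psi k (W.w2 * (x + 2 : ℝ) + z0) =
    exp (2 * W.fF k) * W.Psi k (W.w2 * x + z0) := by
  rw [← W.Psi_quasi (hz0 x)]
  congr 1; push_cast; ring

theorem dpsi_quasi (k : ℂ) (x : ℝ) : W.w2 * deriv (W.Psi k) (W.w2 * (x + 2 : ℝ) + z0) =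
    exp (2 * W.fF k) * (W.w2 * deriv (W.Psi k) (W.w2 * x + z0)) := by
  have h1 := (psi_deriv hz0 k (x + 2)).comp_add_const x 2
  have h2 := (psi_deriv hz0 k x).const_mul (exp (2 * W.fF k))
  have h3 : (fun x : ℝ => W.Psi k (W.w2 * (x + 2 : ℝ) + z0)) =
    fun x : ℝ => exp (2 * W.fF k) * W.Psi k (W.w2 * x + z0) := funext (psi_quasi hz0 k)
  rw [h3] at h1
  exact h1.unique h2

theorem psi_ne_zero {k : ℂ} : ∃ x : ℝ, W.Psi k (W.w2 * x + z0) ≠ 0 := by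
  by_contra! h
  have hm : ∀ x : ℝ, W.w2 * x + z0 + k ∈ W.lattice := by
    intro x
    have := h x
    rw [Psi] at this
    rw [← W.S_eq_zero_iff]
    have h1 := W.S_ne _ (hz0 x)
    simpa [h1, exp_ne_zero] using this
  have hc := W.countable_lattice.preimage (f := fun x : ℝ => W.w2 * x + z0 + k) (by
    intro x y hxy
    have h0 : W.w2 ≠ 0 := fun h0 => W.half2_notMem (h0 ▸ W.zero_mem)
    have : W.w2 * (x:ℂ) = W.w2 * y := by simpa using hxy
    exact_mod_cast mul_left_cancel₀ h0 this)
  have hu : (fun x : ℝ => W.w2 * x + z0 + k) ⁻¹' W.lattice = univ := eq_univ_of_forall hm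
  rw [hu] at hc
  exact not_countable_univ hc

end spectrum

theorem bdd_of_periodic {g : ℝ → ℝ} (hg : Continuous g) (hp : ∀ x, g (x + 2) = g x) :
    ∃ C, ∀ x, g x ≤ C := by
  have hp' : Function.Periodic g 2 := hp
  obtain ⟨C, hC⟩ := (isCompact_Icc (a := (0:ℝ)) (b := 2)).exists_bound_of_continuousOn hg.continuousOn
  refine ⟨C, fun x => ?_⟩
  obtain ⟨y, hy, e⟩ := hp'.exists_mem_Ico₀ (by norm_num) x
  rw [e]
  exact (le_abs_self _).trans (hC y ⟨hy.1, hy.2.le⟩)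

theorem spectrum_mem {z0 : ℂ} (hz0 : ∀ x : ℝ, W.w2 * x + z0 ∉ W.lattice) {k : ℂ}
    (hk : k ∉ W.lattice) (hu : W.uFun W.w2 k = 0) :
    -W.w2 ^ 2 * W.P k ∈ W.lameSpectrum 1 W.w2 z0 := by
  have d1 := psi_deriv hz0 k
  have d2 := psi_deriv2 hz0 hk
  have e1 : deriv (fun x : ℝ => W.Psi k (W.w2 * x + z0)) =
    fun x : ℝ => W.w2 * deriv (W.Psi k) (W.w2 * x + z0) := funext fun x => (d1 x).deriv
  refine ⟨fun x => W.Psi k (W.w2 * x + z0), ?_, ?_, ?_, ?_⟩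
  · obtain ⟨x, hx⟩ := psi_ne_zero hz0 (k := k)
    exact fun h => hx (congrFun h x)
  · rw [contDiff_iff_contDiffAt]
    intro x
    have h1 : ContDiffAt ℝ 2 (W.Psi k) (W.w2 * x + z0) :=
      (W.Psi_analyticAt k (hz0 x)).contDiffAt.restrict_scalars ℝ
    have h2 : ContDiff ℝ 2 (fun x : ℝ => W.w2 * (x:ℂ) + z0) :=
      (contDiff_const.mul ofRealCLM.contDiff).add contDiff_const
    exact h1.comp x h2.contDiffAt
  · intro x
    rw [e1, (d2 x).deriv]
    push_cast
    ring
  · obtain ⟨C, hC⟩ := bdd_of_periodic (g := fun x => ‖W.Psi k (W.w2 * x + z0)‖)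
      (continuous_iff_continuousAt.2 fun x => (d1 x).continuousAt.norm) (by
        intro x
        rw [psi_quasi hz0, norm_mul, norm_exp]
        have : (2 * W.fF k).re = 0 := by
          rw [uFun_eq] at hu; simp [hu]
        rw [this]; simp)
    exact ⟨C, hC⟩

end WeierstrassData

end part3

section part4
open scoped Topology
namespace WeierstrassData
variable (W : WeierstrassData)

theorem deriv_bdd {φ φ' φ'' : ℝ → ℂ} (h1 : ∀ x, HasDerivAt φ (φ' x) x)
    (h2 : ∀ x, HasDerivAt φ' (φ'' x) x) {C K : ℝ} (hC : ∀ x, ‖φ x‖ ≤ C) (hK : ∀ x, ‖φ'' x‖ ≤ K) (x : ℝ) :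
    ‖φ' x‖ ≤ 2 * C + K := by
  have hK0 : 0 ≤ K := (norm_nonneg _).trans (hK 0)
  have a1 : ∀ t ∈ Icc x (x+1), ‖φ' t - φ' x‖ ≤ K := by
    intro t ht
    have := norm_image_sub_le_of_norm_deriv_le_segment' (f := φ') (f' := φ'') (a := x) (b := x + 1) (C := K)
      (fun y _ => (h2 y).hasDerivWithinAt) (fun y _ => hK y) t ht
    refine this.trans ?_
    nlinarith [ht.1, ht.2]
  have a2 := norm_image_sub_le_of_norm_deriv_le_segment' (f := fun t => φ t - (t - x : ℝ) • φ' x)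
      (f' := fun t => φ' t - φ' x) (a := x) (b := x + 1) (C := K)
      (fun y _ => by
        have := (h1 y).sub ((((hasDerivAt_id y).sub_const x).smul_const (φ' x)))
        refine (this.congr_deriv (by simp)).hasDerivWithinAt) (fun y hy => a1 y ⟨hy.1, hy.2.le⟩) (x+1) (by simp)
  simp only [add_sub_cancel_left, one_smul, sub_self, zero_smul, sub_zero, mul_one] at a2
  have a3 : φ' x = φ (x+1) - φ x - (φ (x+1) - φ' x - φ x) := by ring
  rw [a3]
  have := norm_sub_le (φ (x+1) - φ x) (φ (x+1) - φ' x - φ x)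
  have := norm_sub_le (φ (x+1)) (φ x)
  linarith [hC x, hC (x+1)]

theorem ode_unique {q : ℝ → ℂ} {K : ℝ} (hq : ∀ x, ‖q x‖ ≤ K) {φ φ' : ℝ → ℂ}
    (h1 : ∀ x, HasDerivAt φ (φ' x) x) (h2 : ∀ x, HasDerivAt φ' (q x * φ x) x) {x0 : ℝ}
    (i1 : φ x0 = 0) (i2 : φ' x0 = 0) (x : ℝ) : φ x = 0 := by
  have hK0 : 0 ≤ K := (norm_nonneg _).trans (hq 0)
  have key := ODE_solution_unique_univ (v := fun t (p : ℂ × ℂ) => (p.2, q t * p.1)) (s := fun _ => univ)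
    (K := Real.toNNReal (max 1 K)) (f := fun t => (φ t, φ' t)) (g := fun _ => (0, 0)) (t₀ := x0)
    (by
      intro t
      rw [lipschitzOnWith_univ]
      apply LipschitzWith.of_dist_le_mul
      intro a b
      simp only [dist_eq_norm, Prod.norm_def, Prod.fst_sub, Prod.snd_sub, Real.coe_toNNReal _ (show (0:ℝ) ≤ max 1 K by positivity)]
      set m := max ‖a.1 - b.1‖ ‖a.2 - b.2‖
      have hm : 0 ≤ m := by positivity
      apply max_le
      · calc _ ≤ m := le_max_right _ _
          _ = 1 * m := by ring
          _ ≤ _ := by gcongr; exact le_max_left _ _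
      · rw [← mul_sub, norm_mul]
        gcongr
        · exact (hq t).trans (le_max_right _ _)
        · exact le_max_left _ _)
    (fun t => ⟨(h1 t).prodMk (h2 t), trivial⟩)
    (fun t => ⟨(hasDerivAt_const t ((0:ℂ),(0:ℂ))).congr_deriv (by simp; rfl), trivial⟩) (by simp [i1, i2])
  exact congrArg Prod.fst (congrFun key x)

theorem zpow_small {r K w : ℝ} (hr : 0 < r) (hr1 : r ≠ 1) (h : ∀ n : ℤ, w ≤ r ^ n * K) : w ≤ 0 := by
  rcases lt_or_gt_of_ne hr1 with h1 | h1
  · have := (tendsto_pow_atTop_nhds_zero_of_lt_one hr.le h1).mul_const K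
    rw [zero_mul] at this
    exact ge_of_tendsto' this (fun n => by simpa using h n)
  · have := (tendsto_pow_atTop_nhds_zero_of_lt_one (inv_pos.2 hr).le (inv_lt_one_of_one_lt₀ h1)).mul_const K
    rw [zero_mul] at this
    exact ge_of_tendsto' this (fun n => by simpa using h (-n))

theorem iter_quasi {g : ℝ → ℂ} {μ : ℂ} (hμ : μ ≠ 0) (h : ∀ x : ℝ, g (x + 2) = μ * g x) (x : ℝ) (n : ℤ) :
    g (x + 2 * n) = μ ^ n * g x := by
  induction n with
  | zero => simp
  | succ n ih =>
    have := h (x + 2 * (n:ℤ))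
    rw [ih] at this
    rw [zpow_add_one₀ hμ]
    rw [show x + 2 * (((n:ℤ) + 1 : ℤ) : ℝ) = x + 2 * (n:ℤ) + 2 by push_cast; ring, this]; ring
  | pred n ih =>
    have := h (x + 2 * ((-(n:ℤ) - 1 : ℤ):ℝ))
    rw [show x + 2 * ((-(n:ℤ) - 1 : ℤ):ℝ) + 2 = x + 2 * ((-(n:ℤ) : ℤ) : ℝ) by push_cast; ring, ih] at this
    rw [zpow_sub_one₀ hμ]
    rw [mul_right_comm, this]; field_simp

theorem mem_spectrum {z0 : ℂ} (hz0 : ∀ x : ℝ, W.w2 * x + z0 ∉ W.lattice) {lam : ℂ}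
    (hlam : lam ∈ W.lameSpectrum 1 W.w2 z0) :
    ∃ k ∉ W.lattice, W.uFun W.w2 k = 0 ∧ lam = -W.w2 ^ 2 * W.P k := by
  obtain ⟨φ, hφ0, hφ2, hode, C, hC⟩ := hlam
  have hw0 : W.w2 ≠ 0 := fun h0 => W.half2_notMem (h0 ▸ W.zero_mem)
  obtain ⟨k, hk, hPk⟩ := W.P_surj (-lam / W.w2 ^ 2)
  have hlam : lam = -W.w2 ^ 2 * W.P k := by rw [hPk]; field_simp
  refine ⟨k, hk, ?_, hlam⟩
  by_contra hu
  have hφ1 : ContDiff ℝ 1 (deriv φ) := ((contDiff_succ_iff_deriv (n := 1)).1 hφ2).2.2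
  have d1 : ∀ x, HasDerivAt φ (deriv φ x) x := fun x =>
    (hφ2.differentiable (by norm_num) x).hasDerivAt
  set q : ℝ → ℂ := fun x => W.w2 ^ 2 * (2 * W.P (W.w2 * x + z0) + W.P k) with hq
  have d2 : ∀ x, HasDerivAt (deriv φ) (q x * φ x) x := fun x => by
    have := (hφ1.differentiable (by norm_num) x).hasDerivAt
    refine this.congr_deriv ?_
    have h := hode x
    rw [hlam] at h
    push_cast at h
    simp only [hq]
    linear_combination -h
  obtain ⟨K, hK⟩ := bdd_of_periodic (g := fun x => ‖q x‖) (by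
      refine continuous_iff_continuousAt.2 fun x => ContinuousAt.norm ?_
      have h1 := (W.P_diff _ (hz0 x)).continuousAt
      have h2 : ContinuousAt (fun x : ℝ => W.P (W.w2 * x + z0)) x :=
        ContinuousAt.comp_of_eq h1 (by fun_prop) rfl
      simp only [hq]
      fun_prop) (by
      intro x
      simp only [hq]
      rw [show W.w2 * ((x + 2 : ℝ):ℂ) + z0 = W.w2 * x + z0 + 2 * W.w2 by push_cast; ring,
        W.P_periodic _ W.two_w2_mem])
  have hC0 : 0 ≤ C := (norm_nonneg _).trans (hC 0)
  have hK0 : 0 ≤ K := (norm_nonneg _).trans (hK 0)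
  have hb := deriv_bdd d1 d2 hC (K := K * C) (fun x => by rw [norm_mul]; gcongr; exacts [hK x, hC x])
  set D := 2 * C + K * C with hD
  have p1 := psi_deriv hz0 k
  have p2 := psi_deriv2 hz0 hk
  have q1 := psi_quasi hz0 k
  have q2 := dpsi_quasi hz0 k
  set ψ : ℝ → ℂ := fun x => W.Psi k (W.w2 * x + z0) with hψ
  set ψ' : ℝ → ℂ := fun x => W.w2 * deriv (W.Psi k) (W.w2 * x + z0) with hψ'
  set μ := exp (2 * W.fF k) with hμ
  have hμ0 : μ ≠ 0 := exp_ne_zero _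
  have hμ1 : ‖μ‖ ≠ 1 := by
    rw [hμ, norm_exp]
    intro h
    rw [Real.exp_eq_one_iff] at h
    apply hu; rw [uFun_eq]; simpa using h
  -- Wronskian
  have hwr : ∀ x y, φ x * ψ' x - deriv φ x * ψ x = φ y * ψ' y - deriv φ y * ψ y := by
    have hd : ∀ x, HasDerivAt (fun x => φ x * ψ' x - deriv φ x * ψ x) 0 x := fun x => by
      have := ((d1 x).mul (p2 x)).sub ((d2 x).mul (p1 x))
      refine this.congr_deriv ?_
      simp only [hq, hψ, hψ']; ring
    exact is_const_of_deriv_eq_zero (fun x => (hd x).differentiableAt) (fun x => (hd x).deriv)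
  have hw : ∀ x, φ x * ψ' x - deriv φ x * ψ x = 0 := by
    intro x
    rw [← norm_le_zero_iff]
    refine zpow_small (norm_pos_iff.2 hμ0) hμ1 (K := C * ‖ψ' x‖ + D * ‖ψ x‖) fun n => ?_
    rw [hwr x (x + 2 * n), iter_quasi (g := ψ) hμ0 q1, iter_quasi (g := ψ') hμ0 q2]
    calc _ ≤ ‖φ (x + 2 * n) * (μ ^ n * ψ' x)‖ + ‖deriv φ (x + 2 * n) * (μ ^ n * ψ x)‖ := norm_sub_le _ _
      _ = ‖μ‖ ^ n * (‖φ (x + 2 * n)‖ * ‖ψ' x‖ + ‖deriv φ (x + 2 * n)‖ * ‖ψ x‖) := by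
        simp only [norm_mul, norm_zpow]; ring
      _ ≤ _ := by gcongr; exacts [hC _, hb _]
  obtain ⟨x0, hx0⟩ := psi_ne_zero hz0 (k := k)
  change ψ x0 ≠ 0 at hx0
  set c := φ x0 / ψ x0 with hc
  have hφψ : ∀ x, φ x - c * ψ x = 0 := by
    refine ode_unique (q := q) hK (φ' := fun x => deriv φ x - c * ψ' x) (x0 := x0)
      (fun x => (d1 x).sub ((p1 x).const_mul c)) (fun x => ?_) ?_ ?_
    · refine ((d2 x).sub ((p2 x).const_mul c)).congr_deriv ?_
      simp only [hq, hψ]; ring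
    · rw [hc]; field_simp; ring
    · have := hw x0
      rw [hc]; field_simp; linear_combination -this
  have hcn : c ≠ 0 := by
    intro h
    apply hφ0; funext x
    have := hφψ x
    rw [h] at this; simpa using this
  have : ‖c * ψ x0‖ ≤ 0 := by
    refine zpow_small (norm_pos_iff.2 hμ0) hμ1 (K := C) fun n => ?_
    have h1 := hφψ (x0 + 2 * (-n : ℤ))
    rw [iter_quasi (g := ψ) hμ0 q1] at h1
    have h2 : c * ψ x0 = μ ^ n * φ (x0 + 2 * (-n : ℤ)) := by
      have h3 : μ ^ n * μ ^ (-n) = 1 := by rw [← zpow_add₀ hμ0]; simp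
      linear_combination (-μ ^ n) * h1 - c * ψ x0 * h3
    rw [h2, norm_mul, norm_zpow]
    gcongr; exact hC _
  rw [norm_le_zero_iff] at this
  exact mul_ne_zero hcn hx0 this

end WeierstrassData

end part4

section part5
open scoped Topology ComplexConjugate Interval
namespace WeierstrassData
variable (W : WeierstrassData)

/-- rectangular lattices -/
def Rect : Prop := W.w1.im = 0 ∧ 0 < W.w1.re ∧ W.w3.re = 0 ∧ 0 < W.w3.im

/-- real half period -/
def a : ℝ := W.w1.re
/-- imaginary half period -/
def b : ℝ := W.w3.im

section rect
variable {W} (hR : W.Rect)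
include hR

theorem a_pos : 0 < W.a := hR.2.1
theorem b_pos : 0 < W.b := hR.2.2.2
theorem w1_eq : W.w1 = (W.a : ℂ) := Complex.ext (by simp [a]) (by simp [hR.1])
theorem w3_eq : W.w3 = (W.b : ℂ) * I := Complex.ext (by simp [hR.2.2.1]) (by simp [b])
theorem w2_eq : W.w2 = (W.a : ℂ) + W.b * I := by rw [w2, w1_eq hR, w3_eq hR]

theorem mem_iff {z : ℂ} : z ∈ W.lattice ↔ ∃ m n : ℤ, z.re = 2 * m * W.a ∧ z.im = 2 * n * W.b := by
  constructor
  · rintro ⟨m, n, h⟩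
    rw [w1_eq hR, w3_eq hR] at h
    refine ⟨m, n, ?_, ?_⟩ <;> rw [h] <;> simp
  · rintro ⟨m, n, h1, h2⟩
    refine ⟨m, n, ?_⟩
    rw [w1_eq hR, w3_eq hR]
    apply Complex.ext <;> simp [h1, h2]

theorem eq_zero_of_mem {z : ℂ} (hz : z ∈ W.lattice) (h1 : |z.re| < 2 * W.a) (h2 : |z.im| < 2 * W.b) :
    z = 0 := by
  obtain ⟨m, n, hm, hn⟩ := (mem_iff hR).1 hz
  have ha := a_pos hR
  have hb := b_pos hR
  have aux : ∀ (m : ℤ) (c : ℝ), 0 < c → |2 * m * c| < 2 * c → m = 0 := by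
    intro m c hc h
    rw [abs_mul, abs_mul, abs_of_pos hc] at h
    have : |(m:ℝ)| < 1 := by
      simp only [abs_two] at h
      nlinarith
    have h' : |m| < 1 := by exact_mod_cast this
    exact Int.abs_lt_one_iff.1 h'
  have m0 := aux m _ ha (hm ▸ h1)
  have n0 := aux n _ hb (hn ▸ h2)
  apply Complex.ext <;> simp [hm, hn, m0, n0]

theorem notMem_of {z : ℂ} (h1 : |z.re| < 2 * W.a) (h2 : |z.im| < 2 * W.b) (h0 : z ≠ 0) :
    z ∉ W.lattice := fun h => h0 (eq_zero_of_mem hR h h1 h2)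

theorem conj_mem {z : ℂ} : conj z ∈ W.lattice ↔ z ∈ W.lattice := by
  rw [mem_iff hR, mem_iff hR]
  constructor
  · rintro ⟨m, n, h1, h2⟩
    exact ⟨m, -n, by simpa using h1, by simp at h2; push_cast; linarith⟩
  · rintro ⟨m, n, h1, h2⟩
    exact ⟨m, -n, by simpa using h1, by simp; linarith⟩

theorem P_conj {z : ℂ} (hz : z ∉ W.lattice) : W.P (conj z) = conj (W.P z) := by
  have h := W.liouville_zero (fun z => conj (W.P (conj z)) - W.P z) ?_ ?_ 0 ?_ z hz
  · rw [sub_eq_zero] at h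
    rw [← h]; simp
  · intro l hl z
    simp only [map_add]
    rw [W.P_periodic _ hl, W.P_periodic _ ((conj_mem hR).2 hl)]
  · intro z hz
    have h1 := (W.P_hasDerivAt (z := conj z) (by rwa [conj_mem hR])).conj_conj
    simp only [conj_conj] at h1
    exact (DifferentiableAt.sub h1.differentiableAt (W.P_diff z hz))
  · have t : Tendsto (fun z : ℂ => conj z) (𝓝[≠] 0) (𝓝[≠] 0) := by
      apply tendsto_nhdsWithin_of_tendsto_nhds_of_eventually_within
      · have : Tendsto (fun z : ℂ => conj z) (𝓝 0) (𝓝 (conj 0)) := continuous_conj.tendsto 0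
        rw [map_zero] at this
        exact this.mono_left nhdsWithin_le_nhds
      · filter_upwards [self_mem_nhdsWithin] with x hx
        simpa using hx
    have h1 := (continuous_conj.tendsto 0).comp (W.P_pole.comp t)
    have h2 := h1.sub W.P_pole
    simp only [map_zero, sub_zero] at h2
    refine h2.congr fun z => ?_
    simp

theorem Z_conj {z : ℂ} (hz : z ∉ W.lattice) : W.Z (conj z) = conj (W.Z z) := by
  have key : ∀ z ∈ W.latticeᶜ, HasDerivAt (fun z => conj (W.Z (conj z)) - W.Z z) 0 z := by
    intro z hz
    have h1 := (W.Z_hasDerivAt (z := conj z) (by rwa [conj_mem hR])).conj_conj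
    simp only [conj_conj] at h1
    refine (h1.sub (W.Z_hasDerivAt hz)).congr_deriv ?_
    rw [P_conj hR hz]; simp
  obtain ⟨c, hc⟩ := W.isOpen_compl.exists_is_const_of_deriv_eq_zero W.isPreconnected_compl
    (fun z hz => (key z hz).differentiableAt.differentiableWithinAt)
    (fun z hz => (key z hz).deriv)
  have h1 := hc _ hz
  have h2 := hc _ (show -z ∈ W.latticeᶜ from by rwa [mem_compl_iff, W.neg_mem_iff])
  simp only [map_neg, W.Z_odd] at h1 h2
  have : conj (W.Z (conj z)) = W.Z z := by linear_combination (h1 - h2) / 2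
  rw [← this]; simp

theorem legendre : W.Z W.w1 * W.w3 - W.Z W.w3 * W.w1 = Real.pi / 2 * I := by
  have ha := a_pos hR
  have hb := b_pos hR
  set f : ℂ → ℂ := fun z => W.Z z - z⁻¹ with hf
  have hf0 : f 0 = 0 := by
    have : W.Z 0 = 0 := by
      have := W.Z_odd 0
      rw [neg_zero] at this; linear_combination this / 2
    simp [hf, this]
  have hc0 : ContinuousAt f 0 := by
    obtain ⟨ρ, hρ, hρ0, -, hZ⟩ := W.Z_expand
    have h1 : f =ᶠ[𝓝 0] ρ := by
      rw [eventually_nhdsWithin_iff] at hZ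
      filter_upwards [hZ] with z hz
      by_cases h : z = 0
      · rw [h, hf0, hρ0]
      · simp only [hf]; rw [hz h]; simp
    exact hρ.continuousAt.congr h1.symm
  have hmem : ∀ z ∈ [[-W.a, W.a]] ×ℂ [[-W.b, W.b]], z ≠ 0 → z ∉ W.lattice := by
    intro z hz h0
    rw [mem_reProdIm, uIcc_of_le (by linarith), uIcc_of_le (by linarith)] at hz
    refine notMem_of hR ?_ ?_ h0
    · rw [abs_lt]; constructor <;> linarith [hz.1.1, hz.1.2]
    · rw [abs_lt]; constructor <;> linarith [hz.2.1, hz.2.2]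
  have hd : ∀ z ∉ W.lattice, z ≠ 0 → DifferentiableAt ℂ f z := fun z hz h0 =>
    (W.Z_diff z hz).sub (differentiableAt_inv h0)
  have hcont : ContinuousOn f ([[-W.a, W.a]] ×ℂ [[-W.b, W.b]]) := by
    intro z hz
    by_cases h0 : z = 0
    · rw [h0]; exact hc0.continuousWithinAt
    · exact (hd z (hmem z hz h0) h0).continuousAt.continuousWithinAt
  have key := integral_boundary_rect_eq_zero_of_differentiable_on_off_countable f
    (⟨-W.a, -W.b⟩ : ℂ) ⟨W.a, W.b⟩ {0} (countable_singleton 0) hcont (by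
      intro z hz
      have h0 : z ≠ 0 := fun h => hz.2 h
      refine hd z (hmem z ?_ h0) h0
      have h1 := hz.1
      rw [mem_reProdIm] at h1 ⊢
      rw [min_eq_left (by simp; linarith), max_eq_right (by simp; linarith), min_eq_left (by simp; linarith), max_eq_right (by simp; linarith)] at h1
      rw [uIcc_of_le (by linarith), uIcc_of_le (by linarith)]
      exact ⟨⟨h1.1.1.le, h1.1.2.le⟩, ⟨h1.2.1.le, h1.2.2.le⟩⟩)
  simp only at key
  have ch : ∀ y ∈ [[-W.b, W.b]], ContinuousOn (fun x : ℝ => f (x + y * I)) [[-W.a, W.a]] := by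
    intro y hy
    refine hcont.comp (by fun_prop) ?_
    intro x hx
    rw [mem_reProdIm]; simpa using ⟨hx, hy⟩
  have cv : ∀ x ∈ [[-W.a, W.a]], ContinuousOn (fun y : ℝ => f (x + y * I)) [[-W.b, W.b]] := by
    intro y hy
    refine hcont.comp (by fun_prop) ?_
    intro x hx
    rw [mem_reProdIm]; simpa using ⟨hy, hx⟩
  have i1 := (ch (-W.b) left_mem_uIcc).intervalIntegrable (μ := MeasureTheory.volume)
  have i2 := (ch W.b right_mem_uIcc).intervalIntegrable (μ := MeasureTheory.volume)
  have i3 := (cv (-W.a) left_mem_uIcc).intervalIntegrable (μ := MeasureTheory.volume)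
  have i4 := (cv W.a right_mem_uIcc).intervalIntegrable (μ := MeasureTheory.volume)
  have at1 : ∀ c : ℝ, 0 < c → ∀ x : ℝ, HasDerivAt (fun x : ℝ => ((Real.arctan (x / c) : ℝ) : ℂ))
      ((c / (c ^ 2 + x ^ 2) : ℝ) : ℂ) x := by
    intro c hc x
    have h1 : HasDerivAt (fun x : ℝ => Real.arctan (x / c)) (1 / (1 + (x / c) ^ 2) * (1 / c)) x :=
      ((hasDerivAt_id x).div_const c).arctan
    have h2 := h1.ofReal_comp
    refine h2.congr_deriv ?_
    congr 1
    field_simp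
  have e1 : (∫ x in (-W.a)..W.a, f (x + (-W.b:ℝ) * I)) - (∫ x in (-W.a)..W.a, f (x + (W.b:ℝ) * I)) =
      -4 * W.a * W.Z W.w3 - 4 * I * Real.arctan (W.a / W.b) := by
    rw [← intervalIntegral.integral_sub i1 i2]
    rw [intervalIntegral.integral_eq_sub_of_hasDerivAt
      (f := fun x : ℝ => -2 * W.Z W.w3 * x - 2 * I * ((Real.arctan (x / W.b) : ℝ) : ℂ))
      (f' := fun x : ℝ => f (x + (-W.b:ℝ) * I) - f (x + (W.b:ℝ) * I))]
    · rw [neg_div, Real.arctan_neg]; push_cast; ring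
    · intro x hx
      have h1 := ((hasDerivAt_id (x:ℂ)).comp_ofReal.const_mul (-2 * W.Z W.w3)).sub ((at1 _ hb x).const_mul (2 * I))
      refine h1.congr_deriv ?_
      have hx1 : ((x:ℂ) + (-W.b:ℝ) * I) ∉ W.lattice := by
        refine hmem _ ?_ (fun h => ?_)
        · rw [mem_reProdIm]; simpa using hx
        · have := congrArg Complex.im h; simp at this; linarith
      have h2 : W.Z (x + (W.b:ℝ) * I) = W.Z (x + (-W.b:ℝ) * I) + 2 * W.Z W.w3 := by
        rw [← W.Z_half W.half3_notMem W.two_w3_mem hx1, w3_eq hR]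
        congr 1; push_cast; ring
      simp only [hf]
      rw [h2]
      have n1 : (x:ℂ) + (W.b:ℝ) * I ≠ 0 := fun h => by
        have := congrArg Complex.im h; simp at this; linarith
      have n2 : (x:ℂ) - (W.b:ℝ) * I ≠ 0 := fun h => by
        have := congrArg Complex.im h; simp at this; linarith
      have n3 : (W.b:ℂ)^2 + (x:ℂ)^2 ≠ 0 := by
        have : (W.b:ℂ)^2 + (x:ℂ)^2 = ((W.b^2+x^2:ℝ):ℂ) := by push_cast; ring
        rw [this]
        exact_mod_cast (by positivity : W.b^2+x^2 ≠ 0)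
      push_cast
      have hI : I ^ 2 = -1 := I_sq
      rw [show (x:ℂ) + -↑W.b * I = x - W.b * I by ring]
      have h3 : ((x:ℂ) - W.b * I)⁻¹ - ((x:ℂ) + W.b * I)⁻¹ = 2 * I * (W.b / (W.b ^ 2 + x ^ 2)) := by
        rw [inv_sub_inv n2 n1, mul_div_assoc', div_eq_div_iff (mul_ne_zero n2 n1) n3]
        linear_combination (2 * I * W.b ^ 3) * hI
      linear_combination h3
    · exact i1.sub i2
  have e2 : (∫ y in (-W.b)..W.b, f ((W.a:ℝ) + y * I)) - (∫ y in (-W.b)..W.b, f ((-W.a:ℝ) + y * I)) =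
      4 * W.b * W.Z W.w1 - 4 * Real.arctan (W.b / W.a) := by
    rw [← intervalIntegral.integral_sub i4 i3]
    rw [intervalIntegral.integral_eq_sub_of_hasDerivAt
      (f := fun x : ℝ => 2 * W.Z W.w1 * x - 2 * ((Real.arctan (x / W.a) : ℝ) : ℂ))
      (f' := fun y : ℝ => f ((W.a:ℝ) + y * I) - f ((-W.a:ℝ) + y * I))]
    · rw [neg_div, Real.arctan_neg]; push_cast; ring
    · intro x hx
      have h1 := ((hasDerivAt_id (x:ℂ)).comp_ofReal.const_mul (2 * W.Z W.w1)).sub ((at1 _ ha x).const_mul 2)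
      refine h1.congr_deriv ?_
      have hx1 : ((-W.a:ℝ) + (x:ℂ) * I) ∉ W.lattice := by
        refine hmem _ ?_ (fun h => ?_)
        · rw [mem_reProdIm]; simpa using hx
        · have := congrArg Complex.re h; simp at this; linarith
      have h2 : W.Z ((W.a:ℝ) + x * I) = W.Z ((-W.a:ℝ) + x * I) + 2 * W.Z W.w1 := by
        rw [← W.Z_half W.half1_notMem W.two_w1_mem hx1, w1_eq hR]
        congr 1; push_cast; ring
      simp only [hf]
      rw [h2]
      have n1 : (W.a:ℝ) + (x:ℂ) * I ≠ 0 := fun h => by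
        have := congrArg Complex.re h; simp at this; linarith
      have n2 : - (W.a:ℂ) + (x:ℂ) * I ≠ 0 := fun h => by
        have := congrArg Complex.re h; simp at this; linarith
      have n3 : (W.a:ℂ)^2 + (x:ℂ)^2 ≠ 0 := by
        have : (W.a:ℂ)^2 + (x:ℂ)^2 = ((W.a^2+x^2:ℝ):ℂ) := by push_cast; ring
        rw [this]
        exact_mod_cast (by positivity : W.a^2+x^2 ≠ 0)
      push_cast
      have hI : I ^ 2 = -1 := I_sq
      field_simp
      linear_combination (-2 * W.a * x ^ 2) * hI
    · exact i4.sub i3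
  have hat : Real.arctan (W.b / W.a) = Real.pi / 2 - Real.arctan (W.a / W.b) := by
    rw [← Real.arctan_inv_of_pos (by positivity), inv_div]
  rw [hat] at e2
  push_cast at e1 e2 key
  rw [w1_eq hR, w3_eq hR]
  rw [w1_eq hR] at e2
  rw [w3_eq hR] at e1
  simp only [smul_eq_mul] at key
  linear_combination (1/4 : ℂ) * (key - e1 - I * e2)

end rect
end WeierstrassData

end part5

section part6
open scoped Topology ComplexConjugate

/-- a point with given coordinates -/
def pt (x y : ℝ) : ℂ := x + y * I
@[simp] theorem pt_re (x y : ℝ) : (pt x y).re = x := by simp [pt]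
@[simp] theorem pt_im (x y : ℝ) : (pt x y).im = y := by simp [pt]
theorem eq_pt (z : ℂ) : z = pt z.re z.im := by simp [pt]
theorem pt_conj (x y : ℝ) : conj (pt x y) = pt x (-y) := Complex.ext (by simp) (by simp)
theorem pt_neg (x y : ℝ) : -pt x y = pt (-x) (-y) := Complex.ext (by simp) (by simp)

theorem hasDerivAt_pt_x (x y : ℝ) : HasDerivAt (fun x : ℝ => pt x y) 1 x :=
  ((hasDerivAt_id (x:ℂ)).comp_ofReal).add_const _
theorem hasDerivAt_pt_y (x y : ℝ) : HasDerivAt (fun y : ℝ => pt x y) I y := by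
  have := (((hasDerivAt_id (y:ℂ)).comp_ofReal).mul_const I).const_add (x:ℂ)
  exact this.congr_deriv (by simp)

theorem HasDerivAt.re' {f : ℝ → ℂ} {f' : ℂ} {x : ℝ} (h : HasDerivAt f f' x) :
    HasDerivAt (fun x => (f x).re) f'.re x := reCLM.hasFDerivAt.comp_hasDerivAt x h
theorem HasDerivAt.im' {f : ℝ → ℂ} {f' : ℂ} {x : ℝ} (h : HasDerivAt f f' x) :
    HasDerivAt (fun x => (f x).im) f'.im x := imCLM.hasFDerivAt.comp_hasDerivAt x h

theorem neg_of_mono {F F' : ℝ → ℝ} {s t : ℝ} (hc : ContinuousOn F (Icc s t))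
    (hd : ∀ x ∈ Ioo s t, HasDerivAt F (F' x) x) (hm : StrictMonoOn F' (Ioo s t))
    (h0 : F s = 0) (h1 : F t = 0) {x : ℝ} (hx : x ∈ Ioo s t) : F x < 0 := by
  by_contra! h
  obtain ⟨c1, hc1, e1⟩ := exists_hasDerivAt_eq_slope F F' hx.1 (hc.mono (Icc_subset_Icc_right hx.2.le))
    (fun y hy => hd y ⟨hy.1, hy.2.trans hx.2⟩)
  obtain ⟨c2, hc2, e2⟩ := exists_hasDerivAt_eq_slope F F' hx.2 (hc.mono (Icc_subset_Icc_left hx.1.le))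
    (fun y hy => hd y ⟨hx.1.trans hy.1, hy.2⟩)
  have := hm ⟨hc1.1, hc1.2.trans hx.2⟩ ⟨hx.1.trans hc2.1, hc2.2⟩ (hc1.2.trans hc2.1)
  rw [e1, e2, h0, h1] at this
  have i1 : 0 ≤ (F x - 0) / (x - s) := div_nonneg (by linarith) (by linarith [hx.1])
  have i2 : (0 - F x) / (t - x) ≤ 0 := div_nonpos_of_nonpos_of_nonneg (by linarith) (by linarith [hx.2])
  linarith

/-- sign persistence on an interval -/
theorem pos_of_ne {F : ℝ → ℝ} {s : Set ℝ} (hs : IsPreconnected s) (hc : ContinuousOn F s)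
    (hn : ∀ x ∈ s, F x ≠ 0) {x0 : ℝ} (hx0 : x0 ∈ s) (h0 : 0 < F x0) {x : ℝ} (hx : x ∈ s) : 0 < F x := by
  by_contra! h
  obtain ⟨y, hy, e⟩ := hs.intermediate_value hx hx0 hc (show (0:ℝ) ∈ Icc _ _ from ⟨h, h0.le⟩)
  exact hn y hy e

namespace WeierstrassData
variable (W : WeierstrassData)

/-- real part of `e₁` -/
def E1 : ℝ := W.e1.re
/-- real part of `e₂` -/
def E2 : ℝ := W.e2.re
/-- real part of `e₃` -/
def E3 : ℝ := W.e3.re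
/-- `η₁` -/
def h : ℝ := (W.Z W.w1).re
/-- `i η₃` -/
def g : ℝ := -(W.Z W.w3).im
/-- derivative of the Floquet exponent -/
def F1 (k : ℂ) : ℂ := W.Z W.w2 + W.w2 * W.P k

theorem fF_hasDerivAt {k : ℂ} (hk : k ∉ W.lattice) : HasDerivAt W.fF (W.F1 k) k := by
  have := ((hasDerivAt_id k).const_mul (W.Z W.w2)).sub ((W.Z_hasDerivAt hk).const_mul W.w2)
  exact this.congr_deriv (by simp [F1])

theorem F1_hasDerivAt {k : ℂ} (hk : k ∉ W.lattice) : HasDerivAt W.F1 (W.w2 * W.dP k) k :=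
  ((W.P_hasDerivAt hk).const_mul W.w2).const_add _

theorem fF_odd (k : ℂ) : W.fF (-k) = -W.fF k := by simp [fF, W.Z_odd]; ring
theorem fF_w2 : W.fF W.w2 = 0 := by simp [fF]; ring

/-- real part of exponent -/
def U (x y : ℝ) : ℝ := (W.fF (pt x y)).re
/-- imaginary part of exponent -/
def V (x y : ℝ) : ℝ := (W.fF (pt x y)).im

section
variable {W} {x y : ℝ} (hk : pt x y ∉ W.lattice)
include hk
theorem P_dx : HasDerivAt (fun x => W.P (pt x y)) (W.dP (pt x y)) x :=
  ((W.P_hasDerivAt hk).comp_of_eq x (hasDerivAt_pt_x x y) rfl).congr_deriv (by simp)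
theorem P_dy : HasDerivAt (fun y => W.P (pt x y)) (W.dP (pt x y) * I) y :=
  ((W.P_hasDerivAt hk).comp_of_eq y (hasDerivAt_pt_y x y) rfl).congr_deriv (by simp)
theorem fF_dx : HasDerivAt (fun x => W.fF (pt x y)) (W.F1 (pt x y)) x :=
  ((W.fF_hasDerivAt hk).comp_of_eq x (hasDerivAt_pt_x x y) rfl).congr_deriv (by simp)
theorem fF_dy : HasDerivAt (fun y => W.fF (pt x y)) (W.F1 (pt x y) * I) y :=
  ((W.fF_hasDerivAt hk).comp_of_eq y (hasDerivAt_pt_y x y) rfl).congr_deriv (by simp)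
theorem U_dx : HasDerivAt (fun x => W.U x y) (W.F1 (pt x y)).re x := (fF_dx hk).re'
theorem V_dx : HasDerivAt (fun x => W.V x y) (W.F1 (pt x y)).im x := (fF_dx hk).im'
theorem U_dy : HasDerivAt (fun y => W.U x y) (-(W.F1 (pt x y)).im) y :=
  (fF_dy hk).re'.congr_deriv (by simp)
theorem V_dy : HasDerivAt (fun y => W.V x y) (W.F1 (pt x y)).re y :=
  (fF_dy hk).im'.congr_deriv (by simp)
theorem F1_dx : HasDerivAt (fun x => W.F1 (pt x y)) (W.w2 * W.dP (pt x y)) x :=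
  ((W.F1_hasDerivAt hk).comp_of_eq x (hasDerivAt_pt_x x y) rfl).congr_deriv (by simp)
theorem F1_dy : HasDerivAt (fun y => W.F1 (pt x y)) (W.w2 * W.dP (pt x y) * I) y :=
  ((W.F1_hasDerivAt hk).comp_of_eq y (hasDerivAt_pt_y x y) rfl).congr_deriv (by simp)
end

section rect
variable {W} (hR : W.Rect)
include hR

theorem w1_pt : W.w1 = pt W.a 0 := by rw [w1_eq hR]; simp [pt]
theorem w3_pt : W.w3 = pt 0 W.b := by rw [w3_eq hR]; simp [pt]
theorem w2_pt : W.w2 = pt W.a W.b := by rw [w2_eq hR]; simp [pt]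

theorem real_of_conj {z : ℂ} (hz : z ∉ W.lattice) (h : W.P (conj z) = W.P z) : (W.P z).im = 0 := by
  rw [P_conj hR hz] at h
  exact conj_eq_iff_im.1 h

theorem e1_eq : W.e1 = W.E1 := by
  have : (W.P W.w1).im = 0 := real_of_conj hR W.half1_notMem (by
    rw [w1_pt hR, pt_conj]; simp)
  exact Complex.ext (by simp [E1]) (by simpa [e1] using this)
theorem e3_eq : W.e3 = W.E3 := by
  have : (W.P W.w3).im = 0 := real_of_conj hR W.half3_notMem (by
    rw [← W.P_even W.half3_notMem, w3_pt hR, pt_conj, pt_neg]; simp)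
  exact Complex.ext (by simp [E3]) (by simpa [e3] using this)
theorem e2_eq : W.e2 = W.E2 := by
  have : (W.P W.w2).im = 0 := real_of_conj hR W.half2_notMem (by
    rw [← W.P_periodic _ W.two_w3_mem (conj W.w2), w2_pt hR, w3_pt hR, pt_conj]
    congr 1; simp [pt]; ring)
  exact Complex.ext (by simp [E2]) (by simpa [e2] using this)

theorem Zw1 : W.Z W.w1 = W.h := by
  have h1 := Z_conj hR W.half1_notMem
  have : conj W.w1 = W.w1 := by rw [w1_pt hR, pt_conj]; simp
  rw [this] at h1
  exact Complex.ext (by simp [h]) (by simpa using conj_eq_iff_im.1 h1.symm)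
theorem Zw3 : W.Z W.w3 = -W.g * I := by
  have h1 := Z_conj hR W.half3_notMem
  have : conj W.w3 = -W.w3 := by rw [w3_pt hR, pt_conj, pt_neg]; simp
  rw [this, W.Z_odd] at h1
  have := congrArg Complex.re h1
  simp only [neg_re, conj_re] at this
  exact Complex.ext (by simp; linarith) (by simp [g])
theorem Zw2 : W.Z W.w2 = pt W.h (-W.g) := by
  rw [W.Z_w2, Zw1 hR, Zw3 hR]; simp [pt]

theorem leg : W.h * W.b + W.g * W.a = Real.pi / 2 := by
  have := legendre hR
  rw [Zw1 hR, Zw3 hR, w1_eq hR, w3_eq hR] at this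
  have := congrArg Complex.im this
  simpa using this

theorem F1_re (k : ℂ) : (W.F1 k).re = W.h + W.a * (W.P k).re - W.b * (W.P k).im := by
  rw [F1, Zw2 hR, w2_pt hR]; simp; ring
theorem F1_im (k : ℂ) : (W.F1 k).im = -W.g + W.b * (W.P k).re + W.a * (W.P k).im := by
  rw [F1, Zw2 hR, w2_pt hR]; simp; ring

theorem fF_add1 {k : ℂ} (hk : k ∉ W.lattice) : W.fF (k + 2 * W.w1) = W.fF k - Real.pi * I := by
  have := legendre hR
  rw [fF, fF, W.Z_half W.half1_notMem W.two_w1_mem hk, W.Z_w2, w2]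
  linear_combination (-2) * this
theorem fF_add3 {k : ℂ} (hk : k ∉ W.lattice) : W.fF (k + 2 * W.w3) = W.fF k + Real.pi * I := by
  have := legendre hR
  rw [fF, fF, W.Z_half W.half3_notMem W.two_w3_mem hk, W.Z_w2, w2]
  linear_combination (2) * this

theorem fF_w1 : W.fF W.w1 = -(Real.pi / 2) * I := by
  have := fF_add1 hR (k := -W.w1) (by rw [W.neg_mem_iff]; exact W.half1_notMem)
  rw [W.fF_odd, show -W.w1 + 2 * W.w1 = W.w1 by ring] at this
  linear_combination this / 2
theorem fF_w3 : W.fF W.w3 = (Real.pi / 2) * I := by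
  have := fF_add3 hR (k := -W.w3) (by rw [W.neg_mem_iff]; exact W.half3_notMem)
  rw [W.fF_odd, show -W.w3 + 2 * W.w3 = W.w3 by ring] at this
  linear_combination this / 2

theorem neg_w1_pt : pt (-W.a) 0 = -W.w1 := by rw [w1_pt hR, pt_neg]; simp
theorem corner2_pt : pt (-W.a) W.b = W.w2 + -(2 * W.w1) := by
  rw [w1_pt hR, w2_pt hR]; simp [pt]; ring

theorem pt_notMem {x y : ℝ} (hx : |x| < 2 * W.a) (hy : |y| < 2 * W.b) (h0 : x ≠ 0 ∨ y ≠ 0) :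
    pt x y ∉ W.lattice := by
  refine notMem_of hR (by simpa) (by simpa) ?_
  intro h
  have h1 := congrArg Complex.re h
  have h2 := congrArg Complex.im h
  simp at h1 h2
  tauto

/-- points of the closed rectangle other than the origin -/
theorem pt_notMem' {x y : ℝ} (hx : x ∈ Icc (-W.a) 0) (hy : y ∈ Icc 0 W.b) (h0 : x ≠ 0 ∨ y ≠ 0) :
    pt x y ∉ W.lattice := by
  have := a_pos hR
  have := b_pos hR
  refine pt_notMem hR ?_ ?_ h0 <;> rw [abs_lt] <;> constructor <;> linarith [hx.1, hx.2, hy.1, hy.2]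

theorem corner2_notMem : pt (-W.a) W.b ∉ W.lattice :=
  pt_notMem' hR ⟨le_rfl, by linarith [a_pos hR]⟩ ⟨(b_pos hR).le, le_rfl⟩ (Or.inl (by linarith [a_pos hR]))

theorem fF_corner1 : W.fF (pt (-W.a) 0) = (Real.pi / 2) * I := by
  rw [neg_w1_pt hR, W.fF_odd, fF_w1 hR]; ring
theorem fF_corner2 : W.fF (pt (-W.a) W.b) = Real.pi * I := by
  have := fF_add1 hR (corner2_notMem hR)
  rw [corner2_pt hR, show W.w2 + -(2 * W.w1) + 2 * W.w1 = W.w2 by ring, W.fF_w2] at this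
  rw [corner2_pt hR]; linear_combination -this
theorem fF_corner3 : W.fF (pt 0 W.b) = (Real.pi / 2) * I := by rw [← w3_pt hR, fF_w3 hR]

theorem P_corner1 : W.P (pt (-W.a) 0) = W.E1 := by
  rw [neg_w1_pt hR, W.P_even W.half1_notMem, ← e1_eq hR, e1]
theorem P_corner2 : W.P (pt (-W.a) W.b) = W.E2 := by
  rw [corner2_pt hR, W.P_periodic _ (W.neg_mem W.two_w1_mem), ← e2_eq hR, e2]
theorem P_corner3 : W.P (pt 0 W.b) = W.E3 := by
  rw [← w3_pt hR, ← e3_eq hR, e3]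

/-- `℘` is injective on the closed rectangle -/
theorem P_inj_rect {x y x' y' : ℝ} (hx : x ∈ Icc (-W.a) 0) (hy : y ∈ Icc 0 W.b) (h0 : x ≠ 0 ∨ y ≠ 0)
    (hx' : x' ∈ Icc (-W.a) 0) (hy' : y' ∈ Icc 0 W.b) (h0' : x' ≠ 0 ∨ y' ≠ 0)
    (h : W.P (pt x y) = W.P (pt x' y')) : x = x' ∧ y = y' := by
  have ha := a_pos hR
  have hb := b_pos hR
  rcases W.P_inj (pt_notMem' hR hx hy h0) (pt_notMem' hR hx' hy' h0') h with hm | hm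
  · obtain ⟨m, n, e1, e2⟩ := (mem_iff hR).1 hm
    simp at e1 e2
    have m1 : (m:ℝ) ≤ 0 := by
      by_contra! hc
      nlinarith [hx.2, hx'.2, mul_pos hc ha]
    have m2 : (-2:ℝ) < m ∨ x = - W.a ∧ x' = -W.a := by
      by_cases hc : (-2:ℝ) < m
      · exact Or.inl hc
      · push Not at hc
        right; constructor <;> nlinarith [hx.1, hx'.1]
    have n1 : 0 ≤ (n:ℝ) := by
      by_contra! hc
      nlinarith [hy.1, hy'.1, mul_pos (neg_pos.2 hc) hb]
    have m3 : -1 ≤ (m:ℝ) := by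
      by_contra! hc
      nlinarith [hx.1, hx'.1]
    have n2 : (n:ℝ) ≤ 1 := by
      by_contra! hc
      nlinarith [hy.2, hy'.2]
    have m1' : m ≤ 0 := by exact_mod_cast m1
    have m3' : -1 ≤ m := by exact_mod_cast m3
    have n1' : 0 ≤ n := by exact_mod_cast n1
    have n2' : n ≤ 1 := by exact_mod_cast n2
    have hm : m = 0 ∨ m = -1 := by omega
    have hn : n = 0 ∨ n = 1 := by omega
    constructor
    · rcases hm with rfl | rfl
      · push_cast at e1; linarith [hx.2, hx'.2]
      · push_cast at e1; linarith [hx.1, hx'.1]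
    · rcases hn with rfl | rfl
      · push_cast at e2; linarith [hy.1, hy'.1]
      · push_cast at e2; linarith [hy.2, hy'.2]
  · have := eq_zero_of_mem hR hm (by simp [abs_lt]; constructor <;> linarith [hx.1, hx.2, hx'.1, hx'.2])
      (by simp [abs_lt]; constructor <;> linarith [hy.1, hy.2, hy'.1, hy'.2])
    have h1 := congrArg Complex.re this
    have h2 := congrArg Complex.im this
    simp at h1 h2
    exact ⟨by linarith, by linarith⟩

end rect
end WeierstrassData

end part6

section part7
open scoped Topology ComplexConjugate
namespace WeierstrassData
variable (W : WeierstrassData)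

theorem pole_bound : ∃ δ > 0, ∀ z : ℂ, z ≠ 0 → ‖z‖ < δ → ‖W.P z - 1 / z ^ 2‖ < 1 := by
  have h := (Metric.tendsto_nhds.1 W.P_pole) 1 one_pos
  rw [eventually_nhdsWithin_iff, Metric.eventually_nhds_iff] at h
  obtain ⟨δ, hδ, h⟩ := h
  exact ⟨δ, hδ, fun z h0 hz => by simpa using h (by simpa using hz) h0⟩

section rect
variable {W} (hR : W.Rect)
include hR

theorem P_cont_rect {x y : ℝ} (hx : x ∈ Icc (-W.a) 0) (hy : y ∈ Icc 0 W.b) (h0 : x ≠ 0 ∨ y ≠ 0) :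
    ContinuousAt W.P (pt x y) := (W.P_diff _ (pt_notMem' hR hx hy h0)).continuousAt

theorem ma_mem : -W.a ∈ Icc (-W.a) 0 := ⟨le_rfl, by linarith [a_pos hR]⟩
theorem z_mem_a : (0:ℝ) ∈ Icc (-W.a) 0 := ⟨by linarith [a_pos hR], le_rfl⟩
theorem b_mem : W.b ∈ Icc 0 W.b := ⟨(b_pos hR).le, le_rfl⟩
theorem z_mem_b : (0:ℝ) ∈ Icc 0 W.b := ⟨le_rfl, (b_pos hR).le⟩
theorem ma_ne : -W.a ≠ 0 := by linarith [a_pos hR]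
theorem b_ne : W.b ≠ 0 := (b_pos hR).ne'

theorem im_bottom {x : ℝ} (hx : x ∈ Ico (-W.a) 0) : (W.P (pt x 0)).im = 0 :=
  real_of_conj hR (pt_notMem' hR ⟨hx.1, hx.2.le⟩ (z_mem_b hR) (Or.inl hx.2.ne)) (by rw [pt_conj]; simp)
theorem im_right {y : ℝ} (hy : y ∈ Ioc 0 W.b) : (W.P (pt 0 y)).im = 0 := by
  have := (pt_notMem' hR (z_mem_a hR) ⟨hy.1.le, hy.2⟩ (Or.inr hy.1.ne'))
  exact real_of_conj hR this (by rw [← W.P_even this, pt_conj, pt_neg]; simp)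
theorem im_left {y : ℝ} (hy : y ∈ Icc 0 W.b) : (W.P (pt (-W.a) y)).im = 0 := by
  have := (pt_notMem' hR (ma_mem hR) hy (Or.inl (ma_ne hR)))
  refine real_of_conj hR this ?_
  rw [← W.P_even this, ← W.P_periodic _ W.two_w1_mem (conj _), pt_conj, pt_neg, w1_pt hR]
  congr 1; simp [pt]; ring
theorem im_top {x : ℝ} (hx : x ∈ Icc (-W.a) 0) : (W.P (pt x W.b)).im = 0 := by
  have := (pt_notMem' hR hx (b_mem hR) (Or.inr (b_ne hR)))
  refine real_of_conj hR this ?_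
  rw [← W.P_periodic _ W.two_w3_mem (conj _), pt_conj, w3_pt hR]
  congr 1; simp [pt]; ring

theorem cont_bottom : ContinuousOn (fun x : ℝ => (W.P (pt x 0)).re) (Ico (-W.a) 0) := fun x hx =>
  (P_dx (pt_notMem' hR ⟨hx.1, hx.2.le⟩ (z_mem_b hR) (Or.inl hx.2.ne))).re'.continuousAt.continuousWithinAt
theorem cont_right : ContinuousOn (fun y : ℝ => (W.P (pt 0 y)).re) (Ioc 0 W.b) := fun y hy =>
  (P_dy (pt_notMem' hR (z_mem_a hR) ⟨hy.1.le, hy.2⟩ (Or.inr hy.1.ne'))).re'.continuousAt.continuousWithinAt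
theorem cont_left : ContinuousOn (fun y : ℝ => (W.P (pt (-W.a) y)).re) (Icc 0 W.b) := fun y hy =>
  (P_dy (pt_notMem' hR (ma_mem hR) hy (Or.inl (ma_ne hR)))).re'.continuousAt.continuousWithinAt
theorem cont_top : ContinuousOn (fun x : ℝ => (W.P (pt x W.b)).re) (Icc (-W.a) 0) := fun x hx =>
  (P_dx (pt_notMem' hR hx (b_mem hR) (Or.inr (b_ne hR)))).re'.continuousAt.continuousWithinAt

theorem bottom_large (M : ℝ) : ∃ x ∈ Ioo (-W.a) 0, M < (W.P (pt x 0)).re := by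
  have ha := a_pos hR
  obtain ⟨δ, hδ, hP⟩ := W.pole_bound
  set r := min (δ / 2) (min (W.a / 2) (1 / (|M| + 2))) with hr
  have hM : 0 < |M| + 2 := by positivity
  have hr0 : 0 < r := by positivity
  have r1 : r ≤ δ / 2 := min_le_left _ _
  have r2 : r ≤ W.a / 2 := (min_le_right _ _).trans (min_le_left _ _)
  have r3 : r ≤ 1 / (|M| + 2) := (min_le_right _ _).trans (min_le_right _ _)
  have e : pt (-r) 0 = ((-r : ℝ) : ℂ) := by simp [pt]
  refine ⟨-r, ⟨by linarith, by linarith⟩, ?_⟩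
  have hn : ‖((-r : ℝ) : ℂ)‖ = r := by rw [norm_real]; simp [abs_of_pos hr0]
  have := hP (pt (-r) 0) (by rw [e]; exact_mod_cast (by linarith : -r ≠ 0)) (by rw [e, hn]; linarith)
  have h2 := (abs_re_le_norm _).trans_lt this
  have h3 : (1 / (pt (-r) 0) ^ 2 : ℂ).re = 1 / r ^ 2 := by
    rw [e]
    rw [show (1 / ((-r:ℝ):ℂ)^2) = ((1 / r^2 : ℝ):ℂ) by push_cast; simp]
    exact ofReal_re _
  rw [sub_re, h3, abs_lt] at h2
  have h4 : |M| + 2 ≤ 1 / r := by rw [le_div_iff₀ hr0]; rw [le_div_iff₀ hM] at r3; linarith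
  have h5 : 1 / r ^ 2 = (1 / r) ^ 2 := by rw [div_pow, one_pow]
  have := le_abs_self M
  nlinarith [abs_nonneg M]

theorem right_large (M : ℝ) : ∃ y ∈ Ioo 0 W.b, (W.P (pt 0 y)).re < M := by
  have hb := b_pos hR
  obtain ⟨δ, hδ, hP⟩ := W.pole_bound
  set r := min (δ / 2) (min (W.b / 2) (1 / (|M| + 2))) with hr
  have hM : 0 < |M| + 2 := by positivity
  have hr0 : 0 < r := by positivity
  have r1 : r ≤ δ / 2 := min_le_left _ _
  have r2 : r ≤ W.b / 2 := (min_le_right _ _).trans (min_le_left _ _)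
  have r3 : r ≤ 1 / (|M| + 2) := (min_le_right _ _).trans (min_le_right _ _)
  have e : pt 0 r = (r : ℂ) * I := by simp [pt]
  refine ⟨r, ⟨by linarith, by linarith⟩, ?_⟩
  have hn : ‖(r : ℂ) * I‖ = r := by simp [abs_of_pos hr0]
  have := hP (pt 0 r) (by rw [e]; simp [hr0.ne']) (by rw [e, hn]; linarith)
  have h2 := (abs_re_le_norm _).trans_lt this
  have h3 : (1 / (pt 0 r) ^ 2 : ℂ).re = -(1 / r ^ 2) := by
    rw [e]
    rw [show (1 / ((r:ℂ) * I)^2) = ((-(1 / r^2) : ℝ):ℂ) by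
      rw [mul_pow, I_sq]; push_cast; rw [mul_neg_one, div_neg]]
    exact ofReal_re _
  rw [sub_re, h3, abs_lt] at h2
  have h4 : |M| + 2 ≤ 1 / r := by rw [le_div_iff₀ hr0]; rw [le_div_iff₀ hM] at r3; linarith
  have h5 : 1 / r ^ 2 = (1 / r) ^ 2 := by rw [div_pow, one_pow]
  have := neg_abs_le M
  nlinarith [abs_nonneg M]

theorem real_eq {z : ℂ} {r : ℝ} (h : z.im = 0) (h' : z.re = r) : z = r :=
  Complex.ext (by simpa using h') (by simpa using h)

theorem bottom_surj {r : ℝ} (hr : W.E1 ≤ r) : ∃ x ∈ Ico (-W.a) 0, W.P (pt x 0) = r := by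
  obtain ⟨x1, hx1, h1⟩ := bottom_large hR r
  have h2 : (W.P (pt (-W.a) 0)).re = W.E1 := by rw [P_corner1 hR]; simp
  obtain ⟨x, hx, e⟩ := isPreconnected_Ico.intermediate_value (⟨le_rfl, by linarith [a_pos hR]⟩ : -W.a ∈ Ico (-W.a) 0)
    (⟨hx1.1.le, hx1.2⟩ : x1 ∈ Ico (-W.a) 0) (cont_bottom hR) (⟨by rw [h2]; exact hr, h1.le⟩)
  exact ⟨x, hx, real_eq hR (im_bottom hR hx) e⟩

theorem right_surj {r : ℝ} (hr : r ≤ W.E3) : ∃ y ∈ Ioc 0 W.b, W.P (pt 0 y) = r := by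
  obtain ⟨x1, hx1, h1⟩ := right_large hR r
  have h2 : (W.P (pt 0 W.b)).re = W.E3 := by rw [P_corner3 hR]; simp
  obtain ⟨x, hx, e⟩ := isPreconnected_Ioc.intermediate_value (⟨hx1.1, hx1.2.le⟩ : x1 ∈ Ioc 0 W.b)
    (⟨b_pos hR, le_rfl⟩ : W.b ∈ Ioc 0 W.b) (cont_right hR) (⟨h1.le, by rw [h2]; exact hr⟩)
  exact ⟨x, hx, real_eq hR (im_right hR hx) e⟩

theorem lt_E1_of {x y : ℝ} (hx : x ∈ Icc (-W.a) 0) (hy : y ∈ Ioc 0 W.b) (him : (W.P (pt x y)).im = 0) :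
    (W.P (pt x y)).re < W.E1 := by
  by_contra! hc
  obtain ⟨x', hx', e⟩ := bottom_surj hR hc
  have := P_inj_rect hR hx ⟨hy.1.le, hy.2⟩ (Or.inr hy.1.ne') ⟨hx'.1, hx'.2.le⟩ (z_mem_b hR) (Or.inl hx'.2.ne)
    (by rw [e]; exact real_eq hR him rfl)
  exact hy.1.ne' this.2

theorem gt_E3_of {x y : ℝ} (hx : x ∈ Ico (-W.a) 0) (hy : y ∈ Icc 0 W.b) (him : (W.P (pt x y)).im = 0) :
    W.E3 < (W.P (pt x y)).re := by
  by_contra! hc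
  obtain ⟨x', hx', e⟩ := right_surj hR hc
  have := P_inj_rect hR ⟨hx.1, hx.2.le⟩ hy (Or.inl hx.2.ne) (z_mem_a hR) ⟨hx'.1.le, hx'.2⟩ (Or.inr hx'.1.ne')
    (by rw [e]; exact real_eq hR him rfl)
  exact hx.2.ne this.1

theorem E21 : W.E2 < W.E1 := by
  have := lt_E1_of hR (ma_mem hR) (⟨b_pos hR, le_rfl⟩ : W.b ∈ Ioc 0 W.b) (by rw [P_corner2 hR]; simp)
  rw [P_corner2 hR] at this; simpa using this
theorem E32 : W.E3 < W.E2 := by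
  have := gt_E3_of hR (⟨le_rfl, by linarith [a_pos hR]⟩ : -W.a ∈ Ico (-W.a) 0) (b_mem hR) (by rw [P_corner2 hR]; simp)
  rw [P_corner2 hR] at this; simpa using this

theorem bottom_gt {x : ℝ} (hx : x ∈ Ioo (-W.a) 0) : W.E1 < (W.P (pt x 0)).re := by
  obtain ⟨x0, hx0, h0⟩ := bottom_large hR W.E1
  have := pos_of_ne (F := fun x => (W.P (pt x 0)).re - W.E1) isPreconnected_Ioo
    (((cont_bottom hR).mono Ioo_subset_Ico_self).sub continuousOn_const) ?_ hx0 (sub_pos.2 h0) hx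
  · exact sub_pos.1 this
  · intro x hx h
    have := P_inj_rect hR ⟨hx.1.le, hx.2.le⟩ (z_mem_b hR) (Or.inl hx.2.ne) (ma_mem hR) (z_mem_b hR)
      (Or.inl (ma_ne hR)) (by rw [P_corner1 hR]; exact real_eq hR (im_bottom hR ⟨hx.1.le, hx.2⟩) (sub_eq_zero.1 h))
    exact hx.1.ne' this.1

theorem right_lt {y : ℝ} (hy : y ∈ Ioo 0 W.b) : (W.P (pt 0 y)).re < W.E3 := by
  obtain ⟨y0, hy0, h0⟩ := right_large hR W.E3
  have := pos_of_ne (F := fun y => W.E3 - (W.P (pt 0 y)).re) isPreconnected_Ioo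
    (continuousOn_const.sub ((cont_right hR).mono Ioo_subset_Ioc_self)) ?_ hy0 (sub_pos.2 h0) hy
  · exact sub_pos.1 this
  · intro y hy h
    have := P_inj_rect hR (z_mem_a hR) ⟨hy.1.le, hy.2.le⟩ (Or.inr hy.1.ne') (z_mem_a hR) (b_mem hR)
      (Or.inr (b_ne hR)) (by rw [P_corner3 hR]; exact real_eq hR (im_right hR ⟨hy.1, hy.2.le⟩) (sub_eq_zero.1 h).symm)
    exact hy.2.ne this.2

theorem left_anti : StrictAntiOn (fun y : ℝ => (W.P (pt (-W.a) y)).re) (Icc 0 W.b) := by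
  refine (cont_left hR).strictAntiOn_of_injOn_Icc (b_pos hR).le ?_ ?_
  · show (W.P (pt (-W.a) W.b)).re ≤ (W.P (pt (-W.a) 0)).re
    rw [P_corner1 hR, P_corner2 hR]; simpa using (E21 hR).le
  · intro y hy y' hy' h
    exact (P_inj_rect hR (ma_mem hR) hy (Or.inl (ma_ne hR)) (ma_mem hR) hy' (Or.inl (ma_ne hR))
      (Complex.ext h (by rw [im_left hR hy, im_left hR hy']))).2

theorem top_anti : StrictAntiOn (fun x : ℝ => (W.P (pt x W.b)).re) (Icc (-W.a) 0) := by
  refine (cont_top hR).strictAntiOn_of_injOn_Icc (by linarith [a_pos hR]) ?_ ?_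
  · show (W.P (pt 0 W.b)).re ≤ (W.P (pt (-W.a) W.b)).re
    rw [P_corner3 hR, P_corner2 hR]; simpa using (E32 hR).le
  · intro y hy y' hy' h
    exact (P_inj_rect hR hy (b_mem hR) (Or.inr (b_ne hR)) hy' (b_mem hR) (Or.inr (b_ne hR))
      (Complex.ext h (by rw [im_top hR hy, im_top hR hy']))).1

theorem left_bd {y : ℝ} (hy : y ∈ Ioo 0 W.b) : W.E2 < (W.P (pt (-W.a) y)).re ∧ (W.P (pt (-W.a) y)).re < W.E1 := by
  have h1 := left_anti hR (z_mem_b hR) ⟨hy.1.le, hy.2.le⟩ hy.1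
  have h2 := left_anti hR ⟨hy.1.le, hy.2.le⟩ (b_mem hR) hy.2
  simp only [P_corner1 hR, P_corner2 hR, ofReal_re] at h1 h2
  exact ⟨h2, h1⟩
theorem top_bd {x : ℝ} (hx : x ∈ Ioo (-W.a) 0) : W.E3 < (W.P (pt x W.b)).re ∧ (W.P (pt x W.b)).re < W.E2 := by
  have h1 := top_anti hR (ma_mem hR) ⟨hx.1.le, hx.2.le⟩ hx.1
  have h2 := top_anti hR ⟨hx.1.le, hx.2.le⟩ (z_mem_a hR) hx.2
  simp only [P_corner3 hR, P_corner2 hR, ofReal_re] at h1 h2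
  exact ⟨h2, h1⟩

/-! ### signs of `u` on the edges -/

theorem U_corner1 : W.U (-W.a) 0 = 0 := by rw [U, fF_corner1 hR]; simp
theorem U_corner2 : W.U (-W.a) W.b = 0 := by rw [U, fF_corner2 hR]; simp
theorem U_corner3 : W.U 0 W.b = 0 := by rw [U, fF_corner3 hR]; simp

theorem U_left_dy {y : ℝ} (hy : y ∈ Icc 0 W.b) :
    HasDerivAt (fun y => W.U (-W.a) y) (W.g - W.b * (W.P (pt (-W.a) y)).re) y := by
  refine (U_dy (pt_notMem' hR (ma_mem hR) hy (Or.inl (ma_ne hR)))).congr_deriv ?_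
  rw [F1_im hR, im_left hR hy]; ring
theorem U_top_dx {x : ℝ} (hx : x ∈ Icc (-W.a) 0) :
    HasDerivAt (fun x => W.U x W.b) (W.h + W.a * (W.P (pt x W.b)).re) x := by
  refine (U_dx (pt_notMem' hR hx (b_mem hR) (Or.inr (b_ne hR)))).congr_deriv ?_
  rw [F1_re hR, im_top hR hx]; ring
theorem U_bottom_dx {x : ℝ} (hx : x ∈ Ico (-W.a) 0) :
    HasDerivAt (fun x => W.U x 0) (W.h + W.a * (W.P (pt x 0)).re) x := by
  refine (U_dx (pt_notMem' hR ⟨hx.1, hx.2.le⟩ (z_mem_b hR) (Or.inl hx.2.ne))).congr_deriv ?_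
  rw [F1_re hR, im_bottom hR hx]; ring
theorem U_right_dy {y : ℝ} (hy : y ∈ Ioc 0 W.b) :
    HasDerivAt (fun y => W.U 0 y) (W.g - W.b * (W.P (pt 0 y)).re) y := by
  refine (U_dy (pt_notMem' hR (z_mem_a hR) ⟨hy.1.le, hy.2⟩ (Or.inr hy.1.ne'))).congr_deriv ?_
  rw [F1_im hR, im_right hR hy]; ring

theorem U_left_neg {y : ℝ} (hy : y ∈ Ioo 0 W.b) : W.U (-W.a) y < 0 := by
  refine neg_of_mono (F := fun y => W.U (-W.a) y) (F' := fun y => W.g - W.b * (W.P (pt (-W.a) y)).re)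
    (fun y hy => (U_left_dy hR hy).continuousAt.continuousWithinAt)
    (fun y hy => U_left_dy hR ⟨hy.1.le, hy.2.le⟩) ?_ (U_corner1 hR) (U_corner2 hR) hy
  intro s hs t ht hst
  have := left_anti hR ⟨hs.1.le, hs.2.le⟩ ⟨ht.1.le, ht.2.le⟩ hst
  have := mul_lt_mul_of_pos_left this (b_pos hR)
  simp only at this ⊢; linarith
theorem U_top_pos {x : ℝ} (hx : x ∈ Ioo (-W.a) 0) : 0 < W.U x W.b := by
  have := neg_of_mono (F := fun x => -W.U x W.b) (F' := fun x => -(W.h + W.a * (W.P (pt x W.b)).re))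
    (fun x hx => (U_top_dx hR hx).neg.continuousAt.continuousWithinAt)
    (fun x hx => (U_top_dx hR ⟨hx.1.le, hx.2.le⟩).neg) ?_ (by simp [U_corner2 hR]) (by simp [U_corner3 hR]) hx
  · exact neg_lt_zero.1 this
  intro s hs t ht hst
  have := top_anti hR ⟨hs.1.le, hs.2.le⟩ ⟨ht.1.le, ht.2.le⟩ hst
  have := mul_lt_mul_of_pos_left this (a_pos hR)
  simp only at this ⊢; linarith

/-- the critical constants -/
theorem A_bd : W.E3 < -W.h / W.a ∧ -W.h / W.a < W.E2 := by
  have ha := a_pos hR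
  obtain ⟨c, hc, e⟩ := exists_hasDerivAt_eq_zero (f := fun x => W.U x W.b)
    (f' := fun x => W.h + W.a * (W.P (pt x W.b)).re) (show -W.a < 0 by linarith)
    (fun x hx => (U_top_dx hR hx).continuousAt.continuousWithinAt) (by simp [U_corner2 hR, U_corner3 hR])
    (fun x hx => (U_top_dx hR ⟨hx.1.le, hx.2.le⟩))
  have : -W.h / W.a = (W.P (pt c W.b)).re := by field_simp; linarith
  rw [this]; exact top_bd hR hc
theorem B_bd : W.E2 < W.g / W.b ∧ W.g / W.b < W.E1 := by
  have hb := b_pos hR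
  obtain ⟨c, hc, e⟩ := exists_hasDerivAt_eq_zero (f := fun y => W.U (-W.a) y)
    (f' := fun y => W.g - W.b * (W.P (pt (-W.a) y)).re) hb
    (fun y hy => (U_left_dy hR hy).continuousAt.continuousWithinAt) (by simp [U_corner1 hR, U_corner2 hR])
    (fun y hy => (U_left_dy hR ⟨hy.1.le, hy.2.le⟩))
  have : W.g / W.b = (W.P (pt (-W.a) c)).re := by field_simp; linarith
  rw [this]; exact left_bd hR hc

theorem hE2 : 0 < W.h + W.a * W.E2 := by
  have := (A_bd hR).2; rw [div_lt_iff₀ (a_pos hR)] at this; linarith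
theorem hE3 : W.h + W.a * W.E3 < 0 := by
  have := (A_bd hR).1; rw [lt_div_iff₀ (a_pos hR)] at this; linarith
theorem hE1 : 0 < W.h + W.a * W.E1 := by
  have := hE2 hR; nlinarith [E21 hR, a_pos hR]
theorem gE1 : W.g - W.b * W.E1 < 0 := by
  have := (B_bd hR).2; rw [div_lt_iff₀ (b_pos hR)] at this; linarith
theorem gE2 : 0 < W.g - W.b * W.E2 := by
  have := (B_bd hR).1; rw [lt_div_iff₀ (b_pos hR)] at this; linarith
theorem gE3 : 0 < W.g - W.b * W.E3 := by
  have := gE2 hR; nlinarith [E32 hR, b_pos hR]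

theorem bottom_ge {x : ℝ} (hx : x ∈ Ico (-W.a) 0) : W.E1 ≤ (W.P (pt x 0)).re := by
  rcases eq_or_lt_of_le hx.1 with h | h
  · rw [← h, P_corner1 hR]; simp
  · exact (bottom_gt hR ⟨h, hx.2⟩).le

theorem bottom_dx_pos {x : ℝ} (hx : x ∈ Ico (-W.a) 0) : 0 < W.h + W.a * (W.P (pt x 0)).re := by
  have := hE1 hR; nlinarith [bottom_ge hR hx, a_pos hR]

theorem U_bottom_pos {x : ℝ} (hx : x ∈ Ioo (-W.a) 0) : 0 < W.U x 0 := by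
  have : StrictMonoOn (fun x => W.U x 0) (Ico (-W.a) 0) := by
    apply strictMonoOn_of_deriv_pos (convex_Ico _ _)
    · exact fun x hx => (U_bottom_dx hR hx).continuousAt.continuousWithinAt
    · intro x hx
      rw [interior_Ico] at hx
      rw [(U_bottom_dx hR ⟨hx.1.le, hx.2⟩).deriv]
      exact bottom_dx_pos hR ⟨hx.1.le, hx.2⟩
  have := this (⟨le_rfl, by linarith [a_pos hR]⟩ : -W.a ∈ Ico (-W.a) 0) ⟨hx.1.le, hx.2⟩ hx.1
  simpa [U_corner1 hR] using this

theorem U_right_neg {y : ℝ} (hy : y ∈ Ioo 0 W.b) : W.U 0 y < 0 := by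
  have : StrictMonoOn (fun y => W.U 0 y) (Ioc 0 W.b) := by
    apply strictMonoOn_of_deriv_pos (convex_Ioc _ _)
    · exact fun x hx => (U_right_dy hR hx).continuousAt.continuousWithinAt
    · intro x hx
      rw [interior_Ioc] at hx
      rw [(U_right_dy hR ⟨hx.1, hx.2.le⟩).deriv]
      have := gE3 hR; nlinarith [right_lt hR hx, b_pos hR]
  have := this ⟨hy.1, hy.2.le⟩ (⟨b_pos hR, le_rfl⟩ : W.b ∈ Ioc 0 W.b) hy.2
  simpa [U_corner3 hR] using this

end rect
end WeierstrassData

end part7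

section part8
open scoped Topology ComplexConjugate

theorem exists_sqrt_quad {z : ℂ} (hz : 0 < z.im) : ∃ s : ℂ, s ^ 2 = z ∧ 0 < s.re ∧ 0 < s.im := by
  obtain ⟨s, hs⟩ := IsAlgClosed.exists_pow_nat_eq z (n := 2) (by norm_num)
  have h1 : 2 * s.re * s.im = z.im := by rw [← hs]; simp [pow_two]; ring
  rcases lt_trichotomy s.re 0 with h | h | h
  · refine ⟨-s, by rw [neg_pow_two]; exact hs, by simpa, ?_⟩
    have : s.im < 0 := by by_contra! hc; nlinarith
    simpa
  · rw [h] at h1; simp at h1; linarith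
  · refine ⟨s, hs, h, ?_⟩
    by_contra! hc; nlinarith

theorem quad_mono {x y x' y' Y d d' : ℝ} (hx : 0 < x) (hy : 0 < y) (hx' : 0 < x') (hy' : 0 < y')
    (h1 : 2 * x * y = Y) (h1' : 2 * x' * y' = Y) (h2 : x ^ 2 - y ^ 2 = d) (h2' : x' ^ 2 - y' ^ 2 = d')
    (hd : d < d') : x < x' ∧ y' < y := by
  have a : x < x' := by
    by_contra! hc
    have : y ≤ y' := by
      by_contra! hc'
      nlinarith
    nlinarith
  refine ⟨a, ?_⟩
  by_contra! hc
  nlinarith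

/-- The key algebraic inequality. -/
theorem key_alg {w Q : ℂ} {e1 e2 e3 A : ℝ} (hw : 0 < w.im) (h1 : e3 < A) (h2 : A < e2) (h3 : e2 < e1)
    (hQ : Q ^ 2 = 4 * (w - e1) * (w - e2) * (w - e3)) : (conj (w - A) * Q).im ≠ 0 := by
  obtain ⟨s1, q1, r1, i1⟩ := exists_sqrt_quad (z := w - e1) (by simpa)
  obtain ⟨s2, q2, r2, i2⟩ := exists_sqrt_quad (z := w - e2) (by simpa)
  obtain ⟨s3, q3, r3, i3⟩ := exists_sqrt_quad (z := w - e3) (by simpa)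
  obtain ⟨s, q, r, i⟩ := exists_sqrt_quad (z := w - A) (by simpa)
  have dat : ∀ {s : ℂ} {e : ℝ}, s ^ 2 = w - e → 2 * s.re * s.im = w.im ∧ s.re ^ 2 - s.im ^ 2 = w.re - e := by
    intro s e hs
    have a := congrArg Complex.re hs
    have b := congrArg Complex.im hs
    simp [pow_two] at a b
    exact ⟨by linarith, by linarith⟩
  obtain ⟨m1, m1'⟩ := quad_mono r1 i1 r i (dat q1).1 (dat q).1 (dat q1).2 (dat q).2 (by linarith)
  obtain ⟨m2, m2'⟩ := quad_mono r2 i2 r i (dat q2).1 (dat q).1 (dat q2).2 (dat q).2 (by linarith)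
  obtain ⟨m3, m3'⟩ := quad_mono r i r3 i3 (dat q).1 (dat q3).1 (dat q).2 (dat q3).2 (by linarith)
  have hQ' : Q = 2 * (s1 * s2 * s3) ∨ Q = -(2 * (s1 * s2 * s3)) := by
    apply sq_eq_sq_iff_eq_or_eq_neg.1
    rw [hQ, ← q1, ← q2, ← q3]; ring
  have pos : 0 < (conj (w - A) * (s1 * s2 * s3)).im := by
    rw [← q]
    have e : conj (s ^ 2) * (s1 * s2 * s3) = (s1 * conj s) * (s2 * s3 * conj s) := by
      rw [map_pow]; ring
    rw [e, mul_im]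
    have c1 : 0 < (s1 * conj s).im := by simp; nlinarith
    have c2 : 0 < (s1 * conj s).re := by simp; positivity
    have d1 : 0 < (s2 * conj s).im := by simp; nlinarith
    have d2 : 0 < (s2 * conj s).re := by simp; positivity
    have f1 : (s3 * conj s).im < 0 := by simp; nlinarith
    have f2 : 0 < (s3 * conj s).re := by simp; positivity
    have c3 : 0 < (s2 * s3 * conj s).im := by
      rw [show s2 * s3 * conj s = s3 * (s2 * conj s) by ring, mul_im]; positivity
    have c4 : 0 < (s2 * s3 * conj s).re := by
      rw [show s2 * s3 * conj s = s2 * (s3 * conj s) by ring, mul_re]; nlinarith [mul_pos r2 f2]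
    positivity
  have e2 : (conj (w - A) * (2 * (s1 * s2 * s3))).im = 2 * (conj (w - A) * (s1 * s2 * s3)).im := by
    rw [show conj (w - A) * (2 * (s1 * s2 * s3)) = ((2:ℝ):ℂ) * (conj (w - A) * (s1 * s2 * s3)) by push_cast; ring,
      im_ofReal_mul]
  rcases hQ' with h | h
  · rw [h, e2]; linarith
  · rw [h, mul_neg, neg_im, e2]; linarith

/-- sign propagation on an interval -/
theorem pos_propagate {F F' : ℝ → ℝ} {s t : ℝ} (hc : ContinuousOn F (Icc s t))
    (hd : ∀ x ∈ Ioo s t, HasDerivAt F (F' x) x) (h0 : 0 < F s)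
    (hz : ∀ x ∈ Ioo s t, F x = 0 → 0 < F' x) {x : ℝ} (hx : x ∈ Ioo s t) : 0 < F x := by
  by_contra! hn
  have hcl : IsClosed (Icc s x ∩ F ⁻¹' Iic 0) :=
    (hc.mono (Icc_subset_Icc_right hx.2.le)).preimage_isClosed_of_isClosed isClosed_Icc isClosed_Iic
  have hne : (Icc s x ∩ F ⁻¹' Iic 0).Nonempty := ⟨x, ⟨hx.1.le, le_rfl⟩, hn⟩
  have hbd : BddBelow (Icc s x ∩ F ⁻¹' Iic 0) := ⟨s, fun y hy => hy.1.1⟩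
  have hm := hcl.csInf_mem hne hbd
  set z := sInf (Icc s x ∩ F ⁻¹' Iic 0) with hzdef
  have hlt : ∀ y ∈ Ico s z, 0 < F y := by
    intro y hy
    by_contra! h
    have := csInf_le hbd (show y ∈ Icc s x ∩ F ⁻¹' Iic 0 from ⟨⟨hy.1, hy.2.le.trans hm.1.2⟩, h⟩)
    linarith [hy.2]
  have hsz : s < z := by
    rcases eq_or_lt_of_le hm.1.1 with h | h
    · have h2 : F z ≤ 0 := hm.2
      rw [← h] at h2; linarith
    · exact h
  have hzt : z ∈ Ioo s t := ⟨hsz, hm.1.2.trans_lt hx.2⟩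
  have hle : F z ≤ 0 := hm.2
  have hz0 : F z = 0 := by
    refine le_antisymm hle ?_
    have h1 : Tendsto F (𝓝[<] z) (𝓝 (F z)) := (hd z hzt).continuousAt.tendsto.mono_left nhdsWithin_le_nhds
    refine ge_of_tendsto h1 ?_
    filter_upwards [Ioo_mem_nhdsLT hsz] with y hy using (hlt y ⟨hy.1.le, hy.2⟩).le
  have hp := hz z hzt hz0
  have hs := (hasDerivAt_iff_tendsto_slope.1 (hd z hzt)).mono_left
    (nhdsWithin_mono z (show Iio z ⊆ {z}ᶜ from fun y hy => ne_of_lt hy))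
  have : F' z ≤ 0 := by
    refine le_of_tendsto hs ?_
    filter_upwards [Ioo_mem_nhdsLT hsz] with y hy
    rw [slope_def_field, hz0]
    exact div_nonpos_of_nonneg_of_nonpos (by linarith [hlt y ⟨hy.1.le, hy.2⟩]) (by linarith [hy.2])
  linarith

/-- unimodality: a function positive at left, negative at right, and decreasing at its zeros. -/
theorem single_zero {F F' : ℝ → ℝ} {s t : ℝ} (hst : s < t) (hc : ContinuousOn F (Icc s t))
    (hd : ∀ x ∈ Ioo s t, HasDerivAt F (F' x) x) (h0 : 0 < F s) (h1 : F t < 0)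
    (hz : ∀ x ∈ Ioo s t, F x = 0 → F' x < 0) :
    ∃ m ∈ Ioo s t, F m = 0 ∧ (∀ x ∈ Ico s m, 0 < F x) ∧ (∀ x ∈ Ioc m t, F x < 0) := by
  obtain ⟨m, hm, e⟩ := intermediate_value_Icc' hst.le hc (⟨h1.le, h0.le⟩ : (0:ℝ) ∈ Icc _ _)
  have hm' : m ∈ Ioo s t := by
    refine ⟨lt_of_le_of_ne hm.1 ?_, lt_of_le_of_ne hm.2 ?_⟩ <;> rintro rfl <;> linarith
  have hev := (hasDerivAt_iff_tendsto_slope.1 (hd m hm')).eventually (gt_mem_nhds (hz m hm' e))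
  refine ⟨m, hm', e, ?_, ?_⟩
  · intro x hx
    have hevl := hev.filter_mono (nhdsWithin_mono m (show Iio m ⊆ {m}ᶜ from fun y hy => ne_of_lt hy))
    obtain ⟨y, hy1, hy2⟩ := (hevl.and (Ioo_mem_nhdsLT (max_lt hx.2 hm'.1))).exists
    rcases eq_or_lt_of_le hx.1 with h | hsx
    · rwa [← h]
    have hxy : x < y := (le_max_left _ _).trans_lt hy2.1
    have hFy : 0 < F y := by
      rw [slope_def_field, e] at hy1
      by_contra! hneg
      have := div_nonneg_of_nonpos (by linarith : F y - 0 ≤ 0) (by linarith [hy2.2] : y - m ≤ 0)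
      linarith
    have := pos_propagate (F := fun r => F (-r)) (F' := fun r => -F' (-r)) (s := -y) (t := -s) (x := -x)
      (hc.comp continuousOn_neg (fun r hr => ⟨by linarith [hr.2], by linarith [hr.1, hy2.2, hm'.2]⟩))
      (fun r hr => by
        have := (hd (-r) ⟨by linarith [hr.2], by linarith [hr.1, hy2.2, hm'.2]⟩).comp r (hasDerivAt_neg r)
        exact this.congr_deriv (by ring))
      (by simpa using hFy)
      (fun r hr h => by
        have := hz (-r) ⟨by linarith [hr.2], by linarith [hr.1, hy2.2, hm'.2]⟩ h
        simpa using this) ⟨by linarith, by linarith⟩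
    simpa using this
  · intro x hx
    have hevl := hev.filter_mono (nhdsWithin_mono m (show Ioi m ⊆ {m}ᶜ from fun y hy => ne_of_gt hy))
    obtain ⟨y, hy1, hy2⟩ := (hevl.and (Ioo_mem_nhdsGT (lt_min hx.1 hm'.2))).exists
    rcases eq_or_lt_of_le hx.2 with h | hsx
    · rwa [h]
    have hxy : y < x := hy2.2.trans_le (min_le_left _ _)
    have hFy : F y < 0 := by
      rw [slope_def_field, e] at hy1
      by_contra! hneg
      have := div_nonneg (by linarith : 0 ≤ F y - 0) (by linarith [hy2.1] : 0 ≤ y - m)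
      linarith
    have := pos_propagate (F := fun r => -F r) (F' := fun r => -F' r) (s := y) (t := t) (x := x)
      (hc.neg.mono (Icc_subset_Icc_left (by linarith [hy2.1, hm'.1])))
      (fun r hr => (hd r ⟨by linarith [hr.1, hy2.1, hm'.1], hr.2⟩).neg)
      (by simpa using hFy)
      (fun r hr h => by
        have := hz r ⟨by linarith [hr.1, hy2.1, hm'.1], hr.2⟩ (by simpa using h)
        simpa using this) ⟨hxy, hsx⟩
    simpa using this

end part8

section part9
open scoped Topology ComplexConjugate

theorem pos_of_ne_gen {X : Type*} [TopologicalSpace X] {F : X → ℝ} {s : Set X} (hs : IsPreconnected s) (hc : ContinuousOn F s)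
    (hn : ∀ x ∈ s, F x ≠ 0) {x0 : X} (hx0 : x0 ∈ s) (h0 : 0 < F x0) {x : X} (hx : x ∈ s) : 0 < F x := by
  by_contra! h
  obtain ⟨y, hy, e⟩ := hs.intermediate_value hx hx0 hc (show (0:ℝ) ∈ Icc _ _ from ⟨h, h0.le⟩)
  exact hn y hy e

theorem continuous_pt : Continuous (fun p : ℝ × ℝ => pt p.1 p.2) := by unfold pt; fun_prop

namespace WeierstrassData
variable (W : WeierstrassData)

section rect
variable {W} (hR : W.Rect)
include hR

theorem int_notMem {x y : ℝ} (hx : x ∈ Ioo (-W.a) 0) (hy : y ∈ Ioo 0 W.b) : pt x y ∉ W.lattice :=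
  pt_notMem' hR ⟨hx.1.le, hx.2.le⟩ ⟨hy.1.le, hy.2.le⟩ (Or.inl hx.2.ne)

theorem imP_ne {x y : ℝ} (hx : x ∈ Ioo (-W.a) 0) (hy : y ∈ Ioo 0 W.b) : (W.P (pt x y)).im ≠ 0 := by
  intro h
  have hk := int_notMem hR hx hy
  have h2 : W.P (conj (pt x y)) = W.P (pt x y) := by rw [P_conj hR hk]; exact conj_eq_iff_im.2 h
  rcases W.P_inj (by rwa [conj_mem hR]) hk h2 with hm | hm
  · have := eq_zero_of_mem hR hm (by simp [abs_lt]; constructor <;> linarith [hx.1, hx.2])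
      (by simpa using b_pos hR)
    have := congrArg Complex.re this
    simp at this; linarith [hx.2]
  · have := eq_zero_of_mem hR hm (by simpa using a_pos hR)
      (by simp [abs_lt]; constructor <;> linarith [hy.1, hy.2])
    have := congrArg Complex.im this
    simp at this; linarith [hy.1]

theorem cont_int (f : ℂ → ℂ) (hf : ∀ k, k ∉ W.lattice → ContinuousAt f k) :
    ContinuousOn (fun p : ℝ × ℝ => f (pt p.1 p.2)) (Ioo (-W.a) 0 ×ˢ Ioo 0 W.b) := fun p hp =>
  (ContinuousAt.comp (f := fun p : ℝ × ℝ => pt p.1 p.2) (hf _ (int_notMem hR hp.1 hp.2))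
    continuous_pt.continuousAt).continuousWithinAt

theorem imP_pos {x y : ℝ} (hx : x ∈ Ioo (-W.a) 0) (hy : y ∈ Ioo 0 W.b) : 0 < (W.P (pt x y)).im := by
  have ha := a_pos hR
  have hb := b_pos hR
  obtain ⟨δ, hδ, hP⟩ := W.pole_bound
  obtain ⟨r, hr0, hr1⟩ := exists_between (show 0 < min (min (δ / 2) (1/2)) (min W.a W.b) by positivity)
  simp only [lt_min_iff] at hr1
  obtain ⟨⟨r1, r2⟩, r3, r4⟩ := hr1
  have hz : pt (-r) r = r * (-1 + I) := by simp [pt]; ring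
  have hz2 : 1 / pt (-r) r ^ 2 = ((1 / (2 * r^2) : ℝ) : ℂ) * I := by
    have hr : (r:ℂ) ≠ 0 := by exact_mod_cast hr0.ne'
    have e : (pt (-r) r)^2 = -2 * r^2 * I := by
      rw [hz]; linear_combination (r^2 : ℂ) * I_sq
    rw [e]; push_cast
    field_simp
    rw [I_sq]
  have hne : pt (-r) r ≠ 0 := by
    intro h
    have := congrArg Complex.im h
    simp at this; linarith
  have hnorm : ‖pt (-r) r‖ < δ := by
    refine (Complex.norm_le_abs_re_add_abs_im _).trans_lt ?_
    simp [abs_of_pos hr0]; linarith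
  have hb2 := (abs_im_le_norm _).trans_lt (hP _ hne hnorm)
  rw [hz2] at hb2
  have hlow : 0 < (W.P (pt (-r) r)).im := by
    rw [sub_im, im_ofReal_mul, I_im, mul_one, abs_lt] at hb2
    have : 1 < 1 / (2 * r^2) := by rw [lt_div_iff₀ (by positivity)]; nlinarith
    linarith [hb2.1]
  exact pos_of_ne_gen (F := fun p : ℝ × ℝ => (W.P (pt p.1 p.2)).im)
    (isPreconnected_Ioo.prod isPreconnected_Ioo : IsPreconnected (Ioo (-W.a) 0 ×ˢ Ioo 0 W.b))
    (continuous_im.comp_continuousOn (cont_int hR W.P fun k hk => (W.P_diff k hk).continuousAt))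
    (fun p hp => imP_ne hR hp.1 hp.2) (x0 := (-r, r)) ⟨⟨by simpa using r3, by simpa⟩, ⟨hr0, r4⟩⟩ hlow
    (x := (x, y)) ⟨hx, hy⟩

/-- the quantity controlling the sign of `u_xx` -/
theorem key_ne {x y : ℝ} (hx : x ∈ Ioo (-W.a) 0) (hy : y ∈ Ioo 0 W.b) :
    (conj (W.P (pt x y) - ((-W.h / W.a : ℝ) : ℂ)) * W.dP (pt x y)).im ≠ 0 := by
  refine key_alg (imP_pos hR hx hy) (A_bd hR).1 (A_bd hR).2 (E21 hR) ?_
  rw [W.dP_sq (int_notMem hR hx hy), e1_eq hR, e2_eq hR, e3_eq hR]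

theorem uxx_eq {x y : ℝ} {k : ℂ} (hY : (W.P k).im ≠ 0) (h0 : (W.F1 k).re = 0) :
    (W.w2 * W.dP k).re = -(W.a / (W.P k).im) * (conj (W.P k - ((-W.h / W.a : ℝ) : ℂ)) * W.dP k).im := by
  have ha := (a_pos hR).ne'
  rw [F1_re hR] at h0
  have hb : W.b = (W.h + W.a * (W.P k).re) / (W.P k).im := by field_simp; linarith
  rw [w2_pt hR]
  simp [-ofReal_div, -ofReal_neg]
  rw [hb]
  field_simp
  ring

theorem ux_left {y : ℝ} (hy : y ∈ Ioo 0 W.b) : 0 < (W.F1 (pt (-W.a) y)).re := by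
  rw [F1_re hR, im_left hR ⟨hy.1.le, hy.2.le⟩]
  nlinarith [hE2 hR, (left_bd hR hy).1, a_pos hR]
theorem ux_right {y : ℝ} (hy : y ∈ Ioo 0 W.b) : (W.F1 (pt 0 y)).re < 0 := by
  rw [F1_re hR, im_right hR ⟨hy.1, hy.2.le⟩]
  nlinarith [hE3 hR, (right_lt hR hy), a_pos hR]

theorem hline_notMem {x y : ℝ} (hx : x ∈ Icc (-W.a) W.a) (hy : y ∈ Ioo 0 W.b) : pt x y ∉ W.lattice :=
  pt_notMem hR (by rw [abs_lt]; constructor <;> linarith [hx.1, hx.2, a_pos hR])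
    (by rw [abs_lt]; constructor <;> linarith [hy.1, hy.2]) (Or.inr hy.1.ne')

theorem key_pos {x y : ℝ} (hx : x ∈ Ioo (-W.a) 0) (hy : y ∈ Ioo 0 W.b) :
    0 < (conj (W.P (pt x y) - ((-W.h / W.a : ℝ) : ℂ)) * W.dP (pt x y)).im := by
  have ha := a_pos hR
  have hb := b_pos hR
  have hcont : ContinuousOn (fun p : ℝ × ℝ => (conj (W.P (pt p.1 p.2) - ((-W.h / W.a : ℝ) : ℂ)) * W.dP (pt p.1 p.2)).im)
      (Ioo (-W.a) 0 ×ˢ Ioo 0 W.b) := by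
    refine continuous_im.comp_continuousOn (cont_int hR
      (fun k => conj (W.P k - ((-W.h / W.a : ℝ) : ℂ)) * W.dP k) fun k hk => ?_)
    have h1 := (W.P_diff k hk).continuousAt
    have h2 := (W.dP_analyticAt hk).continuousAt
    exact (continuous_conj.continuousAt.comp (h1.sub continuousAt_const)).mul h2
  by_contra! hneg
  have hneg : 0 < -(conj (W.P (pt x y) - ((-W.h / W.a : ℝ) : ℂ)) * W.dP (pt x y)).im := by
    have := key_ne hR hx hy
    have := lt_of_le_of_ne hneg this
    linarith
  have hall : ∀ x' ∈ Ioo (-W.a) 0, 0 < -(conj (W.P (pt x' y) - ((-W.h / W.a : ℝ) : ℂ)) * W.dP (pt x' y)).im := by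
    intro x' hx'
    exact pos_of_ne_gen (isPreconnected_Ioo.prod isPreconnected_Ioo : IsPreconnected (Ioo (-W.a) 0 ×ˢ Ioo 0 W.b))
      hcont.neg (fun p hp => neg_ne_zero.2 (key_ne hR hp.1 hp.2)) (x0 := (x, y)) ⟨hx, hy⟩ hneg
      (x := (x', y)) ⟨hx', hy⟩
  have hn : ∀ x ∈ Icc (-W.a) 0, pt x y ∉ W.lattice := fun x hx => hline_notMem hR ⟨hx.1, by linarith [hx.2]⟩ hy
  have hr := ux_right hR hy
  have hcx : ContinuousOn (fun x => (W.F1 (pt x y)).re) (Icc (-W.a) 0) := fun x hx =>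
    (F1_dx (hn x hx)).re'.continuousAt.continuousWithinAt
  have hall2 : ∀ x ∈ Ioo (-W.a) 0, 0 < (W.F1 (pt x y)).re := fun x' hx' =>
    pos_propagate (F := fun x => (W.F1 (pt x y)).re) (F' := fun x => (W.w2 * W.dP (pt x y)).re)
      (s := -W.a) (t := 0) hcx
      (fun x hx => (F1_dx (hn x ⟨hx.1.le, hx.2.le⟩)).re') (ux_left hR hy)
      (fun x hx h => by
        have hp := imP_pos hR hx hy
        rw [uxx_eq hR (x := x) (y := y) hp.ne' h]
        have := hall x hx
        have h2 : 0 < W.a / (W.P (pt x y)).im := by positivity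
        nlinarith) hx'
  have h1 : Tendsto (fun x => (W.F1 (pt x y)).re) (𝓝[<] 0) (𝓝 (W.F1 (pt 0 y)).re) :=
    (F1_dx (hn 0 (z_mem_a hR))).re'.continuousAt.tendsto.mono_left nhdsWithin_le_nhds
  have := ge_of_tendsto h1 (by
    filter_upwards [Ioo_mem_nhdsLT (show -W.a < 0 by linarith)] with x hx using (hall2 x hx).le)
  linarith

theorem uxx_neg {x y : ℝ} (hx : x ∈ Ioo (-W.a) 0) (hy : y ∈ Ioo 0 W.b) (h : (W.F1 (pt x y)).re = 0) :
    (W.w2 * W.dP (pt x y)).re < 0 := by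
  have hp := imP_pos hR hx hy
  rw [uxx_eq hR (x := x) (y := y) hp.ne' h]
  have := key_pos hR hx hy
  have h2 : 0 < W.a / (W.P (pt x y)).im := by have := a_pos hR; positivity
  nlinarith

/-- each horizontal section of `u` is unimodal -/
theorem unimodal {y : ℝ} (hy : y ∈ Ioo 0 W.b) : ∃ m ∈ Ioo (-W.a) 0, (W.F1 (pt m y)).re = 0 ∧
    (∀ x ∈ Ico (-W.a) m, 0 < (W.F1 (pt x y)).re) ∧ (∀ x ∈ Ioc m 0, (W.F1 (pt x y)).re < 0) := by
  have ha := a_pos hR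
  have hn : ∀ x ∈ Icc (-W.a) 0, pt x y ∉ W.lattice := fun x hx => hline_notMem hR ⟨hx.1, by linarith [hx.2]⟩ hy
  exact single_zero (F := fun x => (W.F1 (pt x y)).re) (F' := fun x => (W.w2 * W.dP (pt x y)).re)
    (s := -W.a) (t := 0) (by linarith) (fun x hx => (F1_dx (hn x hx)).re'.continuousAt.continuousWithinAt)
    (fun x hx => (F1_dx (hn x ⟨hx.1.le, hx.2.le⟩)).re') (ux_left hR hy) (ux_right hR hy)
    (fun x hx h => uxx_neg hR hx hy h)

theorem P_refl {x y : ℝ} (hk : pt x y ∉ W.lattice) : W.P (pt (-x) y) = conj (W.P (pt x y)) := by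
  rw [← P_conj hR hk, ← W.P_even (z := conj (pt x y)) (by rwa [conj_mem hR]), pt_conj, pt_neg, neg_neg]

theorem dP_refl {x y : ℝ} (hk : pt x y ∉ W.lattice) : W.dP (pt (-x) y) = -conj (W.dP (pt x y)) := by
  have e : pt (-x) y = -conj (pt x y) := by rw [pt_conj, pt_neg, neg_neg]
  have hk' : -conj (pt x y) ∉ W.lattice := by rw [W.neg_mem_iff, conj_mem hR]; exact hk
  have h1 : (fun t => W.P (pt (-t) y)) =ᶠ[𝓝 x] fun t => conj (W.P (pt t y)) := by
    have : ContinuousAt (fun t : ℝ => pt t y) x := (hasDerivAt_pt_x x y).continuousAt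
    filter_upwards [this.eventually_mem (W.isOpen_compl.mem_nhds hk)] with t ht using P_refl hR ht
  have h2 : HasDerivAt (fun t => W.P (pt (-t) y)) (-W.dP (pt (-x) y)) x := by
    have := HasDerivAt.scomp x (P_dx (W := W) (x := -x) (y := y) (by rw [e]; exact hk')) (hasDerivAt_neg x)
    exact this.congr_deriv (by simp)
  have h3 : HasDerivAt (fun t => conj (W.P (pt t y))) (conj (W.dP (pt x y))) x :=
    conjCLE.toContinuousLinearMap.hasFDerivAt.comp_hasDerivAt x (P_dx hk)
  have := h2.unique (h3.congr_of_eventuallyEq h1)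
  rw [← this, neg_neg]

/-- `u < 0` on the right rectangle -/
theorem U_R1_neg {x y : ℝ} (hx : x ∈ Icc 0 W.a) (hy : y ∈ Ioo 0 W.b) : W.U x y < 0 := by
  have ha := a_pos hR
  have hn : ∀ x ∈ Icc 0 W.a, pt x y ∉ W.lattice := fun x hx => hline_notMem hR ⟨by linarith [hx.1], hx.2⟩ hy
  have hcont : ContinuousOn (fun x => W.U x y) (Icc 0 W.a) := fun x hx =>
    (U_dx (hn x hx)).continuousAt.continuousWithinAt
  have hend : W.U W.a y < 0 := by
    have h1 := U_left_neg hR hy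
    have h2 := fF_add1 hR (k := pt (-W.a) y) (hline_notMem hR ⟨le_rfl, by linarith⟩ hy)
    have e : pt (-W.a) y + 2 * W.w1 = pt W.a y := by rw [w1_pt hR]; simp [pt]; ring
    rw [e] at h2
    have := congrArg Complex.re h2
    simp at this
    rw [U, this]; exact h1
  obtain ⟨m, hm, hmax⟩ := isCompact_Icc.exists_isMaxOn ⟨x, hx⟩ hcont
  by_contra! hneg
  have hm0 : 0 ≤ W.U m y := hneg.trans (hmax hx)
  have hm' : m ∈ Ioo 0 W.a := by
    refine ⟨lt_of_le_of_ne hm.1 ?_, lt_of_le_of_ne hm.2 ?_⟩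
    · rintro rfl; linarith [U_right_neg hR hy]
    · rintro rfl; linarith
  have hd0 : (W.F1 (pt m y)).re = 0 :=
    (hmax.isLocalMax (Icc_mem_nhds hm'.1 hm'.2)).hasDerivAt_eq_zero (U_dx (hn m hm))
  -- second derivative
  have hmm : -m ∈ Ioo (-W.a) 0 := ⟨by linarith [hm'.2], by linarith [hm'.1]⟩
  have hk' := int_notMem hR hmm hy
  have hP := P_refl hR hk'
  have hdP := dP_refl hR hk'
  rw [neg_neg] at hP hdP
  have hIm := imP_pos hR hmm hy
  have hkey := key_pos hR hmm hy
  have hImm : (W.P (pt m y)).im < 0 := by rw [hP]; simpa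
  have hpos : 0 < (W.w2 * W.dP (pt m y)).re := by
    rw [uxx_eq hR (x := m) (y := y) hImm.ne hd0]
    have e : (conj (W.P (pt m y) - ((-W.h / W.a : ℝ) : ℂ)) * W.dP (pt m y))
      = -conj (conj (W.P (pt (-m) y) - ((-W.h / W.a : ℝ) : ℂ)) * W.dP (pt (-m) y)) := by
      rw [hP, hdP]; simp
    rw [e, neg_im, conj_im, neg_neg]
    have : W.a / (W.P (pt m y)).im < 0 := div_neg_of_pos_of_neg ha hImm
    nlinarith
  have hev := (hasDerivAt_iff_tendsto_slope.1 (F1_dx (hn m hm)).re').eventually (lt_mem_nhds hpos)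
  have hevl := hev.filter_mono (nhdsWithin_mono m (show Ioi m ⊆ {m}ᶜ from fun y hy => ne_of_gt hy))
  obtain ⟨c, hc, hsub⟩ := (mem_nhdsGT_iff_exists_Ioo_subset).1 (hevl.and (Ioo_mem_nhdsGT hm'.2))
  have hc0 : m < c := hc
  obtain ⟨d, hd1, hd2⟩ := exists_between hc0
  have hda := (hsub ⟨hd1, hd2⟩).2
  obtain ⟨q, hq, eq⟩ := exists_hasDerivAt_eq_slope (fun x => W.U x y) (fun x => (W.F1 (pt x y)).re) hd1
    (hcont.mono (Icc_subset_Icc hm.1 hda.2.le)) (fun z hz => U_dx (hn z ⟨by linarith [hz.1, hm'.1], by linarith [hz.2, hda.2]⟩))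
  have h1 := (hsub ⟨hq.1, hq.2.trans hd2⟩).1
  rw [slope_def_field, hd0, sub_zero] at h1
  have h2 : 0 < (W.F1 (pt q y)).re := by
    by_contra! hc
    have := div_nonpos_of_nonpos_of_nonneg hc (by linarith [hq.1] : 0 ≤ q - m)
    linarith
  rw [eq] at h2
  have h3 := hmax (show d ∈ Icc 0 W.a from ⟨by linarith [hm'.1], hda.2.le⟩)
  have h4 : (W.U d y - W.U m y) / (d - m) ≤ 0 :=
    div_nonpos_of_nonpos_of_nonneg (by simp at h3; linarith) (by linarith)
  linarith

end rect
end WeierstrassData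

end part9

section part10
open scoped Topology ComplexConjugate

namespace WeierstrassData
variable (W : WeierstrassData)

/-- equivalence modulo the lattice and sign, tracking the exponent -/
def Eqv (k k' : ℂ) : Prop := k' ∉ W.lattice ∧ W.P k' = W.P k ∧
  ∃ s p : ℤ, W.fF k' = s * W.fF k + p * (Real.pi * I)

theorem Eqv.refl {k : ℂ} (hk : k ∉ W.lattice) : W.Eqv k k := ⟨hk, rfl, 1, 0, by simp⟩
variable {W} in
theorem Eqv.trans {k k' k'' : ℂ} (h : W.Eqv k k') (h' : W.Eqv k' k'') : W.Eqv k k'' := by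
  obtain ⟨_, e, s, p, q⟩ := h
  obtain ⟨m, e', s', p', q'⟩ := h'
  refine ⟨m, e'.trans e, s' * s, s' * p + p', ?_⟩
  rw [q', q]; push_cast; ring
theorem Eqv.neg {k : ℂ} (hk : k ∉ W.lattice) : W.Eqv k (-k) :=
  ⟨by rwa [W.neg_mem_iff], W.P_even hk, -1, 0, by simp [W.fF_odd]⟩
variable {W} in
theorem Eqv.re_zero {k k' : ℂ} (h : W.Eqv k k') (h0 : (W.fF k).re = 0) : (W.fF k').re = 0 := by
  obtain ⟨_, _, s, p, q⟩ := h
  rw [q]; simp [h0]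
variable {W} in
theorem Eqv.im_half {k k' : ℂ} (h : W.Eqv k k') (h0 : ∃ p : ℤ, (W.fF k).im = p * Real.pi / 2) :
    ∃ p : ℤ, (W.fF k').im = p * Real.pi / 2 := by
  obtain ⟨_, _, s, p, q⟩ := h
  obtain ⟨r, hr⟩ := h0
  refine ⟨s * r + 2 * p, ?_⟩
  rw [q]; simp [hr]; ring

section rect
variable {W} (hR : W.Rect)
include hR

theorem Eqv.add1 {k : ℂ} (hk : k ∉ W.lattice) : W.Eqv k (k + 2 * W.w1) :=
  ⟨by rwa [W.add_mem_iff W.two_w1_mem], W.P_periodic _ W.two_w1_mem k, 1, -1, by rw [fF_add1 hR hk]; push_cast; ring⟩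
theorem Eqv.add3 {k : ℂ} (hk : k ∉ W.lattice) : W.Eqv k (k + 2 * W.w3) :=
  ⟨by rwa [W.add_mem_iff W.two_w3_mem], W.P_periodic _ W.two_w3_mem k, 1, 1, by rw [fF_add3 hR hk]; push_cast; ring⟩

theorem Eqv.symm1 {k k' : ℂ} (hk : k ∉ W.lattice) (hs : W.Eqv (-k) (-k')) : W.Eqv k k' := by
  have := (Eqv.neg W hk).trans (hs.trans (Eqv.neg W hs.1))
  rwa [neg_neg] at this

theorem Eqv.shift1 {k : ℂ} (hk : k ∉ W.lattice) (m : ℤ) : W.Eqv k (k + m * (2 * W.w1)) := by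
  induction m using Int.induction_on with
  | zero => simpa using Eqv.refl W hk
  | succ i ih =>
    have := ih.trans (Eqv.add1 hR ih.1)
    rwa [show k + ((i:ℤ):ℂ) * (2 * W.w1) + 2 * W.w1 = k + (((i:ℤ) + 1 : ℤ):ℂ) * (2 * W.w1) by push_cast; ring] at this
  | pred i ih =>
    have h2 := Eqv.add1 hR (Eqv.neg W ih.1).1
    have := ih.trans (Eqv.symm1 hR (k' := k + ((-(i:ℤ) - 1 : ℤ) : ℂ) * (2 * W.w1)) ih.1 (by
      refine (congrArg (W.Eqv _) ?_).mp h2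
      push_cast; ring))
    exact this
theorem Eqv.shift3 {k : ℂ} (hk : k ∉ W.lattice) (m : ℤ) : W.Eqv k (k + m * (2 * W.w3)) := by
  induction m using Int.induction_on with
  | zero => simpa using Eqv.refl W hk
  | succ i ih =>
    have := ih.trans (Eqv.add3 hR ih.1)
    rwa [show k + ((i:ℤ):ℂ) * (2 * W.w3) + 2 * W.w3 = k + (((i:ℤ) + 1 : ℤ):ℂ) * (2 * W.w3) by push_cast; ring] at this
  | pred i ih =>
    have h2 := Eqv.add3 hR (Eqv.neg W ih.1).1
    have := ih.trans (Eqv.symm1 hR (k' := k + ((-(i:ℤ) - 1 : ℤ) : ℂ) * (2 * W.w3)) ih.1 (by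
      refine (congrArg (W.Eqv _) ?_).mp h2
      push_cast; ring))
    exact this

theorem reduce_cell {k : ℂ} (hk : k ∉ W.lattice) :
    ∃ x y : ℝ, W.Eqv k (pt x y) ∧ x ∈ Icc (-W.a) W.a ∧ y ∈ Icc 0 W.b := by
  have ha := a_pos hR
  have hb := b_pos hR
  -- into the symmetric cell
  obtain ⟨x, y, hE, hx, hy⟩ : ∃ x y : ℝ, W.Eqv k (pt x y) ∧ x ∈ Icc (-W.a) W.a ∧ y ∈ Icc (-W.b) W.b := by
    set m := round (k.re / (2 * W.a))
    set n := round (k.im / (2 * W.b))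
    have h1 := Eqv.shift1 hR hk (-m)
    have h2 := h1.trans (Eqv.shift3 hR h1.1 (-n))
    rw [eq_pt (k + ((-m : ℤ) : ℂ) * (2 * W.w1) + ((-n : ℤ) : ℂ) * (2 * W.w3))] at h2
    refine ⟨_, _, h2, ?_, ?_⟩
    · have := abs_sub_round (k.re / (2 * W.a))
      rw [abs_le] at this
      have e : k.re = k.re / (2 * W.a) * (2 * W.a) := by field_simp
      rw [w1_pt hR, w3_pt hR]
      simp
      constructor <;> nlinarith [this.1, this.2]
    · have := abs_sub_round (k.im / (2 * W.b))
      rw [abs_le] at this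
      have e : k.im = k.im / (2 * W.b) * (2 * W.b) := by field_simp
      rw [w1_pt hR, w3_pt hR]
      simp
      constructor <;> nlinarith [this.1, this.2]
  -- upper half
  obtain ⟨x, y, hE, hx, hy⟩ : ∃ x y : ℝ, W.Eqv k (pt x y) ∧ x ∈ Icc (-W.a) W.a ∧ y ∈ Icc 0 W.b := by
    rcases le_total 0 y with h | h
    · exact ⟨x, y, hE, hx, h, hy.2⟩
    · have := hE.trans (Eqv.neg W hE.1)
      rw [pt_neg] at this
      exact ⟨-x, -y, this, ⟨by linarith [hx.2], by linarith [hx.1]⟩, by linarith, by linarith [hy.1]⟩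
  exact ⟨x, y, hE, hx, hy⟩

/-- reduction of arbitrary zeros of `u` to the left rectangle -/
theorem reduce {k : ℂ} (hk : k ∉ W.lattice) (hu : (W.fF k).re = 0) :
    ∃ x y : ℝ, W.Eqv k (pt x y) ∧ ((x ∈ Ioo (-W.a) 0 ∧ y ∈ Ioo 0 W.b) ∨ (x = -W.a ∧ y = 0) ∨
      (x = -W.a ∧ y = W.b) ∨ (x = 0 ∧ y = W.b)) := by
  have ha := a_pos hR
  have hb := b_pos hR
  obtain ⟨x, y, hE, hx, hy⟩ := reduce_cell hR hk
  have hU := hE.re_zero hu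
  rcases eq_or_lt_of_le hy.1 with h0 | h0
  · -- bottom
    obtain ⟨x, hE, hx⟩ : ∃ x : ℝ, W.Eqv k (pt x 0) ∧ x ∈ Icc (-W.a) 0 := by
      rw [← h0] at hE
      rcases le_total x 0 with h | h
      · exact ⟨x, hE, hx.1, h⟩
      · have := hE.trans (Eqv.neg W hE.1)
        rw [pt_neg, neg_zero] at this
        exact ⟨-x, this, by linarith [hx.2], by linarith⟩
    have hU := hE.re_zero hu
    have hx0 : x ≠ 0 := by
      rintro rfl
      apply hE.1
      have : pt 0 0 = 0 := by simp [pt]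
      rw [this]; exact W.zero_mem
    have hx1 : x < 0 := lt_of_le_of_ne hx.2 hx0
    rcases eq_or_lt_of_le hx.1 with h1 | h1
    · exact ⟨x, 0, hE, Or.inr (Or.inl ⟨h1.symm, rfl⟩)⟩
    · exact absurd hU (U_bottom_pos hR ⟨h1, hx1⟩).ne'
  rcases eq_or_lt_of_le hy.2 with h1 | h1
  · -- top
    obtain ⟨x, hE, hx⟩ : ∃ x : ℝ, W.Eqv k (pt x W.b) ∧ x ∈ Icc (-W.a) 0 := by
      rw [h1] at hE
      rcases le_total x 0 with h | h
      · exact ⟨x, hE, hx.1, h⟩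
      · have h2 := hE.trans (Eqv.neg W hE.1)
        have h3 := h2.trans (Eqv.add3 hR h2.1)
        refine ⟨-x, ?_, by linarith [hx.2], by linarith⟩
        rwa [show -pt x W.b + 2 * W.w3 = pt (-x) W.b by rw [w3_pt hR]; simp [pt]; ring] at h3
    have hU := hE.re_zero hu
    rcases eq_or_lt_of_le hx.1 with h1 | h1
    · exact ⟨x, W.b, hE, Or.inr (Or.inr (Or.inl ⟨h1.symm, rfl⟩))⟩
    rcases eq_or_lt_of_le hx.2 with h2 | h2
    · exact ⟨x, W.b, hE, Or.inr (Or.inr (Or.inr ⟨h2, rfl⟩))⟩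
    exact absurd hU (U_top_pos hR ⟨h1, h2⟩).ne'
  rcases le_or_gt 0 x with h2 | h2
  · exact absurd hU (U_R1_neg hR ⟨h2, hx.2⟩ ⟨h0, h1⟩).ne
  rcases eq_or_lt_of_le hx.1 with h3 | h3
  · rw [← h3] at hU
    exact absurd hU (U_left_neg hR ⟨h0, h1⟩).ne
  exact ⟨x, y, hE, Or.inl ⟨⟨h3, h2⟩, h0, h1⟩⟩

end rect
end WeierstrassData

end part10

section part11
open scoped Topology ComplexConjugate ContDiff

theorem ift (F : ℝ × ℝ → ℝ) {y0 x0 d : ℝ} (hF : AnalyticAt ℝ F (y0, x0))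
    (hd : HasDerivAt (fun x => F (y0, x)) d x0) (hd0 : d ≠ 0) :
    ∃ ξ : ℝ → ℝ, AnalyticAt ℝ ξ y0 ∧ ξ y0 = x0 ∧ (∀ᶠ y in 𝓝 y0, F (y, ξ y) = F (y0, x0)) ∧
      ∀ᶠ v in 𝓝 (y0, x0), F v = F (y0, x0) → ξ v.1 = v.2 := by
  have cdf : ContDiffAt ℝ ω F (y0, x0) := hF.contDiffAt
  have hfd := hF.differentiableAt.hasFDerivAt
  have hval : (fderiv ℝ F (y0, x0)) (0, 1) = d := by
    have h1 : HasDerivAt (fun x : ℝ => ((y0, x) : ℝ × ℝ)) (0, 1) x0 :=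
      (hasDerivAt_const x0 y0).prodMk (hasDerivAt_id x0)
    exact (hfd.comp_hasDerivAt x0 h1).unique hd
  have if2 : (fderiv ℝ F (y0, x0) ∘L .inr ℝ ℝ ℝ).IsInvertible := by
    refine ⟨ContinuousLinearEquiv.unitsEquivAut ℝ (Units.mk0 d hd0), ?_⟩
    ext
    simp [hval]
  have hω : (ω : ℕ∞ω) ≠ 0 := by simp
  refine ⟨cdf.implicitFunction hω if2, (cdf.contDiffAt_implicitFunction hω if2).analyticAt,
    cdf.implicitFunction_apply_self hω if2, cdf.eventually_apply_implicitFunction hω if2, ?_⟩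
  filter_upwards [cdf.eventually_apply_eq_iff_implicitFunction hω if2] with v hv h using hv.1 h

theorem analyticAt_re_pt {G : ℂ → ℂ} {y x : ℝ} (hG : AnalyticAt ℂ G (pt x y)) :
    AnalyticAt ℝ (fun p : ℝ × ℝ => (G (pt p.2 p.1)).re) (y, x) := by
  have h1 : AnalyticAt ℝ G (pt x y) := hG.restrictScalars
  have h2 : AnalyticAt ℝ (fun p : ℝ × ℝ => pt p.2 p.1) (y, x) := by
    have e1 : AnalyticAt ℝ (fun p : ℝ × ℝ => (p.2 : ℂ)) (y, x) :=
      (ofRealCLM.analyticAt _).comp analyticAt_snd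
    have e2 : AnalyticAt ℝ (fun p : ℝ × ℝ => (p.1 : ℂ)) (y, x) :=
      (ofRealCLM.analyticAt _).comp analyticAt_fst
    exact e1.add (e2.mul analyticAt_const)
  exact (reCLM.analyticAt _).comp (h1.comp_of_eq h2 rfl)

/-- implicit function for the real part of a holomorphic function -/
theorem ift_re {G G' : ℂ → ℂ} {x0 y0 : ℝ} (hG : AnalyticAt ℂ G (pt x0 y0))
    (hd : HasDerivAt G (G' (pt x0 y0)) (pt x0 y0)) (hd0 : (G' (pt x0 y0)).re ≠ 0) :
    ∃ ξ : ℝ → ℝ, AnalyticAt ℝ ξ y0 ∧ ξ y0 = x0 ∧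
      HasDerivAt ξ ((G' (pt x0 y0)).im / (G' (pt x0 y0)).re) y0 ∧
      (∀ᶠ y in 𝓝 y0, (G (pt (ξ y) y)).re = (G (pt x0 y0)).re) ∧
      ∀ᶠ v in 𝓝 (y0, x0), (G (pt v.2 v.1)).re = (G (pt x0 y0)).re → ξ v.1 = v.2 := by
  have hdx : HasDerivAt (fun x => (G (pt x y0)).re) (G' (pt x0 y0)).re x0 :=
    (((hd.comp_of_eq x0 (hasDerivAt_pt_x x0 y0) rfl).congr_deriv (by simp) :
      HasDerivAt (fun x => G (pt x y0)) (G' (pt x0 y0)) x0)).re'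
  obtain ⟨ξ, h1, h2, h3, h4⟩ := ift _ (analyticAt_re_pt hG) hdx hd0
  refine ⟨ξ, h1, h2, ?_, h3, h4⟩
  have hξ := h1.differentiableAt.hasDerivAt
  set c := deriv ξ y0
  have hp : HasDerivAt (fun y => pt (ξ y) y) (c + I) y0 := by
    have := (hξ.ofReal_comp).add (((hasDerivAt_id (y0:ℂ)).comp_ofReal).mul_const I)
    exact this.congr_deriv (by simp)
  have hc : HasDerivAt (fun y => (G (pt (ξ y) y)).re) (G' (pt x0 y0) * (c + I)).re y0 := by
    have hd' : HasDerivAt G (G' (pt x0 y0)) (pt (ξ y0) y0) := by rw [h2]; exact hd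
    exact HasDerivAt.re' (f := fun y => G (pt (ξ y) y)) (hd'.comp_of_eq y0 hp rfl)
  have h0 : HasDerivAt (fun y => (G (pt (ξ y) y)).re) 0 y0 := by
    exact (hasDerivAt_const y0 (G (pt x0 y0)).re).congr_of_eventuallyEq h3
  have := hc.unique h0
  simp at this
  refine hξ.congr_deriv ?_
  rw [eq_div_iff hd0]; linarith

namespace WeierstrassData
variable (W : WeierstrassData)

theorem fF_analyticAt {k : ℂ} (hk : k ∉ W.lattice) : AnalyticAt ℂ W.fF k := by
  unfold fF
  exact (analyticAt_const.mul analyticAt_id).sub (analyticAt_const.mul (W.Z_analyticAt hk))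
theorem F1_analyticAt {k : ℂ} (hk : k ∉ W.lattice) : AnalyticAt ℂ W.F1 k := by
  unfold F1
  exact analyticAt_const.add (analyticAt_const.mul (W.P_analyticAt hk))

/-- the location of the maximum on the horizontal at height `y` -/
def mx (y : ℝ) : ℝ := by
  classical exact if h : ∃ m ∈ Ioo (-W.a) 0, (W.F1 (pt m y)).re = 0 then h.choose else 0

section rect
variable {W} (hR : W.Rect)
include hR

theorem mx_mem {y : ℝ} (hy : y ∈ Ioo 0 W.b) : W.mx y ∈ Ioo (-W.a) 0 ∧ (W.F1 (pt (W.mx y) y)).re = 0 := by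
  obtain ⟨m, hm, h, _⟩ := unimodal hR hy
  have : ∃ m ∈ Ioo (-W.a) 0, (W.F1 (pt m y)).re = 0 := ⟨m, hm, h⟩
  rw [mx, dif_pos this]
  exact this.choose_spec

theorem mx_unique {x y : ℝ} (hx : x ∈ Icc (-W.a) 0) (hy : y ∈ Ioo 0 W.b) (h : (W.F1 (pt x y)).re = 0) :
    x = W.mx y := by
  obtain ⟨m, hm, h0, h1, h2⟩ := unimodal hR hy
  have key : ∀ x ∈ Icc (-W.a) 0, (W.F1 (pt x y)).re = 0 → x = m := by
    intro x hx h
    rcases lt_trichotomy x m with c | c | c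
    · have := h1 x ⟨hx.1, c⟩; linarith
    · exact c
    · have := h2 x ⟨c, hx.2⟩; linarith
  obtain ⟨e1, e2⟩ := mx_mem hR hy
  rw [key x hx h, key _ ⟨e1.1.le, e1.2.le⟩ e2]

theorem ux_pos {x y : ℝ} (hy : y ∈ Ioo 0 W.b) (hx : x ∈ Ico (-W.a) (W.mx y)) : 0 < (W.F1 (pt x y)).re := by
  obtain ⟨m, hm, h0, h1, h2⟩ := unimodal hR hy
  have := mx_unique hR ⟨hm.1.le, hm.2.le⟩ hy h0
  rw [← this] at hx
  exact h1 x hx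
theorem ux_neg {x y : ℝ} (hy : y ∈ Ioo 0 W.b) (hx : x ∈ Ioc (W.mx y) 0) : (W.F1 (pt x y)).re < 0 := by
  obtain ⟨m, hm, h0, h1, h2⟩ := unimodal hR hy
  have := mx_unique hR ⟨hm.1.le, hm.2.le⟩ hy h0
  rw [← this] at hx
  exact h2 x hx

theorem mx_hasDerivAt {y : ℝ} (hy : y ∈ Ioo 0 W.b) :
    HasDerivAt W.mx ((W.w2 * W.dP (pt (W.mx y) y)).im / (W.w2 * W.dP (pt (W.mx y) y)).re) y := by
  obtain ⟨e1, e2⟩ := mx_mem hR hy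
  have hk := int_notMem hR e1 hy
  obtain ⟨ξ, h1, h2, h3, h4, h5⟩ := ift_re (G' := fun k => W.w2 * W.dP k) (W.F1_analyticAt hk)
    (W.F1_hasDerivAt hk) (uxx_neg hR e1 hy e2).ne
  refine h3.congr_of_eventuallyEq ?_
  have c1 : ∀ᶠ t in 𝓝 y, ξ t ∈ Ioo (-W.a) 0 :=
    h1.continuousAt.eventually_mem (by rw [h2]; exact isOpen_Ioo.mem_nhds e1)
  filter_upwards [c1, isOpen_Ioo.mem_nhds hy, h4] with t t1 t2 t3
  exact (mx_unique hR ⟨t1.1.le, t1.2.le⟩ t2 (by rw [t3, e2])).symm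

/-- the critical point -/
theorem exists_crit : ∃ x ∈ Ioo (-W.a) 0, ∃ y ∈ Ioo 0 W.b, W.F1 (pt x y) = 0 := by
  have ha := a_pos hR
  have hb := b_pos hR
  have hw : W.w2 ≠ 0 := by
    intro h
    rw [w2_pt hR] at h
    have := congrArg Complex.re h
    simp at this; linarith
  obtain ⟨k, hk, hP⟩ := W.P_surj (-W.Z W.w2 / W.w2)
  have hF : ∀ k, W.P k = -W.Z W.w2 / W.w2 → W.F1 k = 0 := by
    intro k h
    rw [F1, h]; field_simp; ring
  obtain ⟨x, y, hE, hx, hy⟩ := reduce_cell hR hk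
  have h0 := hF _ (hE.2.1.trans hP)
  have him : 0 < (W.P (pt x y)).im := by
    have h1 : (W.F1 (pt x y)).re = 0 := by rw [h0]; simp
    have h2 : (W.F1 (pt x y)).im = 0 := by rw [h0]; simp
    rw [F1_re hR] at h1
    rw [F1_im hR] at h2
    have h3 := leg hR
    have h4 : (W.a ^ 2 + W.b ^ 2) * (W.P (pt x y)).im = Real.pi / 2 := by
      rw [← h3]; linear_combination W.a * h2 - W.b * h1
    by_contra! hc
    nlinarith [Real.pi_pos, sq_nonneg W.a, sq_nonneg W.b]
  rcases le_or_gt x 0 with hx0 | hx0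
  · rcases eq_or_lt_of_le hx.1 with c | c
    · rw [← c, im_left hR hy] at him; exact absurd him (lt_irrefl _)
    rcases eq_or_lt_of_le hy.2 with d | d
    · rw [d, im_top hR ⟨hx.1, hx0⟩] at him; exact absurd him (lt_irrefl _)
    rcases eq_or_lt_of_le hx0 with e | e
    · rcases eq_or_lt_of_le hy.1 with f | f
      · exfalso; apply hE.1
        have : pt x y = 0 := by rw [e, ← f]; simp [pt]
        rw [this]; exact W.zero_mem
      · rw [e, im_right hR ⟨f, hy.2⟩] at him; exact absurd him (lt_irrefl _)
    rcases eq_or_lt_of_le hy.1 with f | f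
    · rw [← f, im_bottom hR ⟨hx.1, e⟩] at him; exact absurd him (lt_irrefl _)
    exact ⟨x, ⟨c, e⟩, y, ⟨f, d⟩, h0⟩
  · exfalso
    have hn : pt (-x) y ∉ W.lattice := pt_notMem' hR ⟨by linarith [hx.2], by linarith⟩ hy (Or.inl (by linarith))
    have hc := P_refl hR hn
    rw [neg_neg] at hc
    rw [hc, conj_im] at him
    rcases eq_or_lt_of_le hx.2 with c | c
    · rw [c, im_left hR hy] at him; simp at him
    rcases eq_or_lt_of_le hy.2 with d | d
    · rw [d, im_top hR ⟨by linarith, by linarith⟩] at him; simp at him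
    rcases eq_or_lt_of_le hy.1 with f | f
    · rw [← f, im_bottom hR ⟨by linarith, by linarith⟩] at him; simp at him
    have := imP_pos hR (x := -x) ⟨by linarith, by linarith⟩ ⟨f, d⟩
    linarith

end rect
end WeierstrassData

end part11

section part12
open scoped Topology ComplexConjugate ContDiff

theorem hasDerivAt_curve {ξ : ℝ → ℝ} {c y : ℝ} (h : HasDerivAt ξ c y) :
    HasDerivAt (fun y => pt (ξ y) y) (c + I) y := by
  have := (h.ofReal_comp).add (((hasDerivAt_id (y:ℂ)).comp_ofReal).mul_const I)
  exact this.congr_deriv (by simp)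

namespace WeierstrassData
variable (W : WeierstrassData)

theorem curve_deriv {G : ℂ → ℂ} {g' : ℂ} {ξ : ℝ → ℝ} {c y : ℝ} (h : HasDerivAt ξ c y)
    (hG : HasDerivAt G g' (pt (ξ y) y)) : HasDerivAt (fun y => G (pt (ξ y) y)) (g' * (c + I)) y :=
  hG.comp_of_eq y (hasDerivAt_curve h) rfl

/-- zeros with prescribed sign of `u_x` -/
def ZZ (ε y x : ℝ) : Prop := x ∈ Ioo (-W.a) 0 ∧ W.U x y = 0 ∧ 0 < ε * (W.F1 (pt x y)).re

/-- the branch of zeros with prescribed sign of `u_x` -/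
def br (ε y : ℝ) : ℝ := by
  classical exact if h : ∃ x, W.ZZ ε y x then h.choose else 0

/-- the maximal value on a horizontal section -/
def MM (y : ℝ) : ℝ := W.U (W.mx y) y

section rect
variable {W} (hR : W.Rect)
include hR

theorem MM_hasDerivAt {y : ℝ} (hy : y ∈ Ioo 0 W.b) :
    HasDerivAt W.MM (-(W.F1 (pt (W.mx y) y)).im) y := by
  obtain ⟨e1, e2⟩ := mx_mem hR hy
  have hk := int_notMem hR e1 hy
  have := (curve_deriv (mx_hasDerivAt hR hy) (W.fF_hasDerivAt hk)).re'
  refine this.congr_deriv ?_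
  simp [-ofReal_div, e2]

theorem NN_hasDerivAt {y : ℝ} (hy : y ∈ Ioo 0 W.b) : ∃ d > 0,
    HasDerivAt (fun y => -(W.F1 (pt (W.mx y) y)).im) d y := by
  obtain ⟨e1, e2⟩ := mx_mem hR hy
  have hk := int_notMem hR e1 hy
  have hn := uxx_neg hR e1 hy e2
  have := (curve_deriv (mx_hasDerivAt hR hy) (W.F1_hasDerivAt hk)).im'.neg
  refine ⟨_, ?_, this⟩
  set p := W.w2 * W.dP (pt (W.mx y) y)
  have e : -(p * (((p.im / p.re : ℝ) : ℂ) + I)).im = -(p.re + p.im * (p.im / p.re)) := by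
    simp [-ofReal_div]
  rw [e]
  have : p.im * (p.im / p.re) ≤ 0 := by
    rw [← mul_div_assoc]; exact div_nonpos_of_nonneg_of_nonpos (mul_self_nonneg _) hn.le
  linarith

theorem NN_strictMono : StrictMonoOn (fun y => -(W.F1 (pt (W.mx y) y)).im) (Ioo 0 W.b) := by
  apply strictMonoOn_of_deriv_pos (convex_Ioo _ _)
  · intro y hy
    obtain ⟨d, _, h⟩ := NN_hasDerivAt hR hy
    exact h.continuousAt.continuousWithinAt
  · intro y hy
    rw [interior_Ioo] at hy
    obtain ⟨d, h0, h⟩ := NN_hasDerivAt hR hy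
    rw [h.deriv]; exact h0

theorem MM_gt {xc yc y : ℝ} (hxc : xc ∈ Ioo (-W.a) 0) (hyc : yc ∈ Ioo 0 W.b) (hc : W.F1 (pt xc yc) = 0)
    (hy : y ∈ Ioo 0 W.b) (hne : y ≠ yc) : W.U xc yc < W.MM y := by
  have hm : xc = W.mx yc := mx_unique hR ⟨hxc.1.le, hxc.2.le⟩ hyc (by rw [hc]; simp)
  have h0 : -(W.F1 (pt (W.mx yc) yc)).im = 0 := by rw [← hm, hc]; simp
  have hU : W.U xc yc = W.MM yc := by rw [MM, ← hm]
  rw [hU]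
  rcases lt_or_gt_of_ne hne with h | h
  · obtain ⟨q, hq, e⟩ := exists_hasDerivAt_eq_slope W.MM (fun y => -(W.F1 (pt (W.mx y) y)).im) h
      (fun z hz => (MM_hasDerivAt hR ⟨hy.1.trans_le hz.1, hz.2.trans_lt hyc.2⟩).continuousAt.continuousWithinAt)
      (fun z hz => (MM_hasDerivAt hR ⟨hy.1.trans hz.1, hz.2.trans hyc.2⟩))
    have := NN_strictMono hR ⟨hy.1.trans hq.1, hq.2.trans hyc.2⟩ hyc hq.2
    simp only [h0, e] at this
    by_contra! hc
    have := div_nonneg (by linarith : 0 ≤ W.MM yc - W.MM y) (by linarith : 0 ≤ yc - y)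
    linarith
  · obtain ⟨q, hq, e⟩ := exists_hasDerivAt_eq_slope W.MM (fun y => -(W.F1 (pt (W.mx y) y)).im) h
      (fun z hz => (MM_hasDerivAt hR ⟨hyc.1.trans_le hz.1, hz.2.trans_lt hy.2⟩).continuousAt.continuousWithinAt)
      (fun z hz => (MM_hasDerivAt hR ⟨hyc.1.trans hz.1, hz.2.trans hy.2⟩))
    have := NN_strictMono hR hyc ⟨hyc.1.trans hq.1, hq.2.trans hy.2⟩ hq.1
    simp only [h0, e] at this
    by_contra! hc
    have := div_nonpos_of_nonpos_of_nonneg (by linarith : W.MM y - W.MM yc ≤ 0) (by linarith : 0 ≤ y - yc)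
    linarith

theorem U_mono_left {y : ℝ} (hy : y ∈ Ioo 0 W.b) : StrictMonoOn (fun x => W.U x y) (Icc (-W.a) (W.mx y)) := by
  have hm := (mx_mem hR hy).1
  have ha := a_pos hR
  apply strictMonoOn_of_deriv_pos (convex_Icc _ _)
  · exact fun x hx => (U_dx (hline_notMem hR ⟨hx.1, by linarith [hx.2, hm.2]⟩ hy)).continuousAt.continuousWithinAt
  · intro x hx
    rw [interior_Icc] at hx
    rw [(U_dx (hline_notMem hR ⟨hx.1.le, by linarith [hx.2, hm.2]⟩ hy)).deriv]
    exact ux_pos hR hy ⟨hx.1.le, hx.2⟩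
theorem U_anti_right {y : ℝ} (hy : y ∈ Ioo 0 W.b) : StrictAntiOn (fun x => W.U x y) (Icc (W.mx y) 0) := by
  have hm := (mx_mem hR hy).1
  have ha := a_pos hR
  apply strictAntiOn_of_deriv_neg (convex_Icc _ _)
  · exact fun x hx => (U_dx (hline_notMem hR ⟨by linarith [hx.1, hm.1], by linarith [hx.2]⟩ hy)).continuousAt.continuousWithinAt
  · intro x hx
    rw [interior_Icc] at hx
    rw [(U_dx (hline_notMem hR ⟨by linarith [hx.1, hm.1], by linarith [hx.2]⟩ hy)).deriv]
    exact ux_neg hR hy ⟨hx.1, hx.2.le⟩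

theorem lt_mx_of {x y : ℝ} (hx : x ∈ Ioo (-W.a) 0) (hy : y ∈ Ioo 0 W.b) (h : 0 < (W.F1 (pt x y)).re) : x < W.mx y := by
  by_contra! hc
  rcases eq_or_lt_of_le hc with c | c
  · rw [← c, (mx_mem hR hy).2] at h; exact lt_irrefl _ h
  · linarith [ux_neg hR hy ⟨c, hx.2.le⟩]
theorem gt_mx_of {x y : ℝ} (hx : x ∈ Ioo (-W.a) 0) (hy : y ∈ Ioo 0 W.b) (h : (W.F1 (pt x y)).re < 0) : W.mx y < x := by
  by_contra! hc
  rcases eq_or_lt_of_le hc with c | c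
  · rw [c, (mx_mem hR hy).2] at h; exact lt_irrefl _ h
  · linarith [ux_pos hR hy ⟨hx.1.le, c⟩]

theorem ZZ_unique {ε x x' y : ℝ} (hy : y ∈ Ioo 0 W.b) (h : W.ZZ ε y x) (h' : W.ZZ ε y x') : x = x' := by
  obtain ⟨h1, h2, h3⟩ := h
  obtain ⟨h1', h2', h3'⟩ := h'
  rcases lt_trichotomy ε 0 with e | e | e
  · have a1 := gt_mx_of hR h1 hy (by by_contra! hc; nlinarith)
    have a2 := gt_mx_of hR h1' hy (by by_contra! hc; nlinarith)
    exact (U_anti_right hR hy).injOn ⟨a1.le, h1.2.le⟩ ⟨a2.le, h1'.2.le⟩ (h2.trans h2'.symm)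
  · rw [e] at h3; simp at h3
  · have a1 := lt_mx_of hR h1 hy (by by_contra! hc; nlinarith)
    have a2 := lt_mx_of hR h1' hy (by by_contra! hc; nlinarith)
    exact (U_mono_left hR hy).injOn ⟨h1.1.le, a1.le⟩ ⟨h1'.1.le, a2.le⟩ (h2.trans h2'.symm)

theorem br_eq {ε x y : ℝ} (hy : y ∈ Ioo 0 W.b) (h : W.ZZ ε y x) : W.br ε y = x := by
  have : ∃ x, W.ZZ ε y x := ⟨x, h⟩
  rw [br, dif_pos this]
  exact ZZ_unique hR hy this.choose_spec h

theorem br_pos {y : ℝ} (hy : y ∈ Ioo 0 W.b) (hM : 0 < W.MM y) : W.ZZ 1 y (W.br 1 y) ∧ W.br 1 y < W.mx y := by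
  have hm := (mx_mem hR hy).1
  have ha := a_pos hR
  obtain ⟨x, hx, e⟩ := intermediate_value_Ioo hm.1.le
    (fun x hx => (U_dx (hline_notMem hR ⟨hx.1, by linarith [hx.2, hm.2]⟩ hy)).continuousAt.continuousWithinAt)
    (⟨U_left_neg hR hy, hM⟩ : (0:ℝ) ∈ Ioo _ _)
  have : W.ZZ 1 y x := ⟨⟨hx.1, hx.2.trans hm.2⟩, e, by rw [one_mul]; exact ux_pos hR hy ⟨hx.1.le, hx.2⟩⟩
  rw [br_eq hR hy this]
  exact ⟨this, hx.2⟩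
theorem br_neg {y : ℝ} (hy : y ∈ Ioo 0 W.b) (hM : 0 < W.MM y) : W.ZZ (-1) y (W.br (-1) y) ∧ W.mx y < W.br (-1) y := by
  have hm := (mx_mem hR hy).1
  have ha := a_pos hR
  obtain ⟨x, hx, e⟩ := intermediate_value_Ioo' hm.2.le
    (fun x hx => (U_dx (hline_notMem hR ⟨by linarith [hx.1, hm.1], by linarith [hx.2]⟩ hy)).continuousAt.continuousWithinAt)
    (⟨U_right_neg hR hy, hM⟩ : (0:ℝ) ∈ Ioo _ _)
  have : W.ZZ (-1) y x := ⟨⟨hm.1.trans hx.1, hx.2⟩, e, by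
    have := ux_neg hR hy ⟨hx.1, hx.2.le⟩
    linarith⟩
  rw [br_eq hR hy this]
  exact ⟨this, hx.1⟩

theorem zero_cases {x y : ℝ} (hx : x ∈ Ioo (-W.a) 0) (hy : y ∈ Ioo 0 W.b) (hM : 0 < W.MM y) (h : W.U x y = 0) :
    x = W.br 1 y ∨ x = W.br (-1) y := by
  rcases lt_trichotomy (W.F1 (pt x y)).re 0 with c | c | c
  · exact Or.inr (br_eq hR hy ⟨hx, h, by linarith⟩).symm
  · have := mx_unique hR ⟨hx.1.le, hx.2.le⟩ hy c
    rw [MM, ← this, h] at hM; exact absurd hM (lt_irrefl _)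
  · exact Or.inl (br_eq hR hy ⟨hx, h, by linarith⟩).symm

theorem br_analytic {ε y : ℝ} (hy : y ∈ Ioo 0 W.b) (h : W.ZZ ε y (W.br ε y)) :
    AnalyticAt ℝ (W.br ε) y ∧
    HasDerivAt (W.br ε) ((W.F1 (pt (W.br ε y) y)).im / (W.F1 (pt (W.br ε y) y)).re) y := by
  obtain ⟨h1, h2, h3⟩ := h
  have hk := int_notMem hR h1 hy
  have hne : (W.F1 (pt (W.br ε y) y)).re ≠ 0 := by intro hc; rw [hc] at h3; simp at h3
  obtain ⟨ξ, a1, a2, a3, a4, _⟩ := ift_re (G' := W.F1) (W.fF_analyticAt hk) (W.fF_hasDerivAt hk) hne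
  have hcont : ContinuousAt (fun t => (W.F1 (pt (ξ t) t)).re) y :=
    (curve_deriv a3 (by rw [a2]; exact W.F1_hasDerivAt hk)).re'.continuousAt
  have hev : ∀ᶠ t in 𝓝 y, W.br ε t = ξ t := by
    have c1 : ∀ᶠ t in 𝓝 y, ξ t ∈ Ioo (-W.a) 0 :=
      a1.continuousAt.eventually_mem (by rw [a2]; exact isOpen_Ioo.mem_nhds h1)
    have c2 : ∀ᶠ t in 𝓝 y, 0 < ε * (W.F1 (pt (ξ t) t)).re :=
      (continuousAt_const.mul hcont).eventually_mem (isOpen_Ioi.mem_nhds (by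
        show 0 < ε * (W.F1 (pt (ξ y) y)).re
        rw [a2]; exact h3))
    filter_upwards [c1, c2, a4, isOpen_Ioo.mem_nhds hy] with t t1 t2 t3 t4
    exact br_eq hR t4 ⟨t1, t3.trans h2, t2⟩
  exact ⟨a1.congr (hev.mono fun t ht => ht.symm), a3.congr_of_eventuallyEq hev⟩

/-- monotonicity of `v` along branches -/
theorem br_V {ε y : ℝ} (hy : y ∈ Ioo 0 W.b) (h : W.ZZ ε y (W.br ε y)) :
    ∃ d, 0 < ε * d ∧ HasDerivAt (fun y => W.V (W.br ε y) y) d y := by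
  have hk := int_notMem hR h.1 hy
  have := (curve_deriv (br_analytic hR hy h).2 (W.fF_hasDerivAt hk)).im'
  refine ⟨_, ?_, this⟩
  have h3 := h.2.2
  set p := W.F1 (pt (W.br ε y) y)
  have hne : p.re ≠ 0 := by intro hc; rw [hc] at h3; simp at h3
  have e : (p * (((p.im / p.re : ℝ) : ℂ) + I)).im = (p.re ^ 2 + p.im ^ 2) / p.re ^ 2 * p.re := by
    simp [-ofReal_div]; field_simp
  rw [e]
  have : 0 < (p.re ^ 2 + p.im ^ 2) / p.re ^ 2 := by positivity
  nlinarith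

end rect
end WeierstrassData

end part12

section part13
open scoped Topology ComplexConjugate ContDiff

namespace WeierstrassData
variable (W : WeierstrassData)

/-- symmetry about a half-period -/
def SymC (c : ℂ) : Prop := ∀ k, k ∉ W.lattice → 2 * c - k ∉ W.lattice ∧ W.P (2 * c - k) = W.P k ∧
  (W.fF (2 * c - k)).re = -(W.fF k).re

/-- data of an arc end at a corner -/
structure CornerArc (x0 y0 : ℝ) (ξ : ℝ → ℝ) : Prop where
  an : AnalyticAt ℝ ξ y0
  val : ξ y0 = x0
  notMem : pt x0 y0 ∉ W.lattice
  sym : W.SymC (pt x0 y0)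
  odd : ∀ᶠ s in 𝓝 (0:ℝ), ξ (y0 - s) = 2 * x0 - ξ (y0 + s)

section rect
variable {W} (hR : W.Rect)
include hR

theorem symC1 : W.SymC (pt (-W.a) 0) := by
  intro k hk
  rw [show 2 * pt (-W.a) 0 - k = -(k + 2 * W.w1) by rw [neg_w1_pt hR]; ring]
  have h := Eqv.add1 hR hk
  refine ⟨by rw [W.neg_mem_iff]; exact h.1, by rw [W.P_even h.1, h.2.1], ?_⟩
  rw [W.fF_odd, fF_add1 hR hk]; simp
theorem symC3 : W.SymC (pt 0 W.b) := by
  intro k hk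
  rw [show 2 * pt 0 W.b - k = -k + 2 * W.w3 by rw [w3_pt hR]; ring]
  have h0 := Eqv.neg W hk
  have h := Eqv.add3 hR h0.1
  refine ⟨h.1, by rw [h.2.1, h0.2.1], ?_⟩
  rw [fF_add3 hR h0.1, W.fF_odd]; simp
theorem symC2 : W.SymC (pt (-W.a) W.b) := by
  intro k hk
  rw [show 2 * pt (-W.a) W.b - k = -(k + 2 * W.w1) + 2 * W.w3 by rw [w1_pt hR, w3_pt hR]; simp [pt]; ring]
  have h1 := Eqv.add1 hR hk
  have h0 := Eqv.neg W h1.1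
  have h := Eqv.add3 hR h0.1
  refine ⟨h.1, by rw [h.2.1, h0.2.1, h1.2.1], ?_⟩
  rw [fF_add3 hR h0.1, W.fF_odd, fF_add1 hR hk]; simp

theorem corner_local {x0 y0 ε : ℝ} (hk : pt x0 y0 ∉ W.lattice) (hs : W.SymC (pt x0 y0)) (hU : W.U x0 y0 = 0)
    (hne : 0 < ε * (W.F1 (pt x0 y0)).re) : ∃ ξ, W.CornerArc x0 y0 ξ ∧
      HasDerivAt ξ ((W.F1 (pt x0 y0)).im / (W.F1 (pt x0 y0)).re) y0 ∧
      ∀ᶠ y in 𝓝 y0, y ∈ Ioo 0 W.b → ξ y ∈ Ioo (-W.a) 0 → W.ZZ ε y (ξ y) ∧ W.br ε y = ξ y := by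
  have hne' : (W.F1 (pt x0 y0)).re ≠ 0 := by intro hc; rw [hc] at hne; simp at hne
  obtain ⟨ξ, a1, a2, a3, a4, a5⟩ := ift_re (G' := W.F1) (W.fF_analyticAt hk) (W.fF_hasDerivAt hk) hne'
  refine ⟨ξ, ⟨a1, a2, hk, hs, ?_⟩, a3, ?_⟩
  · have t1 : Tendsto (fun s : ℝ => (y0 - s, 2 * x0 - ξ (y0 + s))) (𝓝 0) (𝓝 (y0, x0)) := by
      have : ContinuousAt (fun s : ℝ => (y0 - s, 2 * x0 - ξ (y0 + s))) 0 := by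
        refine (continuousAt_const.sub continuousAt_id).prodMk (continuousAt_const.sub ?_)
        exact ContinuousAt.comp (f := fun s => y0 + s) (by simpa using a1.continuousAt) (by fun_prop)
      have h := this.tendsto
      simp only [sub_zero, add_zero, a2] at h
      rwa [show 2 * x0 - x0 = x0 by ring] at h
    have t2 : Tendsto (fun s : ℝ => y0 + s) (𝓝 0) (𝓝 y0) := by
      have : ContinuousAt (fun s : ℝ => y0 + s) 0 := by fun_prop
      simpa [ContinuousAt] using this
    have hcurve : ContinuousAt (fun y => pt (ξ y) y) y0 := (hasDerivAt_curve a3).continuousAt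
    have hnm : ∀ᶠ y in 𝓝 y0, pt (ξ y) y ∉ W.lattice :=
      hcurve.eventually_mem (W.isOpen_compl.mem_nhds (by rw [a2]; exact hk))
    filter_upwards [t1.eventually a5, t2.eventually a4, t2.eventually hnm] with s s1 s2 s3
    refine s1 ?_
    have := (hs _ s3).2.2
    have e : 2 * pt x0 y0 - pt (ξ (y0 + s)) (y0 + s) = pt (2 * x0 - ξ (y0 + s)) (y0 - s) :=
      Complex.ext (by simp) (by simp; ring)
    rw [e] at this
    have hU' : (W.fF (pt x0 y0)).re = 0 := hU
    rw [this, s2, hU']; simp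
  · have hcont : ContinuousAt (fun t => (W.F1 (pt (ξ t) t)).re) y0 :=
      (curve_deriv a3 (by rw [a2]; exact W.F1_hasDerivAt hk)).re'.continuousAt
    have c2 : ∀ᶠ t in 𝓝 y0, 0 < ε * (W.F1 (pt (ξ t) t)).re :=
      (continuousAt_const.mul hcont).eventually_mem (isOpen_Ioi.mem_nhds (by
        show 0 < ε * (W.F1 (pt (ξ y0) y0)).re
        rw [a2]; exact hne))
    filter_upwards [c2, a4] with t t1 t2 t3 t4
    have : W.ZZ ε t (ξ t) := ⟨t4, t2.trans hU, t1⟩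
    exact ⟨this, br_eq hR t3 this⟩

theorem corner1 : ∃ ξ, W.CornerArc (-W.a) 0 ξ ∧ ∀ᶠ y in 𝓝[>] 0, W.ZZ 1 y (ξ y) ∧ W.br 1 y = ξ y := by
  have ha := a_pos hR
  have hb := b_pos hR
  have hre : 0 < (W.F1 (pt (-W.a) 0)).re := by rw [F1_re hR, P_corner1 hR]; simpa using hE1 hR
  have him : 0 < (W.F1 (pt (-W.a) 0)).im := by rw [F1_im hR, P_corner1 hR]; simp; linarith [gE1 hR]
  have hk : pt (-W.a) 0 ∉ W.lattice := pt_notMem' hR (ma_mem hR) (z_mem_b hR) (Or.inl (ma_ne hR))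
  obtain ⟨ξ, c1, c2, c3⟩ := corner_local hR (ε := 1) hk (symC1 hR) (U_corner1 hR) (by linarith)
  refine ⟨ξ, c1, ?_⟩
  have hd := div_pos him hre
  have hs := ((hasDerivAt_iff_tendsto_slope.1 c2).eventually (lt_mem_nhds hd)).filter_mono
    (nhdsWithin_mono 0 (show Ioi (0:ℝ) ⊆ {0}ᶜ from fun y hy => ne_of_gt hy))
  have c0 : ∀ᶠ y in 𝓝 0, ξ y < 0 := c1.an.continuousAt.eventually_mem (isOpen_Iio.mem_nhds (by
    rw [c1.val]; show -W.a < 0; linarith))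
  filter_upwards [hs, nhdsWithin_le_nhds c3, Ioo_mem_nhdsGT hb, nhdsWithin_le_nhds c0] with y y1 y2 y3 y4
  refine y2 y3 ⟨?_, y4⟩
  rw [slope_def_field, c1.val] at y1
  by_contra! hc
  have := div_nonpos_of_nonpos_of_nonneg (by linarith : ξ y - -W.a ≤ 0) (by linarith [y3.1] : 0 ≤ y - 0)
  linarith

theorem corner2 : ∃ ξ, W.CornerArc (-W.a) W.b ξ ∧ ∀ᶠ y in 𝓝[<] W.b, W.ZZ 1 y (ξ y) ∧ W.br 1 y = ξ y := by
  have ha := a_pos hR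
  have hb := b_pos hR
  have hre : 0 < (W.F1 (pt (-W.a) W.b)).re := by rw [F1_re hR, P_corner2 hR]; simpa using hE2 hR
  have him : (W.F1 (pt (-W.a) W.b)).im < 0 := by rw [F1_im hR, P_corner2 hR]; simp; linarith [gE2 hR]
  have hk : pt (-W.a) W.b ∉ W.lattice := corner2_notMem hR
  obtain ⟨ξ, c1, c2, c3⟩ := corner_local hR (ε := 1) hk (symC2 hR) (U_corner2 hR) (by linarith)
  refine ⟨ξ, c1, ?_⟩
  have hd := div_neg_of_neg_of_pos him hre
  have hs := ((hasDerivAt_iff_tendsto_slope.1 c2).eventually (gt_mem_nhds hd)).filter_mono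
    (nhdsWithin_mono W.b (show Iio W.b ⊆ {W.b}ᶜ from fun y hy => ne_of_lt hy))
  have c0 : ∀ᶠ y in 𝓝 W.b, ξ y < 0 := c1.an.continuousAt.eventually_mem (isOpen_Iio.mem_nhds (by
    rw [c1.val]; show -W.a < 0; linarith))
  filter_upwards [hs, nhdsWithin_le_nhds c3, Ioo_mem_nhdsLT hb, nhdsWithin_le_nhds c0] with y y1 y2 y3 y4
  refine y2 y3 ⟨?_, y4⟩
  rw [slope_def_field, c1.val] at y1
  by_contra! hc
  have := div_nonneg_of_nonpos (by linarith : ξ y - -W.a ≤ 0) (by linarith [y3.2] : y - W.b ≤ 0)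
  linarith

theorem corner3 : ∃ ξ, W.CornerArc 0 W.b ξ ∧ ∀ᶠ y in 𝓝[<] W.b, W.ZZ (-1) y (ξ y) ∧ W.br (-1) y = ξ y := by
  have ha := a_pos hR
  have hb := b_pos hR
  have hre : (W.F1 (pt 0 W.b)).re < 0 := by rw [F1_re hR, P_corner3 hR]; simpa using hE3 hR
  have him : (W.F1 (pt 0 W.b)).im < 0 := by rw [F1_im hR, P_corner3 hR]; simp; linarith [gE3 hR]
  have hk : pt 0 W.b ∉ W.lattice := pt_notMem' hR (z_mem_a hR) (b_mem hR) (Or.inr (b_ne hR))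
  obtain ⟨ξ, c1, c2, c3⟩ := corner_local hR (ε := -1) hk (symC3 hR) (U_corner3 hR) (by linarith)
  refine ⟨ξ, c1, ?_⟩
  have hd := div_pos_of_neg_of_neg him hre
  have hs := ((hasDerivAt_iff_tendsto_slope.1 c2).eventually (lt_mem_nhds hd)).filter_mono
    (nhdsWithin_mono W.b (show Iio W.b ⊆ {W.b}ᶜ from fun y hy => ne_of_lt hy))
  have c0 : ∀ᶠ y in 𝓝 W.b, -W.a < ξ y := c1.an.continuousAt.eventually_mem (isOpen_Ioi.mem_nhds (by
    rw [c1.val]; show -W.a < 0; linarith))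
  filter_upwards [hs, nhdsWithin_le_nhds c3, Ioo_mem_nhdsLT hb, nhdsWithin_le_nhds c0] with y y1 y2 y3 y4
  refine y2 y3 ⟨y4, ?_⟩
  rw [slope_def_field, c1.val] at y1
  by_contra! hc
  have := div_nonpos_of_nonneg_of_nonpos (by linarith : 0 ≤ ξ y - 0) (by linarith [y3.2] : y - W.b ≤ 0)
  linarith

/-- the negative branch tends to the pole -/
theorem br_tendsto (hZ : ∀ᶠ y in 𝓝[>] 0, W.ZZ (-1) y (W.br (-1) y)) : Tendsto (W.br (-1)) (𝓝[>] 0) (𝓝 0) := by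
  have ha := a_pos hR
  have hb := b_pos hR
  refine tendsto_order.2 ⟨fun r hr => ?_, fun r hr => ?_⟩
  · have hcomp : IsCompact (Icc (-W.a) r) := isCompact_Icc
    have := hcomp.eventually_forall_of_forall_eventually (x₀ := (0:ℝ))
      (P := fun y x => 0 < (W.F1 (pt x y)).re) (by
        intro x hx
        have hx' : x ∈ Ico (-W.a) 0 := ⟨hx.1, hx.2.trans_lt hr⟩
        have hk : pt x 0 ∉ W.lattice := pt_notMem' hR ⟨hx.1, hx'.2.le⟩ (z_mem_b hR) (Or.inl hx'.2.ne)
        have hc : ContinuousAt (fun z : ℝ × ℝ => (W.F1 (pt z.2 z.1)).re) (0, x) :=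
          (analyticAt_re_pt (W.F1_analyticAt hk)).continuousAt
        have hp : 0 < (W.F1 (pt x 0)).re := by
          rw [F1_re hR, im_bottom hR hx']
          have := bottom_dx_pos hR hx'
          linarith
        exact hc.eventually_mem (isOpen_Ioi.mem_nhds hp))
    filter_upwards [nhdsWithin_le_nhds this, hZ] with y y1 y2
    by_contra! hc
    have h1 := y1 _ ⟨y2.1.1.le, hc⟩
    have h2 := y2.2.2
    linarith
  · filter_upwards [hZ] with y hy using hy.1.2.trans hr

end rect
end WeierstrassData

end part13

section part14
open scoped Topology ComplexConjugate ContDiff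

theorem double_zero_factor {G G1 : ℂ → ℂ} {c d : ℂ} (hG : AnalyticAt ℂ G c)
    (hG1 : ∀ᶠ z in 𝓝 c, HasDerivAt G (G1 z) z) (h0 : G1 c = 0) (hd : HasDerivAt G1 d c) :
    ∃ q : ℂ → ℂ, AnalyticAt ℂ q c ∧ q c = d / 2 ∧ ∀ z, G z = G c + (z - c) ^ 2 * q z := by
  have a1 : AnalyticAt ℂ (dslope G c) c := by
    obtain ⟨p, hp⟩ := hG
    exact ⟨_, hp.has_fpower_series_dslope_fslope⟩
  have a2 : AnalyticAt ℂ (dslope (dslope G c) c) c := by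
    obtain ⟨p, hp⟩ := a1
    exact ⟨_, hp.has_fpower_series_dslope_fslope⟩
  set q := dslope (dslope G c) c with hq
  have hz : dslope G c c = 0 := by rw [dslope_same, hG1.self_of_nhds.deriv, h0]
  have hfac : ∀ z, G z = G c + (z - c) ^ 2 * q z := by
    intro z
    have e1 := sub_smul_dslope G c z
    have e2 := sub_smul_dslope (dslope G c) c z
    rw [hz, sub_zero] at e2
    rw [← e2] at e1
    simp only [smul_eq_mul] at e1
    linear_combination -e1
  refine ⟨q, a2, ?_, hfac⟩
  have hev : G1 =ᶠ[𝓝 c] fun z => 2 * (z - c) * q z + (z - c) ^ 2 * deriv q z := by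
    filter_upwards [hG1, a2.eventually_analyticAt] with z h1 h2
    refine h1.unique ?_
    have h3 : HasDerivAt (fun z => G c + (z - c) ^ 2 * q z) (2 * (z - c) * q z + (z - c) ^ 2 * deriv q z) z := by
      have := (((((hasDerivAt_id z).sub_const c).pow 2).mul h2.differentiableAt.hasDerivAt).const_add (G c))
      refine this.congr_deriv ?_
      simp
    rwa [show G = fun z => G c + (z - c) ^ 2 * q z from funext hfac]
  have h4 : HasDerivAt (fun z => 2 * (z - c) * q z + (z - c) ^ 2 * deriv q z) (2 * q c) c := by
    have := ((((hasDerivAt_id c).sub_const c).const_mul 2).mul a2.differentiableAt.hasDerivAt).add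
      ((((hasDerivAt_id c).sub_const c).pow 2).mul a2.deriv.differentiableAt.hasDerivAt)
    refine this.congr_deriv ?_
    simp
  have := hd.unique (h4.congr_of_eventuallyEq hev)
  rw [this]; ring

theorem crossing_branch {G q : ℂ → ℂ} {xc yc r0 : ℝ} (hq : AnalyticAt ℂ q (pt xc yc))
    (hG : ∀ z, G z = G (pt xc yc) + (z - pt xc yc) ^ 2 * q z) (hU : (G (pt xc yc)).re = 0)
    (hr : (((r0:ℂ) + I) ^ 2 * q (pt xc yc)).re = 0) (hs : (((r0:ℂ) + I) * q (pt xc yc)).re ≠ 0) :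
    ∃ ρ : ℝ → ℝ, AnalyticAt ℝ ρ 0 ∧ ρ 0 = r0 ∧
      ∀ᶠ y in 𝓝 yc, (G (pt (xc + (y - yc) * ρ (y - yc)) y)).re = 0 := by
  have hp1 : AnalyticAt ℝ (fun p : ℝ × ℝ => ((p.2 : ℂ) + I)) (0, r0) :=
    ((ofRealCLM.analyticAt _).comp analyticAt_snd).add analyticAt_const
  have hp2 : AnalyticAt ℝ (fun p : ℝ × ℝ => (p.1 : ℂ)) (0, r0) :=
    (ofRealCLM.analyticAt _).comp analyticAt_fst
  have hF : AnalyticAt ℝ (fun p : ℝ × ℝ => (((p.2:ℂ) + I) ^ 2 * q (pt xc yc + p.1 * ((p.2:ℂ) + I))).re) (0, r0) := by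
    refine (reCLM.analyticAt _).comp (((hp1.pow 2)).mul ?_)
    exact (hq.restrictScalars (𝕜 := ℝ)).comp_of_eq (analyticAt_const.add (hp2.mul hp1)) (by simp)
  have hd : HasDerivAt (fun x : ℝ => (((x:ℂ) + I) ^ 2 * q (pt xc yc + ((0:ℝ):ℂ) * ((x:ℂ) + I))).re)
      (2 * (((r0:ℂ) + I) * q (pt xc yc)).re) r0 := by
    have h1 : HasDerivAt (fun x : ℝ => ((x:ℂ) + I) ^ 2 * q (pt xc yc)) (2 * (((r0:ℂ) + I) * q (pt xc yc))) r0 := by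
      have := (((((hasDerivAt_id (r0:ℂ)).comp_ofReal).add_const I).pow 2).mul_const (q (pt xc yc)))
      refine this.congr_deriv ?_
      simp; ring
    have := h1.re'
    simp only [ofReal_zero, zero_mul, add_zero]
    refine this.congr_deriv ?_
    simp
  obtain ⟨ρ, r1, r2, r3, _⟩ := ift _ hF hd (by simpa using hs)
  refine ⟨ρ, r1, r2, ?_⟩
  have ht : Tendsto (fun y : ℝ => y - yc) (𝓝 yc) (𝓝 0) := by
    have : ContinuousAt (fun y : ℝ => y - yc) yc := by fun_prop
    simpa [ContinuousAt] using this
  filter_upwards [ht.eventually r3] with y hy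
  simp only [ofReal_zero, zero_mul, add_zero] at hy
  rw [hr] at hy
  have e : pt (xc + (y - yc) * ρ (y - yc)) y = pt xc yc + ((y - yc : ℝ):ℂ) * ((ρ (y - yc) : ℂ) + I) := by
    simp [pt]; ring
  rw [hG, e]
  have e2 : (pt xc yc + ((y - yc : ℝ):ℂ) * ((ρ (y - yc) : ℂ) + I) - pt xc yc) ^ 2 *
      q (pt xc yc + ((y - yc : ℝ):ℂ) * ((ρ (y - yc) : ℂ) + I)) =
      (((y - yc) ^ 2 : ℝ):ℂ) * (((ρ (y - yc) : ℂ) + I) ^ 2 * q (pt xc yc + ((y - yc : ℝ):ℂ) * ((ρ (y - yc) : ℂ) + I))) := by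
    push_cast; ring
  rw [e2, add_re, hU, re_ofReal_mul, hy]; simp

theorem crossing {G G1 : ℂ → ℂ} {xc yc : ℝ} {d : ℂ} (hG : AnalyticAt ℂ G (pt xc yc))
    (hG1 : ∀ᶠ z in 𝓝 (pt xc yc), HasDerivAt G (G1 z) z) (h0 : G1 (pt xc yc) = 0)
    (hd : HasDerivAt G1 d (pt xc yc)) (hdre : d.re ≠ 0) (hU : (G (pt xc yc)).re = 0) :
    ∃ ξp ξm : ℝ → ℝ, AnalyticAt ℝ ξp yc ∧ AnalyticAt ℝ ξm yc ∧ ξp yc = xc ∧ ξm yc = xc ∧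
      (∀ᶠ y in 𝓝 yc, (G (pt (ξp y) y)).re = 0) ∧ (∀ᶠ y in 𝓝 yc, (G (pt (ξm y) y)).re = 0) ∧
      ∀ᶠ y in 𝓝 yc, (yc < y → ξm y < ξp y) ∧ (y < yc → ξp y < ξm y) := by
  obtain ⟨q, q1, q2, q3⟩ := double_zero_factor hG hG1 h0 hd
  have hm : ∃ m : ℝ, d.im = m * d.re := ⟨d.im / d.re, by field_simp⟩
  obtain ⟨m, hm⟩ := hm
  set s := Real.sqrt (1 + m ^ 2) with hs
  have hs0 : 0 < s := Real.sqrt_pos.2 (by positivity)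
  have hs2 : s ^ 2 = 1 + m ^ 2 := Real.sq_sqrt (by positivity)
  have hqr : (q (pt xc yc)).re = d.re / 2 := by rw [q2]; simp
  have hqi : (q (pt xc yc)).im = m * d.re / 2 := by rw [q2]; simp [hm]
  have root : ∀ r : ℝ, r ^ 2 - 1 = 2 * m * r → (((r:ℂ) + I) ^ 2 * q (pt xc yc)).re = 0 := by
    intro r hr
    simp [pow_two, hqr, hqi]
    linear_combination (d.re / 2) * hr
  have simp' : ∀ r : ℝ, r ≠ m → (((r:ℂ) + I) * q (pt xc yc)).re ≠ 0 := by
    intro r hr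
    simp [hqr, hqi]
    intro hc
    have : d.re * (r - m) = 0 := by linarith
    rcases mul_eq_zero.1 this with h | h
    · exact hdre h
    · exact hr (by linarith)
  obtain ⟨ρp, p1, p2, p3⟩ := crossing_branch (r0 := m + s) q1 q3 hU (root _ (by linear_combination hs2)) (simp' _ (by linarith))
  obtain ⟨ρm, m1, m2, m3⟩ := crossing_branch (r0 := m - s) q1 q3 hU (root _ (by linear_combination hs2)) (simp' _ (by linarith))
  have an : ∀ ρ : ℝ → ℝ, AnalyticAt ℝ ρ 0 → AnalyticAt ℝ (fun y => xc + (y - yc) * ρ (y - yc)) yc := by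
    intro ρ hρ
    have hy : AnalyticAt ℝ (fun y : ℝ => y - yc) yc := analyticAt_id.sub analyticAt_const
    exact analyticAt_const.add (hy.mul (hρ.comp_of_eq hy (by simp)))
  refine ⟨_, _, an _ p1, an _ m1, by simp, by simp, p3, m3, ?_⟩
  have ht : Tendsto (fun y : ℝ => y - yc) (𝓝 yc) (𝓝 0) := by
    have : ContinuousAt (fun y : ℝ => y - yc) yc := by fun_prop
    simpa [ContinuousAt] using this
  have hlt : ∀ᶠ τ in 𝓝 (0:ℝ), ρm τ < ρp τ :=
    m1.continuousAt.eventually_lt p1.continuousAt (by rw [p2, m2]; linarith)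
  filter_upwards [ht.eventually hlt] with y hy
  constructor
  · intro h; nlinarith
  · intro h; nlinarith


end part14

section part15
open scoped Topology ComplexConjugate ContDiff

theorem lt_of_mono_left {f : ℝ → ℝ} {l r A y : ℝ} (hm : StrictMonoOn f (Ioo l r))
    (ht : Tendsto f (𝓝[>] l) (𝓝 A)) (hy : y ∈ Ioo l r) : A < f y := by
  have hmid : (l + y) / 2 ∈ Ioo l r := ⟨by linarith [hy.1], by linarith [hy.1, hy.2]⟩
  have h1 : A ≤ f ((l + y) / 2) := by
    refine le_of_tendsto ht ?_
    filter_upwards [Ioo_mem_nhdsGT hmid.1] with t h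
    exact (hm ⟨h.1, h.2.trans hmid.2⟩ hmid h.2).le
  exact h1.trans_lt (hm hmid hy (by linarith [hy.1]))
theorem lt_of_mono_right {f : ℝ → ℝ} {l r A y : ℝ} (hm : StrictMonoOn f (Ioo l r))
    (ht : Tendsto f (𝓝[<] r) (𝓝 A)) (hy : y ∈ Ioo l r) : f y < A := by
  have hmid : (r + y) / 2 ∈ Ioo l r := ⟨by linarith [hy.1, hy.2], by linarith [hy.2]⟩
  have h1 : f ((r + y) / 2) ≤ A := by
    refine ge_of_tendsto ht ?_
    filter_upwards [Ioo_mem_nhdsLT hmid.2] with t h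
    exact (hm hmid ⟨hmid.1.trans h.1, h.2⟩ h.1).le
  exact (hm hy hmid (by linarith [hy.2])).trans_le h1

namespace WeierstrassData
variable (W : WeierstrassData)

/-- all information on the two arcs of the zero set of `u` in the fundamental rectangle -/
structure ArcData (Xf Xi : ℝ → ℝ) (xf xi : ℝ) : Prop where
  f_an : ∀ y ∈ Ioo 0 W.b, AnalyticAt ℝ Xf y
  i_an : ∀ y ∈ Ioo 0 W.b, AnalyticAt ℝ Xi y
  f_mem : ∀ y ∈ Ioo 0 W.b, Xf y ∈ Ioo (-W.a) 0
  i_mem : ∀ y ∈ Ioo 0 W.b, Xi y ∈ Ioo (-W.a) 0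
  f_zero : ∀ y ∈ Ioo 0 W.b, W.U (Xf y) y = 0
  i_zero : ∀ y ∈ Ioo 0 W.b, W.U (Xi y) y = 0
  cases : ∀ x y, x ∈ Ioo (-W.a) 0 → y ∈ Ioo 0 W.b → W.U x y = 0 → x = Xf y ∨ x = Xi y
  f_left : ∃ ξ, W.CornerArc (-W.a) 0 ξ ∧ ∀ᶠ y in 𝓝[>] 0, Xf y = ξ y
  i_left : Tendsto Xi (𝓝[>] 0) (𝓝 0)
  f_right : ∃ ξ, W.CornerArc xf W.b ξ ∧ ∀ᶠ y in 𝓝[<] W.b, Xf y = ξ y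
  i_right : ∃ ξ, W.CornerArc xi W.b ξ ∧ ∀ᶠ y in 𝓝[<] W.b, Xi y = ξ y
  ends : (xf = -W.a ∧ xi = 0) ∨ (xf = 0 ∧ xi = -W.a)
  v_bd : ∀ y ∈ Ioo 0 W.b, W.V (Xf y) y ∈ Ioo (Real.pi / 2) Real.pi

variable {W}
theorem V_tendsto {X ξ : ℝ → ℝ} {x0 y0 : ℝ} {S : Set ℝ} (hξ : ContinuousAt ξ y0) (hv : ξ y0 = x0)
    (hk : pt x0 y0 ∉ W.lattice) (h : ∀ᶠ y in 𝓝[S] y0, X y = ξ y) :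
    Tendsto (fun y => W.V (X y) y) (𝓝[S] y0) (𝓝 (W.V x0 y0)) := by
  have h1 : ContinuousAt (fun y => pt (ξ y) y) y0 := by unfold pt; fun_prop
  have h2 : ContinuousAt (fun y => W.fF (pt (ξ y) y)) y0 :=
    ContinuousAt.comp (f := fun y => pt (ξ y) y) (g := W.fF) (by rw [hv]; exact (W.fF_hasDerivAt hk).continuousAt) h1
  have h3 : Tendsto (fun y => W.V (ξ y) y) (𝓝 y0) (𝓝 (W.V (ξ y0) y0)) :=
    (continuous_im.continuousAt.comp h2)
  rw [hv] at h3
  exact (h3.mono_left nhdsWithin_le_nhds).congr' (h.mono fun y hy => by simp only [hy])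

section rect
variable (hR : W.Rect)
include hR

theorem V_corner1 : W.V (-W.a) 0 = Real.pi / 2 := by
  show (W.fF (pt (-W.a) 0)).im = _
  rw [fF_corner1 hR]; simp
theorem V_corner2 : W.V (-W.a) W.b = Real.pi := by
  show (W.fF (pt (-W.a) W.b)).im = _
  rw [fF_corner2 hR]; simp
theorem V_corner3 : W.V 0 W.b = Real.pi / 2 := by
  show (W.fF (pt 0 W.b)).im = _
  rw [fF_corner3 hR]; simp

theorem V_mono {l r : ℝ} (h : ∀ y ∈ Ioo l r, y ∈ Ioo 0 W.b ∧ W.ZZ 1 y (W.br 1 y)) :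
    StrictMonoOn (fun y => W.V (W.br 1 y) y) (Ioo l r) := by
  apply strictMonoOn_of_deriv_pos (convex_Ioo _ _)
  · intro y hy
    obtain ⟨d, _, hd⟩ := br_V hR (h y hy).1 (h y hy).2
    exact hd.continuousAt.continuousWithinAt
  · intro y hy
    rw [interior_Ioo] at hy
    obtain ⟨d, h0, hd⟩ := br_V hR (h y hy).1 (h y hy).2
    rw [hd.deriv]; linarith
theorem V_anti {l r : ℝ} (h : ∀ y ∈ Ioo l r, y ∈ Ioo 0 W.b ∧ W.ZZ (-1) y (W.br (-1) y)) :
    StrictMonoOn (fun y => - W.V (W.br (-1) y) y) (Ioo l r) := by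
  apply strictMonoOn_of_deriv_pos (convex_Ioo _ _)
  · intro y hy
    obtain ⟨d, _, hd⟩ := br_V hR (h y hy).1 (h y hy).2
    exact hd.continuousAt.neg.continuousWithinAt
  · intro y hy
    rw [interior_Ioo] at hy
    obtain ⟨d, h0, hd⟩ := br_V hR (h y hy).1 (h y hy).2
    have := hd.neg.deriv
    have e : deriv (fun y => - W.V (W.br (-1) y) y) y = -d := this
    rw [e]; linarith

theorem arcs_pos (hM : ∀ y ∈ Ioo 0 W.b, 0 < W.MM y) : W.ArcData (W.br 1) (W.br (-1)) (-W.a) 0 := by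
  have hb := b_pos hR
  obtain ⟨ξ1, c1, c1'⟩ := corner1 hR
  obtain ⟨ξ2, c2, c2'⟩ := corner2 hR
  obtain ⟨ξ3, c3, c3'⟩ := corner3 hR
  have hmono := V_mono hR (l := 0) (r := W.b) (fun y hy => ⟨hy, (br_pos hR hy (hM y hy)).1⟩)
  refine ⟨fun y hy => (br_analytic hR hy (br_pos hR hy (hM y hy)).1).1,
    fun y hy => (br_analytic hR hy (br_neg hR hy (hM y hy)).1).1,
    fun y hy => (br_pos hR hy (hM y hy)).1.1, fun y hy => (br_neg hR hy (hM y hy)).1.1,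
    fun y hy => (br_pos hR hy (hM y hy)).1.2.1, fun y hy => (br_neg hR hy (hM y hy)).1.2.1,
    fun x y hx hy h => zero_cases hR hx hy (hM y hy) h,
    ⟨ξ1, c1, c1'.mono fun y h => h.2⟩, br_tendsto hR ?_, ⟨ξ2, c2, c2'.mono fun y h => h.2⟩,
    ⟨ξ3, c3, c3'.mono fun y h => h.2⟩, Or.inl ⟨rfl, rfl⟩, ?_⟩
  · filter_upwards [Ioo_mem_nhdsGT hb] with y hy
    exact (br_neg hR hy (hM y hy)).1
  · intro y hy
    constructor
    · rw [← V_corner1 hR]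
      exact lt_of_mono_left (f := fun y => W.V (W.br 1 y) y) hmono (V_tendsto c1.an.continuousAt c1.val c1.notMem (c1'.mono fun y h => h.2)) hy
    · rw [← V_corner2 hR]
      exact lt_of_mono_right (f := fun y => W.V (W.br 1 y) y) hmono (V_tendsto c2.an.continuousAt c2.val c2.notMem (c2'.mono fun y h => h.2)) hy

theorem arcs_zero {xc yc : ℝ} (hxc : xc ∈ Ioo (-W.a) 0) (hyc : yc ∈ Ioo 0 W.b) (hc : W.F1 (pt xc yc) = 0)
    (hU : W.U xc yc = 0) (hM : ∀ y ∈ Ioo 0 W.b, y ≠ yc → 0 < W.MM y) :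
    ∃ Xf Xi, W.ArcData Xf Xi 0 (-W.a) := by
  have hb := b_pos hR
  obtain ⟨ξ1, c1, c1'⟩ := corner1 hR
  obtain ⟨ξ2, c2, c2'⟩ := corner2 hR
  obtain ⟨ξ3, c3, c3'⟩ := corner3 hR
  have hkc := int_notMem hR hxc hyc
  have hm : xc = W.mx yc := mx_unique hR ⟨hxc.1.le, hxc.2.le⟩ hyc (by rw [hc]; simp)
  have hxx := uxx_neg hR hxc hyc (by rw [hc]; simp)
  obtain ⟨ξp, ξm, p1, m1, p2, m2, p3, m3, pm⟩ := crossing (W.fF_analyticAt hkc)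
    (by filter_upwards [W.isOpen_compl.mem_nhds hkc] with z hz; exact W.fF_hasDerivAt hz) hc
    (W.F1_hasDerivAt hkc) hxx.ne hU
  set Xf : ℝ → ℝ := fun y => if y < yc then W.br 1 y else if y = yc then xc else W.br (-1) y with hXf
  set Xi : ℝ → ℝ := fun y => if y < yc then W.br (-1) y else if y = yc then xc else W.br 1 y with hXi
  have Xf_lt : ∀ y, y < yc → Xf y = W.br 1 y := fun y h => by simp [hXf, h]
  have Xi_lt : ∀ y, y < yc → Xi y = W.br (-1) y := fun y h => by simp [hXi, h]
  have Xf_gt : ∀ y, yc < y → Xf y = W.br (-1) y := fun y h => by simp [hXf, h.not_gt, h.ne']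
  have Xi_gt : ∀ y, yc < y → Xi y = W.br 1 y := fun y h => by simp [hXi, h.not_gt, h.ne']
  have Xf_eq : Xf yc = xc := by simp [hXf]
  have Xi_eq : Xi yc = xc := by simp [hXi]
  have bp := fun y hy hn => br_pos hR hy (hM y hy hn)
  have bn := fun y hy hn => br_neg hR hy (hM y hy hn)
  have hloc : ∀ᶠ y in 𝓝 yc, Xf y = ξp y ∧ Xi y = ξm y := by
    have i1 : ∀ᶠ y in 𝓝 yc, ξp y ∈ Ioo (-W.a) 0 :=
      p1.continuousAt.eventually_mem (by rw [p2]; exact isOpen_Ioo.mem_nhds hxc)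
    have i2 : ∀ᶠ y in 𝓝 yc, ξm y ∈ Ioo (-W.a) 0 :=
      m1.continuousAt.eventually_mem (by rw [m2]; exact isOpen_Ioo.mem_nhds hxc)
    filter_upwards [p3, m3, pm, i1, i2, isOpen_Ioo.mem_nhds hyc] with y y1 y2 y3 y4 y5 hy
    rcases lt_trichotomy y yc with h | h | h
    · have z1 := zero_cases hR y4 hy (hM y hy h.ne) y1
      have z2 := zero_cases hR y5 hy (hM y hy h.ne) y2
      have := y3.2 h
      have b1 := (bp y hy h.ne).2
      have b2 := (bn y hy h.ne).2
      rw [Xf_lt y h, Xi_lt y h]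
      rcases z1 with z1 | z1 <;> rcases z2 with z2 | z2 <;> first | exact ⟨z1.symm, z2.symm⟩ | (exfalso; linarith)
    · rw [h, Xf_eq, Xi_eq, p2, m2]; exact ⟨rfl, rfl⟩
    · have z1 := zero_cases hR y4 hy (hM y hy h.ne') y1
      have z2 := zero_cases hR y5 hy (hM y hy h.ne') y2
      have := y3.1 h
      have b1 := (bp y hy h.ne').2
      have b2 := (bn y hy h.ne').2
      rw [Xf_gt y h, Xi_gt y h]
      rcases z1 with z1 | z1 <;> rcases z2 with z2 | z2 <;> first | exact ⟨z1.symm, z2.symm⟩ | (exfalso; linarith)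
  have an1 : ∀ y ∈ Ioo 0 W.b, y ≠ yc → AnalyticAt ℝ (W.br 1) y := fun y hy hn => (br_analytic hR hy (bp y hy hn).1).1
  have an2 : ∀ y ∈ Ioo 0 W.b, y ≠ yc → AnalyticAt ℝ (W.br (-1)) y := fun y hy hn => (br_analytic hR hy (bn y hy hn).1).1
  have ev0 : ∀ᶠ y in 𝓝[>] (0:ℝ), y < yc := by filter_upwards [Ioo_mem_nhdsGT hyc.1] with y hy using hy.2
  have evb : ∀ᶠ y in 𝓝[<] W.b, yc < y := by filter_upwards [Ioo_mem_nhdsLT hyc.2] with y hy using hy.1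
  have mono1 := V_mono hR (l := 0) (r := yc) (fun y hy => ⟨⟨hy.1, hy.2.trans hyc.2⟩, (bp y ⟨hy.1, hy.2.trans hyc.2⟩ hy.2.ne).1⟩)
  have mono2 := V_mono hR (l := yc) (r := W.b) (fun y hy => ⟨⟨hyc.1.trans hy.1, hy.2⟩, (bp y ⟨hyc.1.trans hy.1, hy.2⟩ hy.1.ne').1⟩)
  have anti2 := V_anti hR (l := yc) (r := W.b) (fun y hy => ⟨⟨hyc.1.trans hy.1, hy.2⟩, (bn y ⟨hyc.1.trans hy.1, hy.2⟩ hy.1.ne').1⟩)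
  have T1 : Tendsto (fun y => W.V (W.br 1 y) y) (𝓝[<] yc) (𝓝 (W.V xc yc)) :=
    V_tendsto p1.continuousAt p2 hkc (by
      filter_upwards [nhdsWithin_le_nhds hloc, self_mem_nhdsWithin] with y h h'
      rw [← h.1, Xf_lt y h'])
  have T2 : Tendsto (fun y => W.V (W.br 1 y) y) (𝓝[>] yc) (𝓝 (W.V xc yc)) :=
    V_tendsto m1.continuousAt m2 hkc (by
      filter_upwards [nhdsWithin_le_nhds hloc, self_mem_nhdsWithin] with y h h'
      rw [← h.2, Xi_gt y h'])
  have T3 : Tendsto (fun y => W.V (W.br (-1) y) y) (𝓝[>] yc) (𝓝 (W.V xc yc)) :=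
    V_tendsto p1.continuousAt p2 hkc (by
      filter_upwards [nhdsWithin_le_nhds hloc, self_mem_nhdsWithin] with y h h'
      rw [← h.1, Xf_gt y h'])
  have B1 := V_tendsto c1.an.continuousAt c1.val c1.notMem (c1'.mono fun y h => h.2)
  have B2 := V_tendsto c2.an.continuousAt c2.val c2.notMem (c2'.mono fun y h => h.2)
  have B3 := V_tendsto c3.an.continuousAt c3.val c3.notMem (c3'.mono fun y h => h.2)
  rw [V_corner1 hR] at B1
  rw [V_corner2 hR] at B2
  rw [V_corner3 hR] at B3
  have vc1 : W.V xc yc < Real.pi := by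
    have hy : (yc + W.b) / 2 ∈ Ioo yc W.b := ⟨by linarith [hyc.2], by linarith [hyc.2]⟩
    exact (lt_of_mono_left (f := fun y => W.V (W.br 1 y) y) mono2 T2 hy).trans (lt_of_mono_right (f := fun y => W.V (W.br 1 y) y) mono2 B2 hy)
  have vc2 : Real.pi / 2 < W.V xc yc := by
    have hy : yc / 2 ∈ Ioo 0 yc := ⟨by linarith [hyc.1], by linarith [hyc.1]⟩
    exact (lt_of_mono_left (f := fun y => W.V (W.br 1 y) y) mono1 B1 hy).trans (lt_of_mono_right (f := fun y => W.V (W.br 1 y) y) mono1 T1 hy)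
  refine ⟨Xf, Xi, ?_, ?_, ?_, ?_, ?_, ?_, ?_, ?_, ?_, ?_, ?_, Or.inr ⟨rfl, rfl⟩, ?_⟩
  · intro y hy
    rcases lt_trichotomy y yc with h | h | h
    · exact (an1 y hy h.ne).congr (by filter_upwards [isOpen_Iio.mem_nhds h] with t ht; exact (Xf_lt t ht).symm)
    · subst h; exact p1.congr (hloc.mono fun t ht => ht.1.symm)
    · exact (an2 y hy h.ne').congr (by filter_upwards [isOpen_Ioi.mem_nhds h] with t ht; exact (Xf_gt t ht).symm)
  · intro y hy
    rcases lt_trichotomy y yc with h | h | h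
    · exact (an2 y hy h.ne).congr (by filter_upwards [isOpen_Iio.mem_nhds h] with t ht; exact (Xi_lt t ht).symm)
    · subst h; exact m1.congr (hloc.mono fun t ht => ht.2.symm)
    · exact (an1 y hy h.ne').congr (by filter_upwards [isOpen_Ioi.mem_nhds h] with t ht; exact (Xi_gt t ht).symm)
  · intro y hy
    rcases lt_trichotomy y yc with h | h | h
    · rw [Xf_lt y h]; exact (bp y hy h.ne).1.1
    · rw [h, Xf_eq]; exact hxc
    · rw [Xf_gt y h]; exact (bn y hy h.ne').1.1
  · intro y hy
    rcases lt_trichotomy y yc with h | h | h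
    · rw [Xi_lt y h]; exact (bn y hy h.ne).1.1
    · rw [h, Xi_eq]; exact hxc
    · rw [Xi_gt y h]; exact (bp y hy h.ne').1.1
  · intro y hy
    rcases lt_trichotomy y yc with h | h | h
    · rw [Xf_lt y h]; exact (bp y hy h.ne).1.2.1
    · rw [h, Xf_eq]; exact hU
    · rw [Xf_gt y h]; exact (bn y hy h.ne').1.2.1
  · intro y hy
    rcases lt_trichotomy y yc with h | h | h
    · rw [Xi_lt y h]; exact (bn y hy h.ne).1.2.1
    · rw [h, Xi_eq]; exact hU
    · rw [Xi_gt y h]; exact (bp y hy h.ne').1.2.1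
  · intro x y hx hy hz
    rcases lt_trichotomy y yc with h | h | h
    · rw [Xf_lt y h, Xi_lt y h]; exact zero_cases hR hx hy (hM y hy h.ne) hz
    · left
      subst h
      rw [Xf_eq]
      have e := (mx_mem hR hy).1
      rcases lt_trichotomy x xc with g | g | g
      · have := U_mono_left hR hy ⟨hx.1.le, by rw [← hm]; exact g.le⟩ ⟨e.1.le, le_rfl⟩ (by rw [← hm]; exact g)
        simp only [← hm] at this
        linarith
      · exact g
      · have := U_anti_right hR hy ⟨le_rfl, e.2.le⟩ ⟨by rw [← hm]; exact g.le, hx.2.le⟩ (by rw [← hm]; exact g)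
        simp only [← hm] at this
        linarith
    · rw [Xf_gt y h, Xi_gt y h]; exact (zero_cases hR hx hy (hM y hy h.ne') hz).symm
  · refine ⟨ξ1, c1, ?_⟩
    filter_upwards [c1', ev0] with y h h'
    rw [Xf_lt y h', h.2]
  · have := br_tendsto hR (by
      filter_upwards [Ioo_mem_nhdsGT hb, ev0] with y hy hy'
      exact (bn y hy hy'.ne).1)
    refine this.congr' ?_
    filter_upwards [ev0] with y h'
    rw [Xi_lt y h']
  · refine ⟨ξ3, c3, ?_⟩
    filter_upwards [c3', evb] with y h h'
    rw [Xf_gt y h', h.2]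
  · refine ⟨ξ2, c2, ?_⟩
    filter_upwards [c2', evb] with y h h'
    rw [Xi_gt y h', h.2]
  · intro y hy
    rcases lt_trichotomy y yc with h | h | h
    · rw [Xf_lt y h]
      exact ⟨lt_of_mono_left (f := fun y => W.V (W.br 1 y) y) mono1 B1 ⟨hy.1, h⟩, (lt_of_mono_right (f := fun y => W.V (W.br 1 y) y) mono1 T1 ⟨hy.1, h⟩).trans vc1⟩
    · rw [h, Xf_eq]; exact ⟨vc2, vc1⟩
    · rw [Xf_gt y h]
      have q1 := lt_of_mono_left anti2 T3.neg ⟨h, hy.2⟩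
      have q2 := lt_of_mono_right anti2 B3.neg ⟨h, hy.2⟩
      exact ⟨by linarith, by linarith⟩

/-- existence of the arc data when the critical value is nonnegative -/
theorem arcs {xc yc : ℝ} (hxc : xc ∈ Ioo (-W.a) 0) (hyc : yc ∈ Ioo 0 W.b) (hc : W.F1 (pt xc yc) = 0)
    (hU : 0 ≤ W.U xc yc) : ∃ Xf Xi xf xi, W.ArcData Xf Xi xf xi := by
  have hgt := fun y hy hne => MM_gt hR (y := y) hxc hyc hc hy hne
  rcases hU.eq_or_lt with h | h
  · obtain ⟨Xf, Xi, hA⟩ := arcs_zero hR hxc hyc hc h.symm (fun y hy hn => hU.trans_lt (hgt y hy hn))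
    exact ⟨_, _, _, _, hA⟩
  · refine ⟨_, _, _, _, arcs_pos hR fun y hy => ?_⟩
    by_cases hy' : y = yc
    · have hm : xc = W.mx yc := mx_unique hR ⟨hxc.1.le, hxc.2.le⟩ hyc (by rw [hc]; simp)
      rw [hy', MM, ← hm]; exact h
    · exact h.trans (hgt y hy hy')

end rect
end WeierstrassData

end part15

section part16
open scoped Topology ComplexConjugate ContDiff

/-- an even analytic function is an analytic function of the square -/
theorem even_factor0 {F : Type*} [NormedAddCommGroup F] [NormedSpace ℝ F] [CompleteSpace F] {g : ℝ → F}
    (hg : AnalyticAt ℝ g 0) (he : ∀ᶠ s in 𝓝 (0:ℝ), g (-s) = g s) :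
    ∃ G : ℝ → F, AnalyticAt ℝ G 0 ∧ ∀ᶠ s in 𝓝 (0:ℝ), g s = G (s ^ 2) := by
  obtain ⟨p, hp⟩ := hg
  set q : FormalMultilinearSeries ℝ ℝ F := fun n => ContinuousMultilinearMap.mkPiRing ℝ (Fin n) (p.coeff (2 * n)) with hq
  obtain ⟨r, hr0, hr⟩ := ENNReal.lt_iff_exists_nnreal_btwn.1 hp.radius_pos
  obtain ⟨C, hC0, hC⟩ := p.norm_mul_pow_le_of_lt_radius hr
  have hr0' : (0:NNReal) < r := by exact_mod_cast hr0
  have hqr : ((r ^ 2 : NNReal) : ENNReal) ≤ q.radius := by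
    refine q.le_radius_of_bound C fun n => ?_
    have h1 : ‖q n‖ = ‖p (2 * n)‖ := by
      rw [hq, ContinuousMultilinearMap.norm_mkPiRing, FormalMultilinearSeries.norm_apply_eq_norm_coef]
    rw [h1]
    have := hC (2 * n)
    rw [NNReal.coe_pow, ← pow_mul]
    exact this
  have hqpos : 0 < q.radius := lt_of_lt_of_le (by exact_mod_cast pow_pos hr0' 2) hqr
  have hG := q.hasFPowerSeriesOnBall hqpos
  refine ⟨q.sum, hG.analyticAt, ?_⟩
  have e1 := hasFPowerSeriesAt_iff.1 hp
  have e2 := hasFPowerSeriesAt_iff.1 hG.hasFPowerSeriesAt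
  have tn : Tendsto (fun s : ℝ => -s) (𝓝 0) (𝓝 0) := by
    have : ContinuousAt (fun s : ℝ => -s) 0 := by fun_prop
    simpa [ContinuousAt] using this
  have ts : Tendsto (fun s : ℝ => s ^ 2) (𝓝 0) (𝓝 0) := by
    have : ContinuousAt (fun s : ℝ => s ^ 2) 0 := by fun_prop
    simpa [ContinuousAt] using this
  filter_upwards [e1, tn.eventually e1, ts.eventually e2, he] with s h1 h2 h3 h4
  simp only [zero_add] at h1 h2 h3
  rw [h4] at h2
  have h5 := (h1.add h2).const_smul (1/2 : ℝ)
  have h6 : HasSum (fun n => (s ^ 2) ^ n • q.coeff n) (g s) := by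
    have inj : Function.Injective (fun n : ℕ => 2 * n) := fun m n h => by simpa using h
    have := (inj.hasSum_iff (by
      intro n hn
      have hodd : Odd n := by
        rw [← Nat.not_even_iff_odd]; intro hev
        obtain ⟨m, rfl⟩ := hev
        exact hn ⟨m, by simp; ring⟩
      simp [hodd.neg_pow])).2 h5
    convert this using 1
    · funext n
      have hc : q.coeff n = p.coeff (2 * n) := by
        rw [FormalMultilinearSeries.coeff, hq]
        simp only [ContinuousMultilinearMap.mkPiRing_apply]
        simp
      simp only [Function.comp, hc]
      rw [show (-s) ^ (2 * n) = s ^ (2 * n) from (even_two_mul n).neg_pow s, ← two_smul ℝ, smul_smul, pow_mul]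
      norm_num
    · rw [← two_smul ℝ, smul_smul]; norm_num
  exact h6.unique h3

theorem even_factor {F : Type*} [NormedAddCommGroup F] [NormedSpace ℝ F] [CompleteSpace F] {g : ℝ → F}
    (hg : AnalyticAt ℝ g 0) (he : ∀ᶠ s in 𝓝 (0:ℝ), g (-s) = g s) :
    ∃ G : ℝ → F, AnalyticAt ℝ G 0 ∧ (∀ᶠ s in 𝓝 (0:ℝ), g s = G (s ^ 2)) ∧
      deriv (deriv g) 0 = (2:ℝ) • deriv G 0 := by
  obtain ⟨G, hG, hev⟩ := even_factor0 hg he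
  refine ⟨G, hG, hev, ?_⟩
  have ts : Tendsto (fun s : ℝ => s ^ 2) (𝓝 0) (𝓝 0) := by
    have : ContinuousAt (fun s : ℝ => s ^ 2) 0 := by fun_prop
    simpa [ContinuousAt] using this
  have h1 : deriv g =ᶠ[𝓝 0] fun s => (2 * s) • deriv G (s ^ 2) := by
    filter_upwards [hev.eventually_nhds, ts.eventually hG.eventually_analyticAt] with s a1 a2
    have hd : HasDerivAt (fun s : ℝ => G (s ^ 2)) ((2 * s) • deriv G (s ^ 2)) s := by
      have hp : HasDerivAt (fun s : ℝ => s ^ 2) (2 * s) s := by simpa using hasDerivAt_pow 2 s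
      exact HasDerivAt.scomp s a2.differentiableAt.hasDerivAt hp
    exact (hd.congr_of_eventuallyEq a1).deriv
  rw [h1.deriv_eq]
  have hp : HasDerivAt (fun s : ℝ => s ^ 2) 0 0 := by simpa using hasDerivAt_pow 2 (0:ℝ)
  have hd' : DifferentiableAt ℝ (deriv G) ((0:ℝ) ^ 2) := by
    simpa using hG.deriv.differentiableAt
  have h3 : HasDerivAt (fun s : ℝ => deriv G (s ^ 2)) ((0:ℝ) • deriv (deriv G) ((0:ℝ) ^ 2)) 0 :=
    HasDerivAt.scomp (h := fun s : ℝ => s ^ 2) (0:ℝ) hd'.hasDerivAt hp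
  have h2 := (((hasDerivAt_id (0:ℝ)).const_mul 2).smul h3).deriv
  refine Eq.trans ?_ (h2.trans ?_)
  · rfl
  · simp

/-- local analytic inverse -/
theorem local_inverse {T : ℝ → ℝ} {y0 : ℝ} (hT : AnalyticAt ℝ T y0) (h0 : deriv T y0 ≠ 0) :
    ∃ e : ℝ → ℝ, AnalyticAt ℝ e (T y0) ∧ e (T y0) = y0 ∧ deriv e (T y0) ≠ 0 ∧
      (∀ᶠ t in 𝓝 (T y0), T (e t) = t) ∧ ∀ᶠ y in 𝓝 y0, e (T y) = y := by
  have hF : AnalyticAt ℝ (fun p : ℝ × ℝ => T p.2 - p.1) (T y0, y0) :=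
    (hT.comp_of_eq analyticAt_snd rfl).sub analyticAt_fst
  have hd : HasDerivAt (fun y => T y - T y0) (deriv T y0) y0 := hT.differentiableAt.hasDerivAt.sub_const _
  obtain ⟨e, e1, e2, e3, e4⟩ := ift _ hF hd h0
  simp only [sub_self] at e3 e4
  refine ⟨e, e1, e2, ?_, ?_, ?_⟩
  · have c : HasDerivAt (fun t => T (e t)) (deriv T y0 * deriv e (T y0)) (T y0) :=
      HasDerivAt.comp _ (by rw [e2]; exact hT.differentiableAt.hasDerivAt) e1.differentiableAt.hasDerivAt
    have h1 : (fun t => T (e t)) =ᶠ[𝓝 (T y0)] id := by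
      filter_upwards [e3] with t ht
      simp only [id]; linarith
    have := c.unique ((hasDerivAt_id _).congr_of_eventuallyEq h1)
    intro hc
    rw [hc] at this; simp at this
  · filter_upwards [e3] with t ht
    linarith
  · have : Tendsto (fun y => (T y, y)) (𝓝 y0) (𝓝 (T y0, y0)) := hT.continuousAt.prodMk continuousAt_id
    filter_upwards [this.eventually e4] with y hy
    exact hy (by simp)

theorem even_repar {F : Type*} [NormedAddCommGroup F] [NormedSpace ℝ F] [CompleteSpace F] {g : ℝ → F} {T : ℝ → ℝ}
    (hg : AnalyticAt ℝ g 0) (he : ∀ᶠ s in 𝓝 (0:ℝ), g (-s) = g s)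
    (hT : AnalyticAt ℝ T 0) (hTe : ∀ᶠ s in 𝓝 (0:ℝ), T (-s) = T s) (hT0 : T 0 = 0)
    (hg2 : deriv (deriv g) 0 ≠ 0) (hT2 : deriv (deriv T) 0 ≠ 0) :
    ∃ G : ℝ → F, AnalyticAt ℝ G 0 ∧ deriv G 0 ≠ 0 ∧ ∀ᶠ s in 𝓝 (0:ℝ), g s = G (T s) := by
  obtain ⟨G, G1, G2, G3⟩ := even_factor hg he
  obtain ⟨E, E1, E2, E3⟩ := even_factor hT hTe
  have hE' : deriv E 0 ≠ 0 := by intro h; rw [h] at E3; simp at E3; exact hT2 E3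
  have hG' : deriv G 0 ≠ 0 := by intro h; rw [h] at G3; simp at G3; exact hg2 G3
  have hE0 : E 0 = 0 := by have := E2.self_of_nhds; rw [hT0] at this; simpa using this.symm
  obtain ⟨e, a1, a2, a3, a4, a5⟩ := local_inverse E1 hE'
  rw [hE0] at a1 a2 a3 a4
  refine ⟨fun t => G (e t), G1.comp_of_eq a1 a2, ?_, ?_⟩
  · have : HasDerivAt (fun t => G (e t)) (deriv e 0 • deriv G 0) 0 :=
      HasDerivAt.scomp (0:ℝ) (by rw [a2]; exact G1.differentiableAt.hasDerivAt) a1.differentiableAt.hasDerivAt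
    rw [this.deriv]; exact smul_ne_zero a3 hG'
  · have ts : Tendsto (fun s : ℝ => s ^ 2) (𝓝 0) (𝓝 0) := by
      have : ContinuousAt (fun s : ℝ => s ^ 2) 0 := by fun_prop
      simpa [ContinuousAt] using this
    filter_upwards [G2, E2, ts.eventually a5] with s s1 s2 s3
    simp only [s2, s3, s1]

/-- reparametrization at an interior point -/
theorem inner_repar {K : ℝ → ℂ} {T Y : ℝ → ℝ} {l r y0 : ℝ} (hK : AnalyticAt ℝ K y0) (hK' : deriv K y0 ≠ 0)
    (hT : AnalyticAt ℝ T y0) (hT' : deriv T y0 ≠ 0) (hy : y0 ∈ Ioo l r) (hY : ∀ y ∈ Ioo l r, Y (T y) = y) :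
    AnalyticAt ℝ (fun t => K (Y t)) (T y0) ∧ deriv (fun t => K (Y t)) (T y0) ≠ 0 := by
  obtain ⟨e, a1, a2, a3, a4, a5⟩ := local_inverse hT hT'
  have hev : (fun t => K (Y t)) =ᶠ[𝓝 (T y0)] fun t => K (e t) := by
    have : ∀ᶠ t in 𝓝 (T y0), e t ∈ Ioo l r :=
      a1.continuousAt.eventually_mem (by rw [a2]; exact isOpen_Ioo.mem_nhds hy)
    filter_upwards [this, a4] with t t1 t2
    have := hY _ t1
    rw [t2] at this
    rw [this]
  refine ⟨(hK.comp_of_eq a1 a2).congr hev.symm, ?_⟩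
  rw [hev.deriv_eq]
  have : HasDerivAt (fun t => K (e t)) (deriv e (T y0) • deriv K y0) (T y0) :=
    HasDerivAt.scomp (T y0) (by rw [a2]; exact hK.differentiableAt.hasDerivAt) a1.differentiableAt.hasDerivAt
  rw [this.deriv]; exact smul_ne_zero a3 hK'

/-- an end of an arc: near `0+` it coincides with an even analytic function with nonzero second derivative -/
def EvenEnd (K : ℝ → ℂ) : Prop := ∃ g : ℝ → ℂ, AnalyticAt ℝ g 0 ∧ (∀ᶠ s in 𝓝 (0:ℝ), g (-s) = g s) ∧
  deriv (deriv g) 0 ≠ 0 ∧ ∀ᶠ s in 𝓝[≥] (0:ℝ), K s = g s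

theorem end_repar {K : ℝ → ℂ} {T Y : ℝ → ℝ} {δ : ℝ} (hK : EvenEnd K) (hT : AnalyticAt ℝ T 0)
    (hTe : ∀ᶠ s in 𝓝 (0:ℝ), T (-s) = T s) (hT0 : T 0 = 0) (hT2 : deriv (deriv T) 0 ≠ 0) (hδ : 0 < δ)
    (hTc : ContinuousOn T (Icc 0 δ)) (hTp : ∀ y ∈ Ioc 0 δ, 0 < T y) (hY : ∀ y ∈ Icc 0 δ, Y (T y) = y) :
    ∃ G : ℝ → ℂ, AnalyticAt ℝ G 0 ∧ deriv G 0 ≠ 0 ∧ ∀ᶠ t in 𝓝[≥] (0:ℝ), K (Y t) = G t := by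
  obtain ⟨g, g1, g2, g3, g4⟩ := hK
  obtain ⟨G, G1, G2, G3⟩ := even_repar g1 g2 hT hTe hT0 g3 hT2
  refine ⟨G, G1, G2, ?_⟩
  have := g4.and (nhdsWithin_le_nhds G3)
  obtain ⟨ε, hε, hs⟩ := mem_nhdsGE_iff_exists_Icc_subset.1 this
  set m := min ε δ
  have hm : 0 < m := lt_min hε hδ
  have hmδ : m ≤ δ := min_le_right _ _
  filter_upwards [Icc_mem_nhdsGE (hTp m ⟨hm, hmδ⟩)] with t ht
  rw [← hT0] at ht
  obtain ⟨y, hy, rfl⟩ := intermediate_value_Icc hm.le (hTc.mono (Icc_subset_Icc_right hmδ)) ht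
  rw [hY y ⟨hy.1, hy.2.trans hmδ⟩]
  have h := hs (show y ∈ Icc 0 ε from ⟨hy.1, hy.2.trans (min_le_left _ _)⟩)
  exact h.1.trans h.2


end part16

section part17
open scoped Topology ComplexConjugate ContDiff

theorem glue_finite {K : ℝ → ℂ} {L : ℝ} (hL : 0 < L) (hA : ∀ y ∈ Ioo 0 L, AnalyticAt ℝ K y ∧ deriv K y ≠ 0)
    (h0 : EvenEnd K) (h1 : EvenEnd (fun s => K (L - s))) (hinj : InjOn K (Icc 0 L)) :
    ∃ γ : ℝ → ℂ, AnalyticOnNhd ℝ γ (Icc 0 1) ∧ (∀ t ∈ Icc (0:ℝ) 1, deriv γ t ≠ 0) ∧ InjOn γ (Icc 0 1) ∧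
      γ '' Icc 0 1 = K '' Icc 0 L ∧ γ 0 = K 0 ∧ γ 1 = K L := by
  set c := Real.pi / (2 * L) with hc
  have hpi := Real.pi_pos
  have hc0 : 0 < c := by positivity
  have hcL : c * L = Real.pi / 2 := by rw [hc]; field_simp
  set T : ℝ → ℝ := fun y => Real.sin (c * y) ^ 2 with hT
  have hTd : ∀ y, HasDerivAt T (2 * c * (Real.sin (c * y) * Real.cos (c * y))) y := by
    intro y
    have h := ((((hasDerivAt_id y).const_mul c).sin).pow 2)
    refine h.congr_deriv ?_
    simp; ring
  have hTan : ∀ y, AnalyticAt ℝ T y := by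
    intro y
    have : AnalyticAt ℝ (fun y => c * y) y := analyticAt_const.mul analyticAt_id
    exact ((Real.analyticAt_sin).comp this).pow 2
  have hTpos : ∀ y ∈ Ioo 0 L, 0 < deriv T y := by
    intro y hy
    rw [(hTd y).deriv]
    have e1 : 0 < c * y := mul_pos hc0 hy.1
    have e2 : c * y < Real.pi / 2 := by rw [← hcL]; exact mul_lt_mul_of_pos_left hy.2 hc0
    have := Real.sin_pos_of_pos_of_lt_pi e1 (by linarith)
    have := Real.cos_pos_of_mem_Ioo (show c * y ∈ Ioo (-(Real.pi/2)) (Real.pi/2) from ⟨by linarith, e2⟩)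
    positivity
  have hmono : StrictMonoOn T (Icc 0 L) := by
    apply strictMonoOn_of_deriv_pos (convex_Icc _ _) (fun y _ => (hTan y).continuousAt.continuousWithinAt)
    intro y hy; rw [interior_Icc] at hy; exact hTpos y hy
  have hT0 : T 0 = 0 := by simp [hT]
  have hTL : T L = 1 := by simp [hT, hcL]
  have hTe : ∀ s, T (-s) = T s := by intro s; simp [hT]
  have hTr : ∀ s, T (L - s) = 1 - T s := by
    intro s
    simp only [hT]
    rw [show c * (L - s) = Real.pi / 2 - c * s by rw [mul_sub, hcL], Real.sin_pi_div_two_sub, Real.cos_sq']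
  have hT2 : deriv (deriv T) 0 ≠ 0 := by
    have e : deriv T = fun y => 2 * c * (Real.sin (c * y) * Real.cos (c * y)) := funext fun y => (hTd y).deriv
    have hl := (hasDerivAt_id (0:ℝ)).const_mul c
    have := ((hl.sin.mul hl.cos).const_mul (2 * c)).deriv
    rw [e]
    intro h
    have h' := this.symm.trans h
    simp at h'
    exact hc0.ne' h'
  set Y := Function.invFunOn T (Icc 0 L) with hYd
  have hY : ∀ y ∈ Icc 0 L, Y (T y) = y := fun y hy => hmono.injOn.leftInvOn_invFunOn hy
  have hTm : ∀ y ∈ Icc 0 L, T y ∈ Icc 0 1 := by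
    intro y hy
    rw [← hT0, ← hTL]
    exact ⟨hmono.monotoneOn ⟨le_rfl, hL.le⟩ hy hy.1, hmono.monotoneOn hy ⟨hL.le, le_rfl⟩ hy.2⟩
  have hsurj : ∀ t ∈ Icc (0:ℝ) 1, ∃ y ∈ Icc 0 L, T y = t := by
    intro t ht
    rw [← hT0, ← hTL] at ht
    exact intermediate_value_Icc hL.le (fun y _ => (hTan y).continuousAt.continuousWithinAt) ht
  have hTc : ContinuousOn T (Icc 0 L) := fun y _ => (hTan y).continuousAt.continuousWithinAt
  have hTp : ∀ y ∈ Ioc 0 L, 0 < T y := fun y hy => by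
    rw [← hT0]; exact hmono ⟨le_rfl, hL.le⟩ ⟨hy.1.le, hy.2⟩ hy.1
  obtain ⟨G0, g1, g2, g3⟩ := end_repar (Y := Y) h0 (hTan 0) (Eventually.of_forall hTe) hT0 hT2 hL hTc hTp hY
  obtain ⟨G1, k1, k2, k3⟩ := end_repar (Y := fun t => L - Y (1 - t)) h1 (hTan 0) (Eventually.of_forall hTe) hT0 hT2 hL hTc hTp
    (fun y hy => by
      rw [← hTr, hY (L - y) ⟨by linarith [hy.2], by linarith [hy.1]⟩]; ring)
  simp only [sub_sub_cancel] at k3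
  set γ : ℝ → ℂ := fun t => if t < 0 then G0 t else if 1 < t then G1 (1 - t) else K (Y t) with hγ
  have γin : ∀ t ∈ Icc (0:ℝ) 1, γ t = K (Y t) := by
    intro t ht; simp [hγ, ht.1.not_gt, ht.2.not_gt]
  have γT : ∀ y ∈ Icc 0 L, γ (T y) = K y := fun y hy => by rw [γin _ (hTm y hy), hY y hy]
  have ev0 : γ =ᶠ[𝓝 0] G0 := by
    have : ∀ᶠ t in 𝓝 (0:ℝ), 0 ≤ t → K (Y t) = G0 t := eventually_nhdsWithin_iff.1 g3
    filter_upwards [this, isOpen_Iio.mem_nhds (show (0:ℝ) < 1 by norm_num)] with t h1 h2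
    by_cases h : t < 0
    · simp [hγ, h]
    · rw [γin t ⟨not_lt.1 h, le_of_lt h2⟩, h1 (not_lt.1 h)]
  have ev1 : γ =ᶠ[𝓝 1] fun t => G1 (1 - t) := by
    have : ∀ᶠ t in 𝓝 (0:ℝ), 0 ≤ t → K (Y (1 - t)) = G1 t := eventually_nhdsWithin_iff.1 k3
    have tt : Tendsto (fun t : ℝ => 1 - t) (𝓝 1) (𝓝 0) := by
      have : ContinuousAt (fun t : ℝ => 1 - t) 1 := by fun_prop
      simpa [ContinuousAt] using this
    filter_upwards [tt.eventually this, isOpen_Ioi.mem_nhds (show (0:ℝ) < 1 by norm_num)] with t h1 h2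
    have h2' : 0 < t := h2
    by_cases h : 1 < t
    · simp [hγ, h, h2'.not_gt]
    · rw [γin t ⟨h2'.le, not_lt.1 h⟩]
      have := h1 (by linarith)
      rwa [sub_sub_cancel] at this
  have main : ∀ t ∈ Icc (0:ℝ) 1, AnalyticAt ℝ γ t ∧ deriv γ t ≠ 0 := by
    intro t ht
    obtain ⟨y, hy, rfl⟩ := hsurj t ht
    rcases eq_or_lt_of_le hy.1 with h | h
    · rw [← h, hT0]
      exact ⟨g1.congr ev0.symm, by rw [ev0.deriv_eq]; exact g2⟩
    rcases eq_or_lt_of_le hy.2 with h' | h'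
    · rw [h', hTL]
      have hs : AnalyticAt ℝ (fun t : ℝ => 1 - t) 1 := analyticAt_const.sub analyticAt_id
      refine ⟨(k1.comp_of_eq hs (by simp)).congr ev1.symm, ?_⟩
      rw [ev1.deriv_eq]
      have hd : HasDerivAt (fun t : ℝ => 1 - t) (-1) 1 := by simpa using (hasDerivAt_id (1:ℝ)).const_sub 1
      have : HasDerivAt (fun t : ℝ => G1 (1 - t)) ((-1:ℝ) • deriv G1 0) 1 :=
        HasDerivAt.scomp (h := fun t : ℝ => 1 - t) (1:ℝ) (by simpa using k1.differentiableAt.hasDerivAt) hd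
      rw [this.deriv]; simpa using k2
    · have := inner_repar (Y := Y) (hA y ⟨h, h'⟩).1 (hA y ⟨h, h'⟩).2 (hTan y) (hTpos y ⟨h, h'⟩).ne' ⟨h, h'⟩
        (fun z hz => hY z ⟨hz.1.le, hz.2.le⟩)
      have ev : γ =ᶠ[𝓝 (T y)] fun t => K (Y t) := by
        have : T y ∈ Ioo (0:ℝ) 1 := by
          rw [← hT0, ← hTL]
          exact ⟨hmono ⟨le_rfl, hL.le⟩ hy h, hmono hy ⟨hL.le, le_rfl⟩ h'⟩
        filter_upwards [isOpen_Ioo.mem_nhds this] with t ht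
        exact γin t ⟨ht.1.le, ht.2.le⟩
      exact ⟨this.1.congr ev.symm, by rw [ev.deriv_eq]; exact this.2⟩
  refine ⟨γ, fun t ht => (main t ht).1, fun t ht => (main t ht).2, ?_, ?_, ?_, ?_⟩
  · intro t ht t' ht' h
    obtain ⟨y, hy, rfl⟩ := hsurj t ht
    obtain ⟨y', hy', rfl⟩ := hsurj t' ht'
    rw [γT y hy, γT y' hy'] at h
    rw [hinj hy hy' h]
  · ext z; constructor
    · rintro ⟨t, ht, rfl⟩
      obtain ⟨y, hy, rfl⟩ := hsurj t ht
      exact ⟨y, hy, (γT y hy).symm⟩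
    · rintro ⟨y, hy, rfl⟩
      exact ⟨T y, hTm y hy, γT y hy⟩
  · rw [← hT0, γT 0 ⟨le_rfl, hL.le⟩, hT0]
  · rw [← hTL, γT L ⟨hL.le, le_rfl⟩]

theorem glue_infinite {K : ℝ → ℂ} {L : ℝ} (hL : 0 < L) (hA : ∀ y ∈ Ioo 0 L, AnalyticAt ℝ K y ∧ deriv K y ≠ 0)
    (h0 : EvenEnd K) (hinj : InjOn K (Ico 0 L)) (ht : Tendsto (fun s => ‖K s‖) (𝓝[<] L) atTop) :
    ∃ γ : ℝ → ℂ, AnalyticOnNhd ℝ γ (Ici 0) ∧ (∀ t ∈ Ici (0:ℝ), deriv γ t ≠ 0) ∧ InjOn γ (Ici 0) ∧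
      γ '' Ici 0 = K '' Ico 0 L ∧ γ 0 = K 0 ∧ Tendsto (fun t => ‖γ t‖) atTop atTop := by
  set T : ℝ → ℝ := fun s => s ^ 2 / (L ^ 2 - s ^ 2) with hT
  have hden : ∀ y ∈ Ioo (-L) L, 0 < L ^ 2 - y ^ 2 := fun y hy => by nlinarith [hy.1, hy.2]
  have hTd : ∀ y ∈ Ioo (-L) L, HasDerivAt T (2 * L ^ 2 * y / (L ^ 2 - y ^ 2) ^ 2) y := by
    intro y hy
    have h := (hasDerivAt_pow 2 y).div ((hasDerivAt_pow 2 y).const_sub (L ^ 2)) (hden y hy).ne'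
    refine h.congr_deriv ?_
    simp; ring
  have hTan : ∀ y ∈ Ioo (-L) L, AnalyticAt ℝ T y := by
    intro y hy
    exact (analyticAt_id.pow 2).div (analyticAt_const.sub (analyticAt_id.pow 2)) (hden y hy).ne'
  have sub : ∀ y ∈ Ico 0 L, y ∈ Ioo (-L) L := fun y hy => ⟨by linarith [hy.1], hy.2⟩
  have hTpos : ∀ y ∈ Ioo 0 L, 0 < deriv T y := by
    intro y hy
    have hd := hden y (sub y ⟨hy.1.le, hy.2⟩)
    rw [(hTd y (sub y ⟨hy.1.le, hy.2⟩)).deriv]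
    have := hy.1
    positivity
  have hmono : StrictMonoOn T (Ico 0 L) := by
    apply strictMonoOn_of_deriv_pos (convex_Ico _ _) (fun y hy => (hTan y (sub y hy)).continuousAt.continuousWithinAt)
    intro y hy; rw [interior_Ico] at hy; exact hTpos y hy
  have z_mem : (0:ℝ) ∈ Ico 0 L := ⟨le_rfl, hL⟩
  have hT0 : T 0 = 0 := by simp [hT]
  have hTe : ∀ s, T (-s) = T s := by intro s; simp [hT]
  have hT2 : deriv (deriv T) 0 ≠ 0 := by
    have e : deriv T =ᶠ[𝓝 0] fun y => 2 * L ^ 2 * y / (L ^ 2 - y ^ 2) ^ 2 := by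
      filter_upwards [isOpen_Ioo.mem_nhds (sub 0 z_mem)] with y hy using (hTd y hy).deriv
    rw [e.deriv_eq]
    have hd : HasDerivAt (fun y => 2 * L ^ 2 * y / (L ^ 2 - y ^ 2) ^ 2) (2 * L ^ 2 / (L ^ 2) ^ 2) 0 := by
      have := ((hasDerivAt_id (0:ℝ)).const_mul (2 * L ^ 2)).div (((hasDerivAt_pow 2 (0:ℝ)).const_sub (L ^ 2)).pow 2)
        (pow_ne_zero 2 (hden 0 (sub 0 z_mem)).ne')
      refine this.congr_deriv ?_
      simp; field_simp
    rw [hd.deriv]; positivity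
  set Y := Function.invFunOn T (Ico 0 L) with hYd
  have hY : ∀ y ∈ Ico 0 L, Y (T y) = y := fun y hy => hmono.injOn.leftInvOn_invFunOn hy
  have hTm : ∀ y ∈ Ico 0 L, 0 ≤ T y := by
    intro y hy
    rw [← hT0]
    exact hmono.monotoneOn z_mem hy hy.1
  have hsurj : ∀ t ∈ Ici (0:ℝ), ∃ y ∈ Ico 0 L, T y = t := by
    intro t ht
    have ht' : 0 ≤ t := ht
    have h1 : t / (1 + t) < 1 := by rw [div_lt_one (by linarith)]; linarith
    have h2 : 0 ≤ t / (1 + t) := by positivity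
    refine ⟨L * Real.sqrt (t / (1 + t)), ⟨by positivity, ?_⟩, ?_⟩
    · have : Real.sqrt (t / (1 + t)) < 1 := by rw [Real.sqrt_lt' one_pos]; simpa using h1
      nlinarith
    · simp only [hT, mul_pow, Real.sq_sqrt h2]
      have h3 : (1 + t) ≠ 0 := by positivity
      have h4 : L ^ 2 - L ^ 2 * (t / (1 + t)) = L ^ 2 / (1 + t) := by field_simp; ring
      rw [h4]; field_simp
  have hsub : Icc 0 (L / 2) ⊆ Ico 0 L := fun y hy => ⟨hy.1, by linarith [hy.2]⟩
  obtain ⟨G0, g1, g2, g3⟩ := end_repar (Y := Y) (δ := L / 2) h0 (hTan 0 (sub 0 z_mem)) (Eventually.of_forall hTe) hT0 hT2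
    (by linarith) (fun y hy => (hTan y (sub y (hsub hy))).continuousAt.continuousWithinAt)
    (fun y hy => by rw [← hT0]; exact hmono z_mem (hsub ⟨hy.1.le, hy.2⟩) hy.1) (fun y hy => hY y (hsub hy))
  set γ : ℝ → ℂ := fun t => if t < 0 then G0 t else K (Y t) with hγ
  have γin : ∀ t ∈ Ici (0:ℝ), γ t = K (Y t) := by
    intro t ht
    have : ¬ t < 0 := not_lt.2 ht
    simp [hγ, this]
  have γT : ∀ y ∈ Ico 0 L, γ (T y) = K y := fun y hy => by rw [γin _ (hTm y hy), hY y hy]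
  have ev0 : γ =ᶠ[𝓝 0] G0 := by
    have : ∀ᶠ t in 𝓝 (0:ℝ), 0 ≤ t → K (Y t) = G0 t := eventually_nhdsWithin_iff.1 g3
    filter_upwards [this] with t h1
    by_cases h : t < 0
    · simp [hγ, h]
    · rw [γin t (not_lt.1 h), h1 (not_lt.1 h)]
  have main : ∀ t ∈ Ici (0:ℝ), AnalyticAt ℝ γ t ∧ deriv γ t ≠ 0 := by
    intro t ht
    obtain ⟨y, hy, rfl⟩ := hsurj t ht
    rcases eq_or_lt_of_le hy.1 with h | h
    · rw [← h, hT0]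
      exact ⟨g1.congr ev0.symm, by rw [ev0.deriv_eq]; exact g2⟩
    · have := inner_repar (Y := Y) (hA y ⟨h, hy.2⟩).1 (hA y ⟨h, hy.2⟩).2 (hTan y (sub y hy)) (hTpos y ⟨h, hy.2⟩).ne' ⟨h, hy.2⟩
        (fun z hz => hY z ⟨hz.1.le, hz.2⟩)
      have ev : γ =ᶠ[𝓝 (T y)] fun t => K (Y t) := by
        have : T y ∈ Ioi (0:ℝ) := by
          rw [← hT0]
          exact hmono z_mem hy h
        filter_upwards [isOpen_Ioi.mem_nhds this] with t ht
        exact γin t (show (0:ℝ) ≤ t from le_of_lt ht)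
      exact ⟨this.1.congr ev.symm, by rw [ev.deriv_eq]; exact this.2⟩
  refine ⟨γ, fun t ht => (main t ht).1, fun t ht => (main t ht).2, ?_, ?_, ?_, ?_⟩
  · intro t ht t' ht' h
    obtain ⟨y, hy, rfl⟩ := hsurj t ht
    obtain ⟨y', hy', rfl⟩ := hsurj t' ht'
    rw [γT y hy, γT y' hy'] at h
    rw [hinj hy hy' h]
  · ext z; constructor
    · rintro ⟨t, ht, rfl⟩
      obtain ⟨y, hy, rfl⟩ := hsurj t ht
      exact ⟨y, hy, (γT y hy).symm⟩
    · rintro ⟨y, hy, rfl⟩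
      exact ⟨T y, hTm y hy, γT y hy⟩
  · rw [← hT0, γT 0 z_mem, hT0]
  · have hYt : Tendsto Y atTop (𝓝[<] L) := by
      rw [tendsto_nhdsWithin_iff]
      have hmem : ∀ t, 0 ≤ t → Y t ∈ Ico 0 L := by
        intro t ht
        obtain ⟨y, hy, rfl⟩ := hsurj t ht
        rw [hY y hy]; exact hy
      refine ⟨tendsto_order.2 ⟨fun r hr => ?_, fun r hr => ?_⟩, ?_⟩
      · have hm : max r 0 ∈ Ico 0 L := ⟨le_max_right _ _, max_lt hr hL⟩
        filter_upwards [eventually_gt_atTop (T (max r 0)), eventually_ge_atTop (0:ℝ)] with t h1 h2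
        obtain ⟨y, hy, rfl⟩ := hsurj t h2
        rw [hY y hy]
        exact (le_max_left _ _).trans_lt ((hmono.lt_iff_lt hm hy).1 h1)
      · filter_upwards [eventually_ge_atTop (0:ℝ)] with t h2
        exact (hmem t h2).2.trans hr
      · filter_upwards [eventually_ge_atTop (0:ℝ)] with t h2
        exact (hmem t h2).2
    refine (ht.comp hYt).congr' ?_
    filter_upwards [eventually_ge_atTop (0:ℝ)] with t h2
    simp only [Function.comp, γin t h2]


end part17

section part18
open scoped Topology ComplexConjugate ContDiff

namespace WeierstrassData
variable (W : WeierstrassData)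

theorem w2_ne : W.w2 ≠ 0 := fun h0 => W.half2_notMem (h0 ▸ W.zero_mem)

theorem dP_ne {z : ℂ} (hz : z ∉ W.lattice) (h1 : W.P z ≠ W.e1) (h2 : W.P z ≠ W.e2) (h3 : W.P z ≠ W.e3) :
    W.dP z ≠ 0 := by
  intro h
  have := W.dP_sq hz
  rw [h] at this
  have h4 : 4 * (W.P z - W.e1) * (W.P z - W.e2) * (W.P z - W.e3) ≠ 0 :=
    mul_ne_zero (mul_ne_zero (mul_ne_zero (by norm_num) (sub_ne_zero.2 h1)) (sub_ne_zero.2 h2)) (sub_ne_zero.2 h3)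
  exact h4 (by rw [← this]; simp)

theorem ddP_ne {c : ℂ} (hc : c ∉ W.lattice) (h2 : 2 * c ∈ W.lattice) : deriv W.dP c ≠ 0 := by
  have hd0 := W.dP_half hc h2
  have hsq := W.dP_sq hc
  rw [hd0] at hsq
  have hPc := (W.P_hasDerivAt hc).continuousAt
  have hev : ∀ᶠ z in 𝓝 c, z ∉ W.lattice := W.isOpen_compl.mem_nhds hc
  -- near `c`, `P z = P c` only at `c`
  have hne : ∀ᶠ z in 𝓝[≠] c, W.P z ≠ W.P c := by
    have t : Tendsto (fun z => z - c) (𝓝[≠] c) (𝓝[≠] 0) := by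
      rw [tendsto_nhdsWithin_iff]
      constructor
      · have : ContinuousAt (fun z => z - c) c := by fun_prop
        have h := this.tendsto
        rw [sub_self] at h
        exact h.mono_left nhdsWithin_le_nhds
      · filter_upwards [self_mem_nhdsWithin] with z hz
        exact sub_ne_zero.2 hz
    filter_upwards [t.eventually (W.eventually_notMem 0), nhdsWithin_le_nhds hev] with z z1 z2 h
    rcases W.P_inj z2 hc h with h' | h'
    · apply z1
      have := W.sub_mem h' h2
      rwa [show z + c - 2 * c = z - c by ring] at this
    · exact z1 h'
  have hdz : ∀ᶠ z in 𝓝[≠] c, W.dP z ≠ 0 := by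
    have hc1 : ∀ e, W.P c ≠ e → ∀ᶠ z in 𝓝[≠] c, W.P z ≠ e := fun e he =>
      nhdsWithin_le_nhds (hPc.eventually_ne he)
    have hany : ∀ e, ∀ᶠ z in 𝓝[≠] c, W.P z ≠ e := by
      intro e
      by_cases he : W.P c = e
      · rw [← he]; exact hne
      · exact hc1 e he
    filter_upwards [hany W.e1, hany W.e2, hany W.e3, nhdsWithin_le_nhds hev] with z a b c d
    exact W.dP_ne d a b c
  set R : ℂ → ℂ := fun z => 2 * ((W.P z - W.e2) * (W.P z - W.e3) + (W.P z - W.e1) * (W.P z - W.e3) +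
    (W.P z - W.e1) * (W.P z - W.e2)) with hR
  have heq : ∀ᶠ z in 𝓝[≠] c, deriv W.dP z = R z := by
    filter_upwards [hdz, nhdsWithin_le_nhds (eventually_eventually_nhds.2 hev)] with z z1 z2
    have hz := z2.self_of_nhds
    have e : (fun z => W.dP z ^ 2) =ᶠ[𝓝 z] fun z => 4 * (W.P z - W.e1) * (W.P z - W.e2) * (W.P z - W.e3) := by
      filter_upwards [z2] with t ht using W.dP_sq ht
    have d1 := (W.dP_analyticAt hz).differentiableAt.hasDerivAt.pow 2
    have hP := W.P_hasDerivAt hz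
    have d2 := (((hP.sub_const W.e1).const_mul 4).mul (hP.sub_const W.e2)).mul (hP.sub_const W.e3)
    have := d1.unique (d2.congr_of_eventuallyEq e)
    simp at this
    apply mul_left_cancel₀ z1
    rw [hR]
    linear_combination this / 2
  have c1 : ContinuousAt (deriv W.dP) c := (W.dP_analyticAt hc).deriv.continuousAt
  have c2 : ContinuousAt R c := by rw [hR]; fun_prop
  have t1 : Tendsto (deriv W.dP) (𝓝[≠] c) (𝓝 (deriv W.dP c)) := c1.tendsto.mono_left nhdsWithin_le_nhds
  have t2 : Tendsto R (𝓝[≠] c) (𝓝 (R c)) := c2.tendsto.mono_left nhdsWithin_le_nhds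
  have hval := tendsto_nhds_unique (t1.congr' heq) t2
  rw [hval, hR]
  have n12 := sub_ne_zero.2 W.e1_ne_e2
  have n13 := sub_ne_zero.2 W.e1_ne_e3
  have n23 := sub_ne_zero.2 W.e2_ne_e3
  have n21 := sub_ne_zero.2 W.e1_ne_e2.symm
  have n31 := sub_ne_zero.2 W.e1_ne_e3.symm
  have n32 := sub_ne_zero.2 W.e2_ne_e3.symm
  have hprod : (W.P c - W.e1) * (W.P c - W.e2) * (W.P c - W.e3) = 0 := by
    linear_combination -hsq / 4
  rcases mul_eq_zero.1 hprod with h | h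
  · rcases mul_eq_zero.1 h with h | h
    · have := sub_eq_zero.1 h
      simp [this, n12, n13]
    · have := sub_eq_zero.1 h
      simp [this, n21, n23]
  · have := sub_eq_zero.1 h
    simp [this, n31, n32]

/-- the spectral parameter -/
def Lam (k : ℂ) : ℂ := -W.w2 ^ 2 * W.P k

variable {W}
theorem Lam_hasDerivAt {k : ℂ} (hk : k ∉ W.lattice) : HasDerivAt W.Lam (-W.w2 ^ 2 * W.dP k) k :=
  (W.P_hasDerivAt hk).const_mul _
theorem Lam_analyticAt {k : ℂ} (hk : k ∉ W.lattice) : AnalyticAt ℂ W.Lam k :=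
  analyticAt_const.mul (W.P_analyticAt hk)
theorem Lam_inj {k k' : ℂ} (h : W.Lam k = W.Lam k') : W.P k = W.P k' :=
  mul_left_cancel₀ (neg_ne_zero.2 (pow_ne_zero 2 W.w2_ne)) h

theorem curve_analytic {X : ℝ → ℝ} {y : ℝ} (hX : AnalyticAt ℝ X y) :
    AnalyticAt ℝ (fun y => pt (X y) y) y :=
  ((ofRealCLM.analyticAt _).comp hX).add (((ofRealCLM.analyticAt _)).mul analyticAt_const)

theorem ofReal_add_I_ne (c : ℝ) : (c : ℂ) + I ≠ 0 := fun h => by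
  have := congrArg Complex.im h
  simp at this

theorem inner_curve {X : ℝ → ℝ} {y : ℝ} (hX : AnalyticAt ℝ X y) (hk : pt (X y) y ∉ W.lattice)
    (hd : W.dP (pt (X y) y) ≠ 0) :
    AnalyticAt ℝ (fun y => W.Lam (pt (X y) y)) y ∧ deriv (fun y => W.Lam (pt (X y) y)) y ≠ 0 := by
  refine ⟨((Lam_analyticAt hk).restrictScalars (𝕜 := ℝ)).comp_of_eq (curve_analytic hX) rfl, ?_⟩
  rw [(curve_deriv hX.differentiableAt.hasDerivAt (Lam_hasDerivAt hk)).deriv]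
  exact mul_ne_zero (mul_ne_zero (neg_ne_zero.2 (pow_ne_zero 2 W.w2_ne)) hd) (ofReal_add_I_ne _)

theorem corner_even {x0 y0 : ℝ} {ξ : ℝ → ℝ} (h : W.CornerArc x0 y0 ξ) (h2 : 2 * pt x0 y0 ∈ W.lattice) :
    AnalyticAt ℝ (fun s => W.Lam (pt (ξ (y0 + s)) (y0 + s))) 0 ∧
    (∀ᶠ s in 𝓝 (0:ℝ), W.Lam (pt (ξ (y0 + -s)) (y0 + -s)) = W.Lam (pt (ξ (y0 + s)) (y0 + s))) ∧
    deriv (deriv (fun s => W.Lam (pt (ξ (y0 + s)) (y0 + s)))) 0 ≠ 0 := by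
  set k : ℝ → ℂ := fun s => pt (ξ (y0 + s)) (y0 + s) with hk
  have hs : AnalyticAt ℝ (fun s : ℝ => y0 + s) 0 := analyticAt_const.add analyticAt_id
  have k_an : AnalyticAt ℝ k 0 :=
    AnalyticAt.comp_of_eq (g := fun y => pt (ξ y) y) (curve_analytic h.an) hs (by simp)
  have k0 : k 0 = pt x0 y0 := by simp [hk, h.val]
  have kd : HasDerivAt k (deriv ξ y0 + I) 0 := by
    have h1 : HasDerivAt (fun s : ℝ => y0 + s) 1 0 := by simpa using (hasDerivAt_id (0:ℝ)).const_add y0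
    have h3 := hasDerivAt_curve h.an.differentiableAt.hasDerivAt
    have h3' : HasDerivAt (fun y => pt (ξ y) y) (deriv ξ y0 + I) (y0 + 0) := by simpa using h3
    have := HasDerivAt.scomp (h := fun s : ℝ => y0 + s) (0:ℝ) h3' h1
    exact this.congr_deriv (by simp)
  have hnm : ∀ᶠ s in 𝓝 0, k s ∉ W.lattice :=
    k_an.continuousAt.eventually_mem (W.isOpen_compl.mem_nhds (by rw [k0]; exact h.notMem))
  refine ⟨?_, ?_, ?_⟩
  · exact ((Lam_analyticAt h.notMem).restrictScalars (𝕜 := ℝ)).comp_of_eq k_an k0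
  · filter_upwards [hnm, h.odd] with s s1 s2
    have := (h.sym _ s1).2.1
    have e : 2 * pt x0 y0 - k s = pt (ξ (y0 + -s)) (y0 + -s) := by
      rw [← sub_eq_add_neg, s2]
      exact Complex.ext (by simp [hk]) (by simp [hk]; ring)
    rw [e] at this
    rw [Lam, this]; rfl
  · have e : deriv (fun s => W.Lam (k s)) =ᶠ[𝓝 0] fun s => -W.w2 ^ 2 * W.dP (k s) * deriv k s := by
      filter_upwards [hnm, k_an.eventually_analyticAt] with s s1 s2
      exact ((Lam_hasDerivAt s1).comp_of_eq s s2.differentiableAt.hasDerivAt rfl).deriv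
    rw [e.deriv_eq]
    have d1 : HasDerivAt (fun s => W.dP (k s)) (deriv W.dP (pt x0 y0) * (deriv ξ y0 + I)) 0 :=
      (W.dP_analyticAt h.notMem).differentiableAt.hasDerivAt.comp_of_eq (0:ℝ) kd k0.symm
    have d2 := ((d1.const_mul (-W.w2 ^ 2)).mul k_an.deriv.differentiableAt.hasDerivAt).deriv
    intro hc
    have h0 := d2.symm.trans hc
    rw [k0, W.dP_half h.notMem h2, kd.deriv] at h0
    simp only [mul_zero, zero_mul, add_zero] at h0
    exact mul_ne_zero (mul_ne_zero (neg_ne_zero.2 (pow_ne_zero 2 W.w2_ne))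
      (mul_ne_zero (W.ddP_ne h.notMem h2) (ofReal_add_I_ne _))) (ofReal_add_I_ne _) h0

theorem even_end_left {x0 y0 : ℝ} {ξ X : ℝ → ℝ} (h : W.CornerArc x0 y0 ξ) (h2 : 2 * pt x0 y0 ∈ W.lattice)
    (hX0 : X y0 = x0) (hX : ∀ᶠ y in 𝓝[>] y0, X y = ξ y) :
    EvenEnd (fun s => W.Lam (pt (X (y0 + s)) (y0 + s))) := by
  obtain ⟨a1, a2, a3⟩ := corner_even h h2
  refine ⟨_, a1, a2, a3, ?_⟩
  have t : Tendsto (fun s : ℝ => y0 + s) (𝓝 0) (𝓝 y0) := by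
    have : ContinuousAt (fun s : ℝ => y0 + s) 0 := by fun_prop
    simpa [ContinuousAt] using this
  have h1 : ∀ᶠ y in 𝓝 y0, y0 < y → X y = ξ y := eventually_nhdsWithin_iff.1 hX
  filter_upwards [nhdsWithin_le_nhds (t.eventually h1), self_mem_nhdsWithin] with s s1 s2
  rcases eq_or_lt_of_le (show 0 ≤ s from s2) with e | e
  · rw [← e]; simp [hX0, h.val]
  · rw [s1 (by linarith)]

theorem even_end_right {x0 y0 : ℝ} {ξ X : ℝ → ℝ} (h : W.CornerArc x0 y0 ξ) (h2 : 2 * pt x0 y0 ∈ W.lattice)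
    (hX0 : X y0 = x0) (hX : ∀ᶠ y in 𝓝[<] y0, X y = ξ y) :
    EvenEnd (fun s => W.Lam (pt (X (y0 - s)) (y0 - s))) := by
  obtain ⟨a1, a2, a3⟩ := corner_even h h2
  refine ⟨_, a1, a2, a3, ?_⟩
  have t : Tendsto (fun s : ℝ => y0 - s) (𝓝 0) (𝓝 y0) := by
    have : ContinuousAt (fun s : ℝ => y0 - s) 0 := by fun_prop
    simpa [ContinuousAt] using this
  have h1 : ∀ᶠ y in 𝓝 y0, y < y0 → X y = ξ y := eventually_nhdsWithin_iff.1 hX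
  filter_upwards [nhdsWithin_le_nhds (t.eventually h1), self_mem_nhdsWithin, nhdsWithin_le_nhds a2] with s s1 s2 s3
  rw [← s3, ← sub_eq_add_neg]
  rcases eq_or_lt_of_le (show 0 ≤ s from s2) with e | e
  · rw [← e]; simp [hX0, h.val]
  · rw [s1 (by linarith)]

theorem Lam_tendsto {X : ℝ → ℝ} (hX : Tendsto X (𝓝[>] 0) (𝓝 0)) :
    Tendsto (fun y => ‖W.Lam (pt (X y) y)‖) (𝓝[>] 0) atTop := by
  have t0 : Tendsto (fun y => pt (X y) y) (𝓝[>] 0) (𝓝[≠] 0) := by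
    rw [tendsto_nhdsWithin_iff]
    constructor
    · have h1 : Tendsto (fun y : ℝ => ((X y : ℝ) : ℂ)) (𝓝[>] 0) (𝓝 ((0:ℝ):ℂ)) := (continuous_ofReal.tendsto 0).comp hX
      have h2 : Tendsto (fun y : ℝ => ((y : ℝ) : ℂ)) (𝓝[>] 0) (𝓝 ((0:ℝ):ℂ)) :=
        (continuous_ofReal.tendsto 0).mono_left nhdsWithin_le_nhds
      have := h1.add (h2.mul_const I)
      simpa [pt] using this
    · filter_upwards [self_mem_nhdsWithin] with y hy h
      have := congrArg Complex.im h
      simp at this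
      exact (ne_of_gt hy) this
  have t1 : Tendsto (fun z : ℂ => ‖W.P z‖) (𝓝[≠] 0) atTop := by
    have i1 : Tendsto (fun z : ℂ => ‖z⁻¹‖ ^ 2) (𝓝[≠] 0) atTop :=
      (tendsto_pow_atTop two_ne_zero).comp (tendsto_norm_cobounded_atTop.comp tendsto_inv₀_nhdsNE_zero)
    have i2 : Tendsto (fun z : ℂ => ‖z⁻¹‖ ^ 2 + -1) (𝓝[≠] 0) atTop := tendsto_atTop_add_const_right _ _ i1
    obtain ⟨δ, hδ, hp⟩ := W.pole_bound
    refine tendsto_atTop_mono' _ ?_ i2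
    filter_upwards [self_mem_nhdsWithin, nhdsWithin_le_nhds (Metric.ball_mem_nhds (0:ℂ) hδ)] with z z1 z2
    have h := hp z z1 (by simpa using z2)
    have e : ‖z⁻¹‖ ^ 2 = ‖1 / z ^ 2‖ := by simp
    rw [e]
    have := norm_sub_norm_le (1 / z ^ 2) (W.P z)
    rw [norm_sub_rev] at this
    linarith
  have t2 := (t1.comp t0).const_mul_atTop (r := ‖-W.w2 ^ 2‖) (norm_pos_iff.2 (neg_ne_zero.2 (pow_ne_zero 2 W.w2_ne)))
  refine t2.congr fun y => ?_
  simp only [Function.comp, Lam, norm_mul]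

end WeierstrassData

end part18

section part19
open scoped Topology ComplexConjugate ContDiff


/-- the conclusion of the theorem for a spectrum `S`, endpoint set `E` and set of closed gaps `G` -/
def ArcConcl (S E G : Set ℂ) : Prop := ∃ γf γi : ℝ → ℂ,
      AnalyticOnNhd ℝ γf (Set.Icc 0 1) ∧ (∀ t ∈ Set.Icc (0:ℝ) 1, deriv γf t ≠ 0) ∧
        Set.InjOn γf (Set.Icc 0 1) ∧
      AnalyticOnNhd ℝ γi (Set.Ici 0) ∧ (∀ t ∈ Set.Ici (0:ℝ), deriv γi t ≠ 0) ∧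
        Set.InjOn γi (Set.Ici 0) ∧
      S = γf '' Set.Icc 0 1 ∪ γi '' Set.Ici 0 ∧
      Filter.Tendsto (fun t => ‖γi t‖) Filter.atTop Filter.atTop ∧
      Bornology.IsBounded (γf '' Set.Icc 0 1) ∧
      ({γf 0, γf 1, γi 0} : Set ℂ) = E ∧
      (∀ lam ∈ G, lam ∈ γi '' Set.Ici 0)

namespace WeierstrassData

variable (W : WeierstrassData)

/-- the spectrum, as the image of the zero set of `u` -/
def SSet : Set ℂ := {lam | ∃ k ∉ W.lattice, (W.fF k).re = 0 ∧ lam = W.Lam k}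
/-- the endpoints of the arcs -/
def ESet : Set ℂ := {-W.w2 ^ 2 * W.e1, -W.w2 ^ 2 * W.e2, -W.w2 ^ 2 * W.e3}
/-- the closed gaps -/
def GSet : Set ℂ := {lam | (∃ k ∉ W.lattice, (W.fF k).re = 0 ∧ (∃ p : ℤ, (W.fF k).im = p * Real.pi / 2) ∧
  lam = W.Lam k) ∧ lam ∉ W.ESet}

section rect
variable {W} (hR : W.Rect)
include hR

theorem Lam_corner1 : W.Lam (pt (-W.a) 0) = -W.w2 ^ 2 * W.e1 := by rw [Lam, P_corner1 hR, e1_eq hR]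
theorem Lam_corner2 : W.Lam (pt (-W.a) W.b) = -W.w2 ^ 2 * W.e2 := by rw [Lam, P_corner2 hR, e2_eq hR]
theorem Lam_corner3 : W.Lam (pt 0 W.b) = -W.w2 ^ 2 * W.e3 := by rw [Lam, P_corner3 hR, e3_eq hR]

theorem int_dP_ne {x y : ℝ} (hx : x ∈ Ioo (-W.a) 0) (hy : y ∈ Ioo 0 W.b) : W.dP (pt x y) ≠ 0 := by
  have him := imP_ne hR hx hy
  refine W.dP_ne (int_notMem hR hx hy) ?_ ?_ ?_
  · rw [e1_eq hR]; intro h; rw [h] at him; simp at him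
  · rw [e2_eq hR]; intro h; rw [h] at him; simp at him
  · rw [e3_eq hR]; intro h; rw [h] at him; simp at him

theorem assemble {Xf Xi : ℝ → ℝ} {xf xi : ℝ} (A : W.ArcData Xf Xi xf xi) :
    ArcConcl W.SSet W.ESet W.GSet := by
  have ha := a_pos hR
  have hb := b_pos hR
  set Yf : ℝ → ℝ := fun y => if y = 0 then -W.a else if y = W.b then xf else Xf y with hYf
  set Yi : ℝ → ℝ := fun y => if y = W.b then xi else Xi y with hYi
  have Yf0 : Yf 0 = -W.a := by simp [hYf]
  have Yfb : Yf W.b = xf := by simp [hYf, hb.ne']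
  have Yib : Yi W.b = xi := by simp [hYi]
  have Yfi : ∀ y ∈ Ioo 0 W.b, Yf y = Xf y := fun y hy => by simp [hYf, hy.1.ne', hy.2.ne]
  have Yii : ∀ y ∈ Ioo 0 W.b, Yi y = Xi y := fun y hy => by simp [hYi, hy.2.ne]
  have xf_mem : xf ∈ Icc (-W.a) 0 := by
    rcases A.ends with h | h <;> rw [h.1]
    exacts [ma_mem hR, z_mem_a hR]
  have xi_mem : xi ∈ Icc (-W.a) 0 := by
    rcases A.ends with h | h <;> rw [h.2]
    exacts [z_mem_a hR, ma_mem hR]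
  have Yf_mem : ∀ y ∈ Icc 0 W.b, Yf y ∈ Icc (-W.a) 0 ∧ (Yf y ≠ 0 ∨ y ≠ 0) := by
    intro y hy
    rcases hy.1.eq_or_lt with h | h
    · rw [← h, Yf0]; exact ⟨ma_mem hR, Or.inl (ma_ne hR)⟩
    · refine ⟨?_, Or.inr h.ne'⟩
      rcases hy.2.eq_or_lt with h' | h'
      · rw [h', Yfb]; exact xf_mem
      · rw [Yfi y ⟨h, h'⟩]; exact Ioo_subset_Icc_self (A.f_mem y ⟨h, h'⟩)
  have Yi_mem : ∀ y ∈ Ioc 0 W.b, Yi y ∈ Icc (-W.a) 0 ∧ (Yi y ≠ 0 ∨ y ≠ 0) := by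
    intro y hy
    refine ⟨?_, Or.inr hy.1.ne'⟩
    rcases hy.2.eq_or_lt with h' | h'
    · rw [h', Yib]; exact xi_mem
    · rw [Yii y ⟨hy.1, h'⟩]; exact Ioo_subset_Icc_self (A.i_mem y ⟨hy.1, h'⟩)
  have d2 : 2 * pt (-W.a) 0 ∈ W.lattice := (mem_iff hR).2 ⟨-1, 0, by simp, by simp⟩
  have d3 : 2 * pt (-W.a) W.b ∈ W.lattice := (mem_iff hR).2 ⟨-1, 1, by simp, by simp⟩
  have d4 : 2 * pt 0 W.b ∈ W.lattice := (mem_iff hR).2 ⟨0, 1, by simp, by simp⟩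
  have df : 2 * pt xf W.b ∈ W.lattice := by
    rcases A.ends with h | h <;> rw [h.1] <;> assumption
  have di : 2 * pt xi W.b ∈ W.lattice := by
    rcases A.ends with h | h <;> rw [h.2] <;> assumption
  have hev : ∀ y ∈ Ioo 0 W.b, ∀ᶠ z in 𝓝 y, z ∈ Ioo 0 W.b := fun y hy => isOpen_Ioo.mem_nhds hy
  have ev0 : ∀ᶠ y in 𝓝[>] (0:ℝ), y ∈ Ioo 0 W.b := Ioo_mem_nhdsGT hb
  have evb : ∀ᶠ y in 𝓝[<] W.b, y ∈ Ioo 0 W.b := Ioo_mem_nhdsLT hb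
  have inner : ∀ (X Y : ℝ → ℝ), (∀ y ∈ Ioo 0 W.b, AnalyticAt ℝ X y) → (∀ y ∈ Ioo 0 W.b, X y ∈ Ioo (-W.a) 0) →
      (∀ y ∈ Ioo 0 W.b, Y y = X y) → ∀ y ∈ Ioo 0 W.b,
      AnalyticAt ℝ (fun y => W.Lam (pt (Y y) y)) y ∧ deriv (fun y => W.Lam (pt (Y y) y)) y ≠ 0 := by
    intro X Y h1 h2 h3 y hy
    have := inner_curve (h1 y hy) (int_notMem hR (h2 y hy) hy) (int_dP_ne hR (h2 y hy) hy)
    have e : (fun y => W.Lam (pt (X y) y)) =ᶠ[𝓝 y] fun y => W.Lam (pt (Y y) y) :=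
      (hev y hy).mono fun z hz => by simp only [h3 z hz]
    exact ⟨this.1.congr e, by rw [← e.deriv_eq]; exact this.2⟩
  -- the finite arc
  obtain ⟨γf, f1, f2, f3, f4, f5, f6⟩ := glue_finite (K := fun y => W.Lam (pt (Yf y) y)) hb
    (inner Xf Yf A.f_an A.f_mem Yfi)
    (by
      obtain ⟨ξ, c, hc⟩ := A.f_left
      have := even_end_left (X := Yf) c d2 Yf0 (by
        filter_upwards [hc, ev0] with y h1 h2
        rw [Yfi y h2, h1])
      simpa only [zero_add] using this)
    (by
      obtain ⟨ξ, c, hc⟩ := A.f_right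
      exact even_end_right (X := Yf) c df Yfb (by
        filter_upwards [hc, evb] with y h1 h2
        rw [Yfi y h2, h1]))
    (by
      intro y hy y' hy' h
      obtain ⟨m1, m2⟩ := Yf_mem y hy
      obtain ⟨m1', m2'⟩ := Yf_mem y' hy'
      exact (P_inj_rect hR m1 hy m2 m1' hy' m2' (Lam_inj h)).2)
  obtain ⟨γi, i1, i2, i3, i4, i5, i6⟩ := glue_infinite (K := fun s => W.Lam (pt (Yi (W.b - s)) (W.b - s))) hb
    (by
      intro s hs
      have hy : W.b - s ∈ Ioo 0 W.b := ⟨by linarith [hs.2], by linarith [hs.1]⟩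
      obtain ⟨q1, q2⟩ := inner Xi Yi A.i_an A.i_mem Yii _ hy
      constructor
      · exact AnalyticAt.comp_of_eq (f := fun s : ℝ => W.b - s) q1 (analyticAt_const.sub analyticAt_id) rfl
      · rw [deriv_comp_const_sub (f := fun y => W.Lam (pt (Yi y) y))]
        exact neg_ne_zero.2 q2)
    (by
      obtain ⟨ξ, c, hc⟩ := A.i_right
      exact even_end_right (X := Yi) c di Yib (by
        filter_upwards [hc, evb] with y h1 h2
        rw [Yii y h2, h1]))
    (by
      intro y hy y' hy' h
      have h1 : W.b - y ∈ Ioc 0 W.b := ⟨by linarith [hy.2], by linarith [hy.1]⟩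
      have h1' : W.b - y' ∈ Ioc 0 W.b := ⟨by linarith [hy'.2], by linarith [hy'.1]⟩
      obtain ⟨m1, m2⟩ := Yi_mem _ h1
      obtain ⟨m1', m2'⟩ := Yi_mem _ h1'
      have := (P_inj_rect hR m1 (Ioc_subset_Icc_self h1) m2 m1' (Ioc_subset_Icc_self h1') m2' (Lam_inj h)).2
      linarith)
    (by
      have t : Tendsto (fun s : ℝ => W.b - s) (𝓝[<] W.b) (𝓝[>] 0) := by
        rw [tendsto_nhdsWithin_iff]
        constructor
        · have : ContinuousAt (fun s : ℝ => W.b - s) W.b := by fun_prop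
          have := this.tendsto
          rw [sub_self] at this
          exact this.mono_left nhdsWithin_le_nhds
        · filter_upwards [self_mem_nhdsWithin] with s hs
          exact sub_pos.2 (mem_Iio.1 hs)
      have hX : Tendsto Yi (𝓝[>] 0) (𝓝 0) := A.i_left.congr' (by
        filter_upwards [ev0] with y hy
        exact (Yii y hy).symm)
      exact (Lam_tendsto hX).comp t)
  simp only [Yf0] at f5
  simp only [Yfb] at f6
  simp only [sub_zero, Yib] at i5
  have hends : ({γf 0, γf 1, γi 0} : Set ℂ) = W.ESet := by
    rw [f5, f6, i5, ESet, Lam_corner1 hR]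
    rcases A.ends with h | h
    · rw [h.1, h.2, Lam_corner2 hR, Lam_corner3 hR]
    · rw [h.1, h.2, Lam_corner2 hR, Lam_corner3 hR]
      rw [Set.pair_comm]
  -- interior points
  have int_f : ∀ y ∈ Ioo 0 W.b, W.Lam (pt (Xf y) y) ∈ γf '' Icc 0 1 := by
    intro y hy
    rw [f4]
    exact ⟨y, Ioo_subset_Icc_self hy, by simp only [Yfi y hy]⟩
  have int_i : ∀ y ∈ Ioo 0 W.b, W.Lam (pt (Xi y) y) ∈ γi '' Ici 0 := by
    intro y hy
    rw [i4]
    exact ⟨W.b - y, ⟨by linarith [hy.2], by linarith [hy.1]⟩, by simp only [sub_sub_cancel, Yii y hy]⟩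
  have corner_mem : ∀ lam ∈ W.ESet, lam ∈ γf '' Icc 0 1 ∪ γi '' Ici 0 := by
    intro lam h
    rw [← hends] at h
    rcases h with h | h | h
    · exact Or.inl ⟨0, by simp, h.symm⟩
    · exact Or.inl ⟨1, by simp, h.symm⟩
    · exact Or.inr ⟨0, by simp, h.symm⟩
  have U_f : ∀ y ∈ Icc 0 W.b, W.U (Yf y) y = 0 := by
    intro y hy
    rcases hy.1.eq_or_lt with h | h
    · rw [← h, Yf0]; exact U_corner1 hR
    · rcases hy.2.eq_or_lt with h' | h'
      · rw [h', Yfb]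
        rcases A.ends with h | h <;> rw [h.1]
        exacts [U_corner2 hR, U_corner3 hR]
      · rw [Yfi y ⟨h, h'⟩]; exact A.f_zero y ⟨h, h'⟩
  have U_i : ∀ y ∈ Ioc 0 W.b, W.U (Yi y) y = 0 := by
    intro y hy
    rcases hy.2.eq_or_lt with h' | h'
    · rw [h', Yib]
      rcases A.ends with h | h <;> rw [h.2]
      exacts [U_corner3 hR, U_corner2 hR]
    · rw [Yii y ⟨hy.1, h'⟩]; exact A.i_zero y ⟨hy.1, h'⟩
  have corner_E : ∀ x y, (x = -W.a ∧ y = 0) ∨ (x = -W.a ∧ y = W.b) ∨ (x = 0 ∧ y = W.b) →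
      W.Lam (pt x y) ∈ W.ESet := by
    rintro x y (⟨rfl, rfl⟩ | ⟨rfl, rfl⟩ | ⟨rfl, rfl⟩)
    · rw [Lam_corner1 hR]; simp [ESet]
    · rw [Lam_corner2 hR]; simp [ESet]
    · rw [Lam_corner3 hR]; simp [ESet]
  refine ⟨γf, γi, f1, f2, f3, i1, i2, i3, ?_, i6, ?_, hends, ?_⟩
  · apply Set.Subset.antisymm
    · rintro lam ⟨k, hk, hu, rfl⟩
      obtain ⟨x, y, hE, h⟩ := reduce hR hk hu
      have hu' := hE.re_zero hu
      have eL : W.Lam k = W.Lam (pt x y) := by rw [Lam, Lam, hE.2.1]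
      rw [eL]
      rcases h with ⟨hx, hy⟩ | h
      · rcases A.cases x y hx hy hu' with e | e
        · rw [e]; exact Or.inl (int_f y hy)
        · rw [e]; exact Or.inr (int_i y hy)
      · exact corner_mem _ (corner_E x y h)
    · rw [f4, i4]
      rintro lam (⟨y, hy, rfl⟩ | ⟨s, hs, rfl⟩)
      · exact ⟨_, pt_notMem' hR (Yf_mem y hy).1 hy (Yf_mem y hy).2, U_f y hy, rfl⟩
      · have h1 : W.b - s ∈ Ioc 0 W.b := ⟨by linarith [hs.2], by linarith [hs.1]⟩
        exact ⟨_, pt_notMem' hR (Yi_mem _ h1).1 (Ioc_subset_Icc_self h1) (Yi_mem _ h1).2, U_i _ h1, rfl⟩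
  · exact (isCompact_Icc.image_of_continuousOn f1.continuousOn).isBounded
  · rintro lam ⟨⟨k, hk, hu, hv, rfl⟩, hn⟩
    obtain ⟨x, y, hE, h⟩ := reduce hR hk hu
    have hu' := hE.re_zero hu
    have eL : W.Lam k = W.Lam (pt x y) := by rw [Lam, Lam, hE.2.1]
    rw [eL] at hn ⊢
    rcases h with ⟨hx, hy⟩ | h
    · rcases A.cases x y hx hy hu' with e | e
      · exfalso
        obtain ⟨p, hp⟩ := hE.im_half hv
        have hV := A.v_bd y hy
        rw [← e] at hV
        have hp' : W.V x y = p * Real.pi / 2 := hp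
        rw [hp'] at hV
        have hpi := Real.pi_pos
        have h1 : (1:ℝ) < p := by
          by_contra hc
          push Not at hc
          nlinarith [hV.1]
        have h2 : (p:ℝ) < 2 := by
          by_contra hc
          push Not at hc
          nlinarith [hV.2]
        have h1' : (1:ℤ) < p := by exact_mod_cast h1
        have h2' : p < (2:ℤ) := by exact_mod_cast h2
        omega
      · rw [e]; exact int_i y hy
    · exact absurd (corner_E x y h) hn

theorem concl_pos {xc yc : ℝ} (hxc : xc ∈ Ioo (-W.a) 0) (hyc : yc ∈ Ioo 0 W.b) (hc : W.F1 (pt xc yc) = 0)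
    (hU : 0 ≤ W.U xc yc) : ArcConcl W.SSet W.ESet W.GSet := by
  obtain ⟨Xf, Xi, xf, xi, A⟩ := arcs hR hxc hyc hc hU
  exact assemble hR A

end rect
end WeierstrassData

end part19

section part20
open scoped Topology ComplexConjugate ContDiff


/-- the reflection `k ↦ i k̄` -/
def tau (k : ℂ) : ℂ := I * conj k

theorem tau_tau (k : ℂ) : tau (tau k) = k := by
  simp only [tau, map_mul, conj_I, conj_conj]
  linear_combination (-k) * I_mul_I
theorem tau_add (k l : ℂ) : tau (k + l) = tau k + tau l := by simp [tau, mul_add]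
theorem tau_neg (k : ℂ) : tau (-k) = -tau k := by simp [tau]
theorem tau_pt (x y : ℝ) : tau (pt x y) = pt y x := Complex.ext (by simp [tau]) (by simp [tau])
theorem conj_tau (k : ℂ) : conj (tau k) = -I * k := by simp [tau]

theorem tau_tendsto : Tendsto tau (𝓝[≠] 0) (𝓝[≠] 0) := by
  rw [tendsto_nhdsWithin_iff]
  constructor
  · have : ContinuousAt tau 0 := (continuous_const.mul continuous_conj).continuousAt
    have := this.tendsto
    rw [show tau 0 = 0 by simp [tau]] at this
    exact this.mono_left nhdsWithin_le_nhds
  · filter_upwards [self_mem_nhdsWithin] with z hz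
    intro h
    apply hz
    rw [mem_singleton_iff, ← tau_tau z, mem_singleton_iff.1 h]; simp [tau]

theorem hasDerivAt_refl {f : ℂ → ℂ} {f' z : ℂ} (h : HasDerivAt f f' (tau z)) :
    HasDerivAt (fun z => conj (f (tau z))) (-I * conj f') z := by
  have h1 : HasDerivAt (fun w => I * w) I (conj z) := by
    simpa using (hasDerivAt_id (conj z)).const_mul I
  have h2 : HasDerivAt (fun w => f (I * w)) (f' * I) (conj z) := HasDerivAt.comp_of_eq (conj z) h h1 rfl
  have h3 := h2.conj_conj
  simp only [conj_conj] at h3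
  refine h3.congr_deriv ?_
  simp; ring

theorem tau_lattice {w1 w3 z : ℂ} : z ∈ latticeSet (tau w3) (tau w1) ↔ tau z ∈ latticeSet w1 w3 := by
  have key : ∀ {w1 w3 z : ℂ}, z ∈ latticeSet (tau w3) (tau w1) → tau z ∈ latticeSet w1 w3 := by
    rintro w1 w3 z ⟨m, n, h⟩
    refine ⟨n, m, ?_⟩
    rw [h]
    simp only [tau, map_add, map_mul, conj_I, conj_conj, map_ofNat, map_intCast]
    linear_combination (-2 * m * w3 - 2 * n * w1) * I_mul_I
  refine ⟨key, fun h => ?_⟩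
  have := key (w1 := tau w3) (w3 := tau w1) (z := tau z) (by simpa only [tau_tau] using h)
  rwa [tau_tau] at this

theorem ArcConcl.conj {S E G : Set ℂ} (h : ArcConcl S E G) :
    ArcConcl (conj '' S) (conj '' E) (conj '' G) := by
  obtain ⟨γf, γi, f1, f2, f3, i1, i2, i3, hS, ht, hb, hE, hG⟩ := h
  have an : ∀ (γ : ℝ → ℂ) t, AnalyticAt ℝ γ t → AnalyticAt ℝ (fun t => conj (γ t)) t := fun γ t h =>
    (conjCLE.toContinuousLinearMap.analyticAt _).comp h
  have de : ∀ (γ : ℝ → ℂ) t, AnalyticAt ℝ γ t → deriv γ t ≠ 0 → deriv (fun t => conj (γ t)) t ≠ 0 := by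
    intro γ t h h0
    have := (conjCLE.toContinuousLinearMap.hasFDerivAt.comp_hasDerivAt t h.differentiableAt.hasDerivAt).deriv
    have e : deriv (fun t => conj (γ t)) t = conj (deriv γ t) := this
    rw [e]
    simpa using h0
  have im : ∀ (γ : ℝ → ℂ) s, (fun t => conj (γ t)) '' s = conj '' (γ '' s) := fun γ s => by
    rw [image_image]
  refine ⟨fun t => conj (γf t), fun t => conj (γi t), fun t h => an _ _ (f1 t h), fun t h => de _ _ (f1 t h) (f2 t h),
    fun s hs t ht h => f3 hs ht ((starRingEnd ℂ).injective h), fun t h => an _ _ (i1 t h),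
    fun t h => de _ _ (i1 t h) (i2 t h),
    fun s hs t ht h => i3 hs ht ((starRingEnd ℂ).injective h), ?_, ?_, ?_, ?_, ?_⟩
  · rw [im, im, ← image_union, hS]
  · simpa using ht
  · exact (isCompact_Icc.image_of_continuousOn fun t h => (an _ _ (f1 t h)).continuousAt.continuousWithinAt).isBounded
  · rw [← hE]; simp [image_insert_eq]
  · rintro _ ⟨lam, h, rfl⟩
    rw [im]
    exact ⟨_, hG lam h, rfl⟩

namespace WeierstrassData

/-- the reflected Weierstrass data -/
def refl (W : WeierstrassData) : WeierstrassData where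
  w1 := tau W.w3
  w3 := tau W.w1
  P := fun z => -conj (W.P (tau z))
  Z := fun z => -I * conj (W.Z (tau z))
  S := fun z => I * conj (W.S (tau z))
  w1_ne := by
    intro h
    have h3 : W.w3 = 0 := by rw [← tau_tau W.w3, h]; simp [tau]
    exact W.indep 0 (by simp [h3])
  indep := by
    intro r h
    have h2 : W.w1 = (r : ℂ) * W.w3 := by
      rw [← tau_tau W.w1, h]
      simp only [tau, map_mul, conj_I, conj_conj, conj_ofReal]
      linear_combination (- r * W.w3) * I_mul_I
    have hr : (r : ℂ) ≠ 0 := by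
      intro h0
      rw [h0, zero_mul] at h2
      exact W.w1_ne h2
    apply W.indep r⁻¹
    rw [h2]; push_cast; field_simp
  P_diff := fun z hz => by
    have := (W.P_diff _ (fun h => hz (tau_lattice.2 h))).hasDerivAt
    exact (hasDerivAt_refl this).neg.differentiableAt
  P_periodic := fun w hw z => by
    show -conj (W.P (tau (z + w))) = -conj (W.P (tau z))
    rw [tau_add, W.P_periodic _ (tau_lattice.1 hw)]
  P_pole := by
    have h := (continuous_conj.tendsto 0).comp (W.P_pole.comp tau_tendsto)
    have h' := h.neg
    simp only [map_zero, neg_zero] at h'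
    refine h'.congr fun z => ?_
    simp only [Function.comp, map_sub, map_div₀, map_one, map_pow, conj_tau]
    rw [mul_pow, neg_sq, I_sq]
    rw [neg_one_mul, div_neg]; ring
  Z_diff := fun z hz => by
    have := (W.Z_diff _ (fun h => hz (tau_lattice.2 h))).hasDerivAt
    exact ((hasDerivAt_refl this).const_mul _).differentiableAt
  Z_deriv := fun z hz => by
    have hz' : tau z ∉ latticeSet W.w1 W.w3 := fun h => hz (tau_lattice.2 h)
    have := (W.Z_diff _ hz').hasDerivAt
    rw [W.Z_deriv _ hz'] at this
    rw [((hasDerivAt_refl this).const_mul (-I)).deriv]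
    simp only [map_neg, neg_neg]
    linear_combination (- conj (W.P (tau z))) * I_mul_I
  Z_odd := fun z => by
    simp only [tau_neg, W.Z_odd, map_neg, mul_neg]
  S_diff := fun z =>
    ((hasDerivAt_refl (W.S_diff (tau z)).hasDerivAt).const_mul _).differentiableAt
  S_ne := fun z hz => by
    have hz' : tau z ∉ latticeSet W.w1 W.w3 := fun h => hz (tau_lattice.2 h)
    have := W.S_ne _ hz'
    exact mul_ne_zero I_ne_zero (by simpa using this)
  S_deriv := fun z hz => by
    have hz' : tau z ∉ latticeSet W.w1 W.w3 := fun h => hz (tau_lattice.2 h)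
    have := (W.S_diff (tau z)).hasDerivAt
    rw [W.S_deriv _ hz'] at this
    rw [((hasDerivAt_refl this).const_mul I).deriv]
    simp only [map_mul]
    ring
  S_norm := by
    have h := (continuous_conj.tendsto 1).comp (W.S_norm.comp tau_tendsto)
    simp only [map_one] at h
    refine h.congr fun z => ?_
    simp only [Function.comp, map_div₀, conj_tau]
    rw [neg_mul, div_neg, ← div_div, div_I]
    ring

variable (W : WeierstrassData)

theorem refl_mem {k : ℂ} : k ∈ W.refl.lattice ↔ tau k ∈ W.lattice := tau_lattice
theorem refl_mem' {k : ℂ} : tau k ∈ W.refl.lattice ↔ k ∈ W.lattice := by rw [refl_mem, tau_tau]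
theorem refl_w2 : W.refl.w2 = tau W.w2 := by
  show tau W.w3 + tau W.w1 = _
  rw [w2, tau_add, add_comm]
theorem refl_P (k : ℂ) : W.refl.P (tau k) = -conj (W.P k) := by
  show -conj (W.P (tau (tau k))) = _
  rw [tau_tau]
theorem refl_Z (k : ℂ) : W.refl.Z (tau k) = -I * conj (W.Z k) := by
  show -I * conj (W.Z (tau (tau k))) = _
  rw [tau_tau]
theorem refl_fF (k : ℂ) : W.refl.fF (tau k) = conj (W.fF k) := by
  rw [fF, refl_w2, refl_Z, refl_Z, fF]
  simp only [tau, map_sub, map_mul]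
  linear_combination (-(conj (W.Z W.w2) * conj k) + conj W.w2 * conj (W.Z k)) * I_mul_I
theorem refl_F1 (k : ℂ) : W.refl.F1 (tau k) = -I * conj (W.F1 k) := by
  rw [F1, refl_w2, refl_Z, refl_P, F1]
  simp only [tau, map_add, map_mul]
  ring
theorem refl_Lam (k : ℂ) : W.refl.Lam (tau k) = conj (W.Lam k) := by
  rw [Lam, refl_w2, refl_P, Lam]
  simp only [tau, map_neg, map_mul, map_pow]
  linear_combination (conj W.w2 ^ 2 * conj (W.P k)) * I_mul_I

theorem refl_ESet : conj '' W.refl.ESet = W.ESet := by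
  have h : ∀ k, -W.refl.w2 ^ 2 * W.refl.P (tau k) = conj (-W.w2 ^ 2 * W.P k) := W.refl_Lam
  have h1 : -W.refl.w2 ^ 2 * W.refl.e1 = conj (-W.w2 ^ 2 * W.e3) := h _
  have h3 : -W.refl.w2 ^ 2 * W.refl.e3 = conj (-W.w2 ^ 2 * W.e1) := h _
  have h2 : -W.refl.w2 ^ 2 * W.refl.e2 = conj (-W.w2 ^ 2 * W.e2) := by
    rw [e2, refl_w2]; rw [← refl_w2]; 
    have := h W.w2
    rwa [refl_w2] at this ⊢
  rw [ESet, ESet, h1, h2, h3]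
  simp only [image_insert_eq, image_singleton, conj_conj]
  ext z; simp only [mem_insert_iff, mem_singleton_iff]; tauto

theorem refl_SSet : conj '' W.refl.SSet = W.SSet := by
  ext lam
  constructor
  · rintro ⟨_, ⟨k, hk, hu, rfl⟩, rfl⟩
    obtain ⟨l, rfl⟩ : ∃ l, k = tau l := ⟨tau k, (tau_tau k).symm⟩
    rw [refl_mem'] at hk
    rw [refl_fF, conj_re] at hu
    exact ⟨l, hk, hu, by rw [refl_Lam, conj_conj]⟩
  · rintro ⟨k, hk, hu, rfl⟩
    exact ⟨W.refl.Lam (tau k), ⟨tau k, by rwa [refl_mem'], by rwa [refl_fF, conj_re], rfl⟩, by rw [refl_Lam, conj_conj]⟩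

theorem GSet_sub_refl : W.GSet ⊆ conj '' W.refl.GSet := by
  rintro lam ⟨⟨k, hk, hu, ⟨p, hp⟩, rfl⟩, hn⟩
  refine ⟨W.refl.Lam (tau k), ⟨⟨tau k, by rwa [refl_mem'], by rwa [refl_fF, conj_re], ⟨-p, ?_⟩, rfl⟩, ?_⟩,
    by rw [refl_Lam, conj_conj]⟩
  · rw [refl_fF, conj_im, hp]; push_cast; ring
  · intro h
    apply hn
    rw [← refl_ESet]
    exact ⟨_, h, by rw [refl_Lam, conj_conj]⟩

section rect
variable {W} (hR : W.Rect)
include hR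

theorem refl_rect : W.refl.Rect := by
  obtain ⟨h1, h2, h3, h4⟩ := hR
  refine ⟨?_, ?_, ?_, ?_⟩
  · show (tau W.w3).im = 0
    simp [tau, h3]
  · show 0 < (tau W.w3).re
    simp [tau, h4]
  · show (tau W.w1).re = 0
    simp [tau, h1]
  · show 0 < (tau W.w1).im
    simp [tau, h2]
omit hR in
theorem refl_a : W.refl.a = W.b := by
  show (tau W.w3).re = W.w3.im
  simp [tau]
omit hR in
theorem refl_b : W.refl.b = W.a := by
  show (tau W.w1).im = W.w1.re
  simp [tau]

theorem concl : ArcConcl W.SSet W.ESet W.GSet := by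
  obtain ⟨x, hx, y, hy, hc⟩ := exists_crit hR
  rcases le_or_gt 0 (W.U x y) with hU | hU
  · exact concl_pos hR hx hy hc hU
  · have e : pt (-y) (-x) = -tau (pt x y) := by rw [tau_pt, pt_neg]
    have hm : tau (pt x y) ∉ W.refl.lattice := by
      rw [refl_mem']; exact int_notMem hR hx hy
    have h := concl_pos (W := W.refl) (refl_rect hR) (xc := -y) (yc := -x)
      (by rw [refl_a]; exact ⟨by linarith [hy.2], by linarith [hy.1]⟩)
      (by rw [refl_b]; exact ⟨by linarith [hx.2], by linarith [hx.1]⟩)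
      (by
        rw [e, F1, W.refl.P_even hm]
        have := W.refl_F1 (pt x y)
        rw [hc, F1] at this
        simpa using this)
      (by
        rw [U, e, fF_odd, refl_fF]
        simp only [neg_re, conj_re]
        have : (W.fF (pt x y)).re < 0 := hU
        linarith)
    obtain ⟨γf, γi, c⟩ := h.conj
    rw [refl_SSet, refl_ESet] at c
    obtain ⟨c1, c2, c3, c4, c5, c6, c7, c8, c9, c10, c11⟩ := c
    exact ⟨γf, γi, c1, c2, c3, c4, c5, c6, c7, c8, c9, c10, fun lam h => c11 lam (W.GSet_sub_refl h)⟩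

end rect
end WeierstrassData

theorem closed_gaps_main
    (W : WeierstrassData)
    (hrect : W.w1.im = 0 ∧ 0 < W.w1.re ∧ W.w3.re = 0 ∧ 0 < W.w3.im)
    (z0 : ℂ) (hz0 : ∀ x : ℝ, W.w2 * x + z0 ∉ W.lattice) :
    ArcConcl (W.lameSpectrum 1 W.w2 z0) {-W.w2 ^ 2 * W.e1, -W.w2 ^ 2 * W.e2, -W.w2 ^ 2 * W.e3}
      {lam | W.IsClosedGap W.w2 lam} := by
  have hS : W.lameSpectrum 1 W.w2 z0 = W.SSet := by
    ext lam
    constructor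
    · intro h
      obtain ⟨k, hk, hu, e⟩ := W.mem_spectrum hz0 h
      exact ⟨k, hk, hu, e⟩
    · rintro ⟨k, hk, hu, rfl⟩
      exact W.spectrum_mem hz0 hk hu
  rw [hS]
  exact WeierstrassData.concl (W := W) hrect

end part20

/-- For a rectangular lattice (`ω₁ ∈ (0,∞)`, `ω₃ ∈ i(0,∞)`)
and `ω = ω₂ = ω₁ + ω₃`, all closed spectral gaps of the complex Lamé operator
`L = -d²/dx² + 2ω²℘(ωx+z₀)` are located on the spectral arc extending to
infinity. -/
theorem closed_gaps_on_infinite_arc_rectangular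
    (W : WeierstrassData)
    (hrect : W.w1.im = 0 ∧ 0 < W.w1.re ∧ W.w3.re = 0 ∧ 0 < W.w3.im)
    (z0 : ℂ) (hz0 : ∀ x : ℝ, W.w2 * x + z0 ∉ W.lattice) :
    ∃ γf γi : ℝ → ℂ,
      AnalyticOnNhd ℝ γf (Set.Icc 0 1) ∧ (∀ t ∈ Set.Icc (0:ℝ) 1, deriv γf t ≠ 0) ∧
        Set.InjOn γf (Set.Icc 0 1) ∧
      AnalyticOnNhd ℝ γi (Set.Ici 0) ∧ (∀ t ∈ Set.Ici (0:ℝ), deriv γi t ≠ 0) ∧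
        Set.InjOn γi (Set.Ici 0) ∧
      W.lameSpectrum 1 W.w2 z0 = γf '' Set.Icc 0 1 ∪ γi '' Set.Ici 0 ∧
      Filter.Tendsto (fun t => ‖γi t‖) Filter.atTop Filter.atTop ∧
      Bornology.IsBounded (γf '' Set.Icc 0 1) ∧
      ({γf 0, γf 1, γi 0} : Set ℂ)
        = {-W.w2 ^ 2 * W.e1, -W.w2 ^ 2 * W.e2, -W.w2 ^ 2 * W.e3} ∧
      -- all closed spectral gaps lie on the arc extending to infinity
      (∀ lam : ℂ, W.IsClosedGap W.w2 lam → lam ∈ γi '' Set.Ici 0) := by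
  exact closed_gaps_main W hrect z0 hz0
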